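/- Let δ be a cardinal and let F = { X ⊆ δ : δ − X is not Woodin for strong compactness in δ }. Then F is a proper filter on δ if and only if δ is Woodin for strong compactness. -/

import Mathlib

/-!
A framework for formalizing large-cardinal notions from
"Woodin for strong compactness cardinals" over the Mathlib model `ZFSet`
of ZFC.  The ambient set-theoretic universe `V` is the type `ZFSet`;
classes are sets `Set ZFSet`; everything is relativised to a "universe
class" `W : Set ZFSet` (the ambient universe being `W = Set.univ`), so
that the same definitions can also be interpreted inside transitive set
models of ZFC (used to express the forcing/consistency results).
-/

namespace WSC

/-! ### First-order formulas in the language of set theory -/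

/-- First-order formulas in the language `{∈}`, with `n` free (de Bruijn) variables. -/
inductive Fml : ℕ → Type where
  | mem {n} : Fin n → Fin n → Fml n
  | eq  {n} : Fin n → Fin n → Fml n
  | not {n} : Fml n → Fml n
  | and {n} : Fml n → Fml n → Fml n
  | ex  {n} : Fml (n + 1) → Fml n

namespace Fml

/-- Realization of a formula over the class `C`, with all quantifiers relativised to `C`. -/
def Realize (C : Set ZFSet) : ∀ {n}, Fml n → (Fin n → ZFSet) → Prop
  | _, .mem i j, v => v i ∈ v j
  | _, .eq i j, v => v i = v j
  | _, .not φ, v => ¬ Realize C φ v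
  | _, .and φ ψ, v => Realize C φ v ∧ Realize C ψ v
  | _, .ex φ, v => ∃ x ∈ C, Realize C φ (Fin.snoc v x)

def or {n} (φ ψ : Fml n) : Fml n := .not (.and (.not φ) (.not ψ))
def imp {n} (φ ψ : Fml n) : Fml n := Fml.or (.not φ) ψ
def iff {n} (φ ψ : Fml n) : Fml n := .and (imp φ ψ) (imp ψ φ)
def all {n} (φ : Fml (n + 1)) : Fml n := .not (.ex (.not φ))

/-- Universal closure. -/
def alls : ∀ {n}, Fml n → Fml 0
  | 0, φ => φ
  | _ + 1, φ => alls (all φ)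

/-- Renaming of variables. -/
def rename : ∀ {n m}, (Fin n → Fin m) → Fml n → Fml m
  | _, _, f, .mem i j => .mem (f i) (f j)
  | _, _, f, .eq i j => .eq (f i) (f j)
  | _, _, f, .not φ => .not (rename f φ)
  | _, _, f, .and φ ψ => .and (rename f φ) (rename f ψ)
  | _, _, f, .ex φ => .ex (rename (Fin.snoc (fun i => (f i).castSucc) (Fin.last _)) φ)

end Fml

/-- A sentence `φ` holds in the class `C`. -/
def Sat (C : Set ZFSet) (φ : Fml 0) : Prop := Fml.Realize C φ (fun i => i.elim0)

/-! ### The ZFC axioms -/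

def extAx : Fml 0 :=
  Fml.all (Fml.all (Fml.imp (Fml.all (Fml.iff (.mem 2 0) (.mem 2 1))) (.eq 0 1)))

def pairAx : Fml 0 := Fml.all (Fml.all (Fml.ex (Fml.and (.mem 0 2) (.mem 1 2))))

def unionAx : Fml 0 :=
  Fml.all (Fml.ex (Fml.all (Fml.all
    (Fml.imp (Fml.and (.mem 2 3) (.mem 3 0)) (.mem 2 1)))))

def powerAx : Fml 0 :=
  Fml.all (Fml.ex (Fml.all
    (Fml.imp (Fml.all (Fml.imp (.mem 3 2) (.mem 3 0))) (.mem 2 1))))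

def infAx : Fml 0 :=
  Fml.ex (Fml.and
    (Fml.ex (Fml.and (.mem 1 0) (Fml.all (Fml.not (.mem 2 1)))))
    (Fml.all (Fml.imp (.mem 1 0)
      (Fml.ex (Fml.and (.mem 2 0)
        (Fml.all (Fml.iff (.mem 3 2) (Fml.or (.mem 3 1) (.eq 3 1)))))))))

def foundAx : Fml 0 :=
  Fml.all (Fml.imp (Fml.ex (.mem 1 0))
    (Fml.ex (Fml.and (.mem 1 0) (Fml.all (Fml.imp (.mem 2 1) (Fml.not (.mem 2 0)))))))

def choiceAx : Fml 0 :=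
  Fml.all (Fml.imp
    (Fml.and
      (Fml.all (Fml.imp (.mem 1 0) (Fml.ex (.mem 2 1))))
      (Fml.all (Fml.all (Fml.imp
        (Fml.and (.mem 1 0) (Fml.and (.mem 2 0) (Fml.ex (Fml.and (.mem 3 1) (.mem 3 2)))))
        (.eq 1 2)))))
    (Fml.ex (Fml.all (Fml.imp (.mem 2 0)
      (Fml.ex (Fml.and (Fml.and (.mem 3 2) (.mem 3 1))
        (Fml.all (Fml.imp (Fml.and (.mem 4 2) (.mem 4 1)) (.eq 4 3)))))))))

/-- An instance of the separation schema, for a formula `φ` with parameters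
`0, …, n-1` and distinguished variable `n`. -/
def sepAx (n : ℕ) (φ : Fml (n + 1)) : Fml 0 :=
  Fml.alls ((Fml.ex (Fml.all (Fml.iff
    (Fml.mem (⟨n + 2, by omega⟩ : Fin (n + 3)) ⟨n + 1, by omega⟩)
    (Fml.and (Fml.mem (⟨n + 2, by omega⟩ : Fin (n + 3)) ⟨n, by omega⟩)
      (Fml.rename (fun i => if h : (i : ℕ) < n then (⟨i, by omega⟩ : Fin (n + 3))
        else ⟨n + 2, by omega⟩) φ))))) : Fml (n + 1))

/-- An instance of the collection schema, for a formula `φ` with parameters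
`0, …, n-1` and distinguished variables `n` (input) and `n+1` (output). -/
def collAx (n : ℕ) (φ : Fml (n + 2)) : Fml 0 :=
  let φ' : Fml (n + 4) := Fml.rename (fun i => if h : (i : ℕ) < n then (⟨i, by omega⟩ : Fin (n + 4))
    else ⟨(i : ℕ) + 2, by have := i.isLt; omega⟩) φ
  Fml.alls ((Fml.ex (Fml.all
    (Fml.imp (Fml.mem (⟨n + 2, by omega⟩ : Fin (n + 3)) ⟨n, by omega⟩)
      (Fml.imp (Fml.ex φ')
        (Fml.ex (Fml.and (Fml.mem (⟨n + 3, by omega⟩ : Fin (n + 4)) ⟨n + 1, by omega⟩) φ')))))) : Fml (n + 1))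

/-- The ZFC axioms. -/
def ZFCax : Set (Fml 0) :=
  {extAx, pairAx, unionAx, powerAx, infAx, foundAx, choiceAx} ∪
    (⋃ n, Set.range (sepAx n)) ∪ (⋃ n, Set.range (collAx n))

/-- A transitive set model of ZFC. -/
def IsZFModel (m : ZFSet) : Prop := m.IsTransitive ∧ ∀ φ ∈ ZFCax, Sat m.toSet φ

/-- A countable transitive model of ZFC. -/
def IsCtm (m : ZFSet) : Prop := IsZFModel m ∧ m.toSet.Countable

/-! ### Basic set-theoretic notions -/

/-- `x` is a (von Neumann) ordinal: a transitive set of transitive sets. -/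
def IsOrd (x : ZFSet) : Prop := x.IsTransitive ∧ ∀ y ∈ x, ZFSet.IsTransitive y

/-- `x ≤ y` for ordinals. -/
def oLe (x y : ZFSet) : Prop := x ∈ y ∨ x = y

/-- `f` is a function with domain `d` (coded as a set of Kuratowski pairs). -/
def IsFuncOn (d f : ZFSet) : Prop :=
  (∀ p ∈ f, ∃ a b : ZFSet, a ∈ d ∧ p = a.pair b) ∧ ∀ a ∈ d, ∃! b : ZFSet, a.pair b ∈ f

/-- All values of the (partial) function `f` lie in `b`. -/
def MapsInto (f b : ZFSet) : Prop := ∀ x y : ZFSet, x.pair y ∈ f → y ∈ b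

/-- The function `f` is injective. -/
def InjFun (f : ZFSet) : Prop := ∀ x x' y : ZFSet, x.pair y ∈ f → x'.pair y ∈ f → x = x'

/-- `|a| ≤ |b|`, witnessed by an injection belonging to the universe class `W`. -/
def SetLeIn (W : Set ZFSet) (a b : ZFSet) : Prop :=
  ∃ f ∈ W, IsFuncOn a f ∧ MapsInto f b ∧ InjFun f

/-- `κ` is a cardinal (relative to the universe class `W`). -/
def IsCardIn (W : Set ZFSet) (κ : ZFSet) : Prop :=
  IsOrd κ ∧ ∀ α ∈ κ, ¬ SetLeIn W κ α

/-- `M` is a transitive class. -/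
def TransClass (M : Set ZFSet) : Prop := ∀ x ∈ M, ∀ y : ZFSet, y ∈ x → y ∈ M

/-- An elementary embedding `j : (W, ∈) → (M, ∈)` between two classes. -/
structure ElemEmb (W M : Set ZFSet) where
  toFun : ZFSet → ZFSet
  maps : ∀ x ∈ W, toFun x ∈ M
  elem : ∀ {n : ℕ} (φ : Fml n) (v : Fin n → ZFSet), (∀ i, v i ∈ W) →
    (Fml.Realize W φ v ↔ Fml.Realize M φ (fun i => toFun (v i)))

/-- `κ` is the critical point of `j`: the least ordinal moved. -/
def IsCrit {W M : Set ZFSet} (j : ElemEmb W M) (κ : ZFSet) : Prop :=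
  IsOrd κ ∧ j.toFun κ ≠ κ ∧ ∀ α ∈ κ, j.toFun α = α

/-! ### The rank hierarchy -/

/-- `x ∈ V_lam`. -/
def VMem (lam x : ZFSet) : Prop := x.rank < lam.rank

/-- `V_lam ⊆ M` (with `V_lam` computed in the universe class `W`). -/
def VInclIn (W M : Set ZFSet) (lam : ZFSet) : Prop := ∀ x ∈ W, VMem lam x → x ∈ M

/-- `A ⊆ V_δ`. -/
def SubV (A δ : ZFSet) : Prop := ∀ x ∈ A, VMem δ x

/-- `A ∩ V_lam = B ∩ V_lam`. -/
def AgreeBelowIn (W : Set ZFSet) (lam A B : ZFSet) : Prop :=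
  ∀ x ∈ W, VMem lam x → (x ∈ A ↔ x ∈ B)

/-- `A ∩ lam = B ∩ lam` (for sets of ordinals). -/
def AgreeMem (lam A B : ZFSet) : Prop := ∀ ξ ∈ lam, (ξ ∈ A ↔ ξ ∈ B)

/-! ### Covering properties -/

/-- `M ⊨ |s| < t`: in `M` there is an injection of `s` into some ordinal `β ∈ t`. -/
def CardLtIn (M : Set ZFSet) (s t : ZFSet) : Prop :=
  ∃ β f : ZFSet, β ∈ t ∧ f ∈ M ∧ IsFuncOn s f ∧ MapsInto f β ∧ InjFun f

/-- `j` satisfies the weak `lam`-covering property (with target class `M`):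
there is `s ∈ M` with `j '' lam ⊆ s` and `M ⊨ |s| < j κ`. -/
def WCovers (M : Set ZFSet) (j : ZFSet → ZFSet) (κ lam : ZFSet) : Prop :=
  ∃ s ∈ M, (∀ α ∈ lam, j α ∈ s) ∧ CardLtIn M s (j κ)

/-- `j` satisfies the (full) `lam`-covering property: every `X ∈ W` with
`X ⊆ M` and `|X| ≤ lam` is covered by some `s ∈ M` with `M ⊨ |s| < j κ`. -/
def CoversIn (W M : Set ZFSet) (j : ZFSet → ZFSet) (κ lam : ZFSet) : Prop :=
  ∀ X ∈ W, X.toSet ⊆ M → SetLeIn W X lam → ∃ s ∈ M, X ⊆ s ∧ CardLtIn M s (j κ)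

/-! ### Strongness -/

/-- `κ` is `lam`-strong. -/
def LamStrongIn (W : Set ZFSet) (κ lam : ZFSet) : Prop :=
  ∃ M : Set ZFSet, M ⊆ W ∧ TransClass M ∧ ∃ j : ElemEmb W M,
    IsCrit j κ ∧ lam ∈ j.toFun κ ∧ VInclIn W M lam

/-- `κ` is `lam`-strong for `A`. -/
def LamStrongForIn (W : Set ZFSet) (κ lam A : ZFSet) : Prop :=
  ∃ M : Set ZFSet, M ⊆ W ∧ TransClass M ∧ ∃ j : ElemEmb W M,
    IsCrit j κ ∧ lam ∈ j.toFun κ ∧ VInclIn W M lam ∧ AgreeBelowIn W lam A (j.toFun A)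

/-- `κ` is `<δ`-strong. -/
def LtStrongIn (W : Set ZFSet) (κ δ : ZFSet) : Prop :=
  ∀ lam : ZFSet, oLe κ lam → lam ∈ δ → LamStrongIn W κ lam

/-- `κ` is `<δ`-strong for `A`. -/
def LtStrongForIn (W : Set ZFSet) (κ δ A : ZFSet) : Prop :=
  ∀ lam : ZFSet, oLe κ lam → lam ∈ δ → LamStrongForIn W κ lam A

/-! ### Strong compactness -/

/-- `κ` is `lam`-strongly compact (there is an embedding with critical point `κ`,
`j κ > lam`, satisfying the weak `lam`-covering property). -/
def LamSCIn (W : Set ZFSet) (κ lam : ZFSet) : Prop :=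
  ∃ M : Set ZFSet, M ⊆ W ∧ TransClass M ∧ ∃ j : ElemEmb W M,
    IsCrit j κ ∧ lam ∈ j.toFun κ ∧ WCovers M j.toFun κ lam

/-- `κ` is `lam`-strongly compact for the set of ordinals `A`: there is a
`lam`-strong compactness embedding `j` (one with the full `lam`-covering
property) with critical point `κ` and `A ∩ lam = j A ∩ lam`. -/
def LamSCForIn (W : Set ZFSet) (κ lam A : ZFSet) : Prop :=
  ∃ M : Set ZFSet, M ⊆ W ∧ TransClass M ∧ ∃ j : ElemEmb W M,
    IsCrit j κ ∧ lam ∈ j.toFun κ ∧ CoversIn W M j.toFun κ lam ∧ AgreeMem lam A (j.toFun A)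

/-- `κ` is `<δ`-strongly compact. -/
def LtSCIn (W : Set ZFSet) (κ δ : ZFSet) : Prop :=
  ∀ lam : ZFSet, oLe κ lam → lam ∈ δ → LamSCIn W κ lam

/-- `κ` is `<δ`-strongly compact for `A`. -/
def LtSCForIn (W : Set ZFSet) (κ δ A : ZFSet) : Prop :=
  ∀ lam : ZFSet, oLe κ lam → lam ∈ δ → LamSCForIn W κ lam A

/-! ### Supercompactness -/

/-- `M` is closed under `lam`-sequences (from the universe class `W`). -/
def SeqClosedIn (W M : Set ZFSet) (lam : ZFSet) : Prop :=
  ∀ f ∈ W, IsFuncOn lam f → (∀ x y : ZFSet, x.pair y ∈ f → y ∈ M) → f ∈ M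

/-- `κ` is `lam`-supercompact. -/
def LamSupercompactIn (W : Set ZFSet) (κ lam : ZFSet) : Prop :=
  ∃ M : Set ZFSet, M ⊆ W ∧ TransClass M ∧ ∃ j : ElemEmb W M,
    IsCrit j κ ∧ lam ∈ j.toFun κ ∧ SeqClosedIn W M lam

/-- `κ` is `lam`-supercompact for `A`. -/
def LamSupercompactForIn (W : Set ZFSet) (κ lam A : ZFSet) : Prop :=
  ∃ M : Set ZFSet, M ⊆ W ∧ TransClass M ∧ ∃ j : ElemEmb W M,
    IsCrit j κ ∧ lam ∈ j.toFun κ ∧ SeqClosedIn W M lam ∧ AgreeBelowIn W lam A (j.toFun A)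

/-- `κ` is `<δ`-supercompact. -/
def LtSupercompactIn (W : Set ZFSet) (κ δ : ZFSet) : Prop :=
  ∀ lam : ZFSet, oLe κ lam → lam ∈ δ → LamSupercompactIn W κ lam

/-- `κ` is `<δ`-supercompact for `A`. -/
def LtSupercompactForIn (W : Set ZFSet) (κ δ A : ZFSet) : Prop :=
  ∀ lam : ZFSet, oLe κ lam → lam ∈ δ → LamSupercompactForIn W κ lam A

/-! ### The global large-cardinal notions -/

/-- `δ` is a Woodin cardinal. -/
def WoodinIn (W : Set ZFSet) (δ : ZFSet) : Prop :=
  IsCardIn W δ ∧ ∀ A ∈ W, SubV A δ → ∃ κ, κ ∈ δ ∧ LtStrongForIn W κ δ A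

/-- `δ` is a Woodin for strong compactness cardinal. -/
def WoodinSCIn (W : Set ZFSet) (δ : ZFSet) : Prop :=
  IsCardIn W δ ∧ ∀ A ∈ W, A ⊆ δ → ∃ κ, κ ∈ δ ∧ LtSCForIn W κ δ A

/-- `δ` is a Vopěnka cardinal. -/
def VopenkaIn (W : Set ZFSet) (δ : ZFSet) : Prop :=
  IsCardIn W δ ∧ ∀ A ∈ W, SubV A δ → ∃ κ, κ ∈ δ ∧ LtSupercompactForIn W κ δ A

/-- `δ` is Woodin and a limit of `<δ`-supercompact cardinals. -/
def WoodinLimSupercompactIn (W : Set ZFSet) (δ : ZFSet) : Prop :=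
  WoodinIn W δ ∧ ∀ α ∈ δ, ∃ κ : ZFSet, α ∈ κ ∧ κ ∈ δ ∧ LtSupercompactIn W κ δ

/-! ### Inaccessibility -/

/-- `δ` is a regular ordinal: the range of any function from a smaller
ordinal into `δ` is bounded. -/
def RegularIn (W : Set ZFSet) (δ : ZFSet) : Prop :=
  IsOrd δ ∧ ∀ α ∈ δ, ∀ f ∈ W, IsFuncOn α f → MapsInto f δ →
    ∃ β ∈ δ, ∀ x y : ZFSet, x.pair y ∈ f → y ∈ β

/-- The power set of `x` relative to `W`. -/
def powersetIn (W : Set ZFSet) (x : ZFSet) : ZFSet := ZFSet.sep (fun z => z ∈ W) x.powerset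

/-- `δ` is a strong limit cardinal. -/
def StrongLimitIn (W : Set ZFSet) (δ : ZFSet) : Prop :=
  IsCardIn W δ ∧ ∀ α ∈ δ, ∃ β ∈ δ, SetLeIn W (powersetIn W α) β

/-- `δ` is inaccessible: an uncountable regular strong limit cardinal. -/
def InaccessibleIn (W : Set ZFSet) (δ : ZFSet) : Prop :=
  ZFSet.omega ∈ δ ∧ IsCardIn W δ ∧ RegularIn W δ ∧ StrongLimitIn W δ

/-! ### Ultrafilters and measurability -/

/-- Relative complement `a \ b`. -/
def zdiff (a b : ZFSet) : ZFSet := ZFSet.sep (fun x => x ∉ b) a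

/-- Intersection `a ∩ b`. -/
def zinter (a b : ZFSet) : ZFSet := ZFSet.sep (fun x => x ∈ b) a

/-- `U` is a nonprincipal `α`-complete ultrafilter on `α`. -/
def IsUfOnIn (W : Set ZFSet) (α U : ZFSet) : Prop :=
  (∀ x ∈ U, x ⊆ α) ∧ α ∈ U ∧ (∅ : ZFSet) ∉ U ∧
  (∀ x ∈ U, ∀ y : ZFSet, y ∈ W → y ⊆ α → x ⊆ y → y ∈ U) ∧
  (∀ x ∈ W, x ⊆ α → (x ∈ U ∨ zdiff α x ∈ U)) ∧
  (∀ β ∈ α, ∀ g ∈ W, IsFuncOn β g → MapsInto g U →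
    ZFSet.sep (fun ξ => ∀ p q : ZFSet, p.pair q ∈ g → ξ ∈ q) α ∈ U) ∧
  (∀ ξ ∈ α, ZFSet.sep (fun x => x = ξ) α ∉ U)

/-- `U` is a normal ultrafilter on `α`: a nonprincipal `α`-complete
ultrafilter closed under diagonal intersections. -/
def IsNormalUfOnIn (W : Set ZFSet) (α U : ZFSet) : Prop :=
  IsUfOnIn W α U ∧
    ∀ g ∈ W, IsFuncOn α g → MapsInto g U →
      ZFSet.sep (fun ξ => ∀ p q : ZFSet, p.pair q ∈ g → p ∈ ξ → ξ ∈ q) α ∈ U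

/-- `α` is a measurable cardinal. -/
def MeasurableIn (W : Set ZFSet) (α : ZFSet) : Prop := ∃ U ∈ W, IsUfOnIn W α U

/-! ### Functions `f : δ → δ` and closure points -/

/-- `f` codes a function from `δ` to `δ`. -/
def FuncSelf (δ f : ZFSet) : Prop := IsFuncOn δ f ∧ MapsInto f δ

/-- `κ` is a closure point of `f`, i.e. `f '' κ ⊆ κ`. -/
def ClosurePt (f κ : ZFSet) : Prop := ∀ x y : ZFSet, x.pair y ∈ f → x ∈ κ → y ∈ κ

/-! ### GCH -/

/-- GCH: for every infinite cardinal `κ`, any family of subsets of `κ` has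
size at most `κ` or size at least that of the full power set of `κ`. -/
def GCHIn (W : Set ZFSet) : Prop :=
  ∀ κ ∈ W, IsCardIn W κ → oLe ZFSet.omega κ →
    ∀ X ∈ W, (∀ z ∈ X, z ⊆ κ) → (SetLeIn W X κ ∨ SetLeIn W (powersetIn W κ) X)

/-! ### Forcing -/

/-- `(P, R)` is a forcing notion (a preordered set, `x.pair y ∈ R` meaning
`x ≤ y`, i.e. `x` is stronger than `y`). -/
def IsPoset (P R : ZFSet) : Prop :=
  (∀ p ∈ P, p.pair p ∈ R) ∧
  (∀ p q r : ZFSet, p.pair q ∈ R → q.pair r ∈ R → p.pair r ∈ R) ∧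
  (∀ x y : ZFSet, x.pair y ∈ R → x ∈ P ∧ y ∈ P)

/-- `G` is an `m`-generic filter on the forcing notion `(P, R) ∈ m`. -/
def IsGenericFilter (m P R G : ZFSet) : Prop :=
  G ⊆ P ∧
  (∀ p ∈ G, ∀ q ∈ P, p.pair q ∈ R → q ∈ G) ∧
  (∀ p ∈ G, ∀ q ∈ G, ∃ r ∈ G, r.pair p ∈ R ∧ r.pair q ∈ R) ∧
  (∀ D ∈ m, (D ⊆ P ∧ ∀ p ∈ P, ∃ q ∈ D, q.pair p ∈ R) → ∃ q, q ∈ G ∧ q ∈ D)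

/-- `n = m[G]` : `n` is a transitive ZFC-model extending `m` and containing
`G`, and is the least such. -/
def IsGenericExt (m G n : ZFSet) : Prop :=
  IsZFModel n ∧ m ⊆ n ∧ G ∈ n ∧
    ∀ n' : ZFSet, IsZFModel n' → m ⊆ n' → G ∈ n' → n ⊆ n'

/-- `n` is a (set-)forcing extension of the transitive model `m`. -/
def IsForcingExt (m n : ZFSet) : Prop :=
  ∃ P R G : ZFSet, P ∈ m ∧ R ∈ m ∧ IsPoset P R ∧
    IsGenericFilter m P R G ∧ IsGenericExt m G n

/-! ### Ambient (full-universe) abbreviations -/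

abbrev LamStrong (κ lam : ZFSet) : Prop := LamStrongIn Set.univ κ lam
abbrev LamStrongFor (κ lam A : ZFSet) : Prop := LamStrongForIn Set.univ κ lam A
abbrev LtStrong (κ δ : ZFSet) : Prop := LtStrongIn Set.univ κ δ
abbrev LtStrongFor (κ δ A : ZFSet) : Prop := LtStrongForIn Set.univ κ δ A
abbrev LamSC (κ lam : ZFSet) : Prop := LamSCIn Set.univ κ lam
abbrev LamSCFor (κ lam A : ZFSet) : Prop := LamSCForIn Set.univ κ lam A
abbrev LtSC (κ δ : ZFSet) : Prop := LtSCIn Set.univ κ δ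
abbrev LtSCFor (κ δ A : ZFSet) : Prop := LtSCForIn Set.univ κ δ A
abbrev LamSupercompact (κ lam : ZFSet) : Prop := LamSupercompactIn Set.univ κ lam
abbrev LtSupercompact (κ δ : ZFSet) : Prop := LtSupercompactIn Set.univ κ δ
abbrev Woodin (δ : ZFSet) : Prop := WoodinIn Set.univ δ
abbrev WoodinSC (δ : ZFSet) : Prop := WoodinSCIn Set.univ δ
abbrev Vopenka (δ : ZFSet) : Prop := VopenkaIn Set.univ δ
abbrev IsCard (κ : ZFSet) : Prop := IsCardIn Set.univ κ
abbrev Inaccessible (δ : ZFSet) : Prop := InaccessibleIn Set.univ δ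
abbrev Covers (M : Set ZFSet) (j : ZFSet → ZFSet) (κ lam : ZFSet) : Prop :=
  CoversIn Set.univ M j κ lam
abbrev VIncl (M : Set ZFSet) (lam : ZFSet) : Prop := VInclIn Set.univ M lam
abbrev AgreeBelow (lam A B : ZFSet) : Prop := AgreeBelowIn Set.univ lam A B
abbrev SeqClosed (M : Set ZFSet) (lam : ZFSet) : Prop := SeqClosedIn Set.univ M lam

/-- `X ⊆ δ` is *Woodin for strong compactness in `δ`*: for every `f : δ → δ`
there is `κ ∈ X` which is a closure point of `f` and an embedding `j : V → M`
with critical point `κ`, satisfying the weak `(j f)(κ)`-covering property and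
`V_{(j f)(κ)} ⊆ M`. -/
def WSCinSet (δ X : ZFSet) : Prop :=
  ∀ f : ZFSet, FuncSelf δ f → ∃ κ : ZFSet, κ ∈ X ∧ ClosurePt f κ ∧
    ∃ (M : Set ZFSet) (j : ElemEmb Set.univ M) (y : ZFSet), TransClass M ∧
      IsCrit j κ ∧ κ.pair y ∈ j.toFun f ∧ WCovers M j.toFun κ y ∧ VIncl M y

/-- The collection `F = {X ⊆ δ ∣ δ - X is not Woodin for strong compactness in δ}`. -/
def Fset (δ : ZFSet) : Set ZFSet := {X : ZFSet | X ⊆ δ ∧ ¬ WSCinSet δ (zdiff δ X)}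

/-- `F` is a proper filter on `δ`: a nonempty collection of subsets of `δ`
closed under supersets and (finite) intersections, not containing `∅`. -/
def IsProperFilterOn (δ : ZFSet) (F : Set ZFSet) : Prop :=
  F.Nonempty ∧ (∀ X ∈ F, X ⊆ δ) ∧ (∅ : ZFSet) ∉ F ∧
  (∀ X ∈ F, ∀ Y : ZFSet, Y ⊆ δ → X ⊆ Y → Y ∈ F) ∧
  (∀ X ∈ F, ∀ Y ∈ F, zinter X Y ∈ F)

/-!
### The proof

Since `F` is a proper filter exactly when `δ` is Woodin for strong compactness in itself, the two
implications reduce to the following. If `δ` is Woodin for strong compactness, a function `f` and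
the membership relation of `V_δ` are coded by a subset of `δ`. Conversely, a failure of strong
compactness for `A` gives a function `f` bounding the failures; for the embedding `j` provided by
`f`, the ultrafilter derived from a cover of `j '' l` and from countable pieces of `j` belongs to
the target of `j`, and its ultrapower refutes the failure there.
-/

section Proof

universe u w

open ZFSet Cardinal

section Definability

variable {n : ℕ}

/-- `P` is uniformly definable over transitive classes. -/
class Dfn (P : Set ZFSet.{u} → (Fin n → ZFSet.{u}) → Prop) : Prop where
  out : ∃ φ : Fml n, ∀ C v, TransClass C → (∀ i, v i ∈ C) → (Fml.Realize C φ v ↔ P C v)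

/-- `s` is a variable. -/
class IsVar (s : (Fin n → ZFSet.{u}) → ZFSet.{u}) : Prop where
  out : ∃ i, ∀ v, s v = v i

instance isVar_apply (i : Fin n) : IsVar (fun v : Fin n → ZFSet.{u} => v i) := ⟨i, fun _ => rfl⟩

variable {P Q : Set ZFSet.{u} → (Fin n → ZFSet.{u}) → Prop}
variable {a b c d : (Fin n → ZFSet.{u}) → ZFSet.{u}}

theorem Dfn.congr (h : Dfn P) (e : ∀ C v, TransClass C → (∀ i, v i ∈ C) → (P C v ↔ Q C v)) :
    Dfn Q := by
  obtain ⟨φ, hφ⟩ := h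
  exact ⟨φ, fun C v hC hv => (hφ C v hC hv).trans (e C v hC hv)⟩

theorem IsVar.mem_class [h : IsVar a] {C : Set ZFSet.{u}} {v : Fin n → ZFSet.{u}}
    (hv : ∀ i, v i ∈ C) : a v ∈ C := by
  obtain ⟨i, hi⟩ := h
  exact hi v ▸ hv i

instance (priority := low) IsVar.lift [h : IsVar a] :
    IsVar (fun w : Fin (n + 1) → ZFSet.{u} => a (fun i => w i.castSucc)) := by
  obtain ⟨i, hi⟩ := h
  exact ⟨i.castSucc, fun w => hi _⟩

instance dfn_mem [ha : IsVar a] [hb : IsVar b] : Dfn (fun _ v => a v ∈ b v) := by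
  obtain ⟨i, hi⟩ := ha
  obtain ⟨k, hk⟩ := hb
  exact ⟨.mem i k, fun C v _ _ => by simp [Fml.Realize, hi, hk]⟩

instance dfn_eq [ha : IsVar a] [hb : IsVar b] : Dfn (fun _ v => a v = b v) := by
  obtain ⟨i, hi⟩ := ha
  obtain ⟨k, hk⟩ := hb
  exact ⟨.eq i k, fun C v _ _ => by simp [Fml.Realize, hi, hk]⟩

instance dfn_not [hP : Dfn P] : Dfn (fun C v => ¬ P C v) := by
  obtain ⟨φ, hφ⟩ := hP
  exact ⟨.not φ, fun C v hC hv => by simp [Fml.Realize, hφ C v hC hv]⟩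

instance dfn_and [hP : Dfn P] [hQ : Dfn Q] : Dfn (fun C v => P C v ∧ Q C v) := by
  obtain ⟨φ, hφ⟩ := hP
  obtain ⟨ψ, hψ⟩ := hQ
  exact ⟨.and φ ψ, fun C v hC hv => by simp [Fml.Realize, hφ C v hC hv, hψ C v hC hv]⟩

instance dfn_or [Dfn P] [Dfn Q] : Dfn (fun C v => P C v ∨ Q C v) :=
  (inferInstance : Dfn (fun C v => ¬ (¬ P C v ∧ ¬ Q C v))).congr fun _ _ _ _ => by tauto

instance dfn_imp [Dfn P] [Dfn Q] : Dfn (fun C v => P C v → Q C v) :=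
  (inferInstance : Dfn (fun C v => ¬ (P C v ∧ ¬ Q C v))).congr fun _ _ _ _ => by tauto

instance dfn_iff [Dfn P] [Dfn Q] : Dfn (fun C v => P C v ↔ Q C v) :=
  (inferInstance : Dfn (fun C v => (P C v → Q C v) ∧ (Q C v → P C v))).congr
    fun _ _ _ _ => by tauto

variable {R : Set ZFSet.{u} → (Fin n → ZFSet.{u}) → ZFSet.{u} → Prop}

instance dfn_exC [hR : Dfn (fun C (w : Fin (n + 1) → ZFSet.{u}) =>
    R C (fun i => w i.castSucc) (w (Fin.last n)))] :
    Dfn (fun C v => ∃ x ∈ C, R C v x) := by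
  obtain ⟨φ, hφ⟩ := hR
  refine ⟨.ex φ, fun C v hC hv => ?_⟩
  simp only [Fml.Realize]
  refine exists_congr fun x => and_congr_right fun hx => ?_
  rw [hφ C _ hC]
  · simp
  · intro i
    refine Fin.lastCases ?_ (fun i => ?_) i
    · simpa using hx
    · simpa using hv i

theorem dfn_ex (hR : Dfn (fun C (w : Fin (n + 1) → ZFSet.{u}) =>
    R C (fun i => w i.castSucc) (w (Fin.last n))))
    (h : ∀ C v x, TransClass C → (∀ i, v i ∈ C) → R C v x → x ∈ C) :
    Dfn (fun C v => ∃ x, R C v x) :=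
  (dfn_exC (R := R)).congr fun C v hC hv =>
    ⟨fun ⟨x, _, hx⟩ => ⟨x, hx⟩, fun ⟨x, hx⟩ => ⟨x, h C v x hC hv hx, hx⟩⟩

instance dfn_allC [hR : Dfn (fun C (w : Fin (n + 1) → ZFSet.{u}) =>
    R C (fun i => w i.castSucc) (w (Fin.last n)))] :
    Dfn (fun C v => ∀ x ∈ C, R C v x) :=
  (inferInstance : Dfn (fun C v => ¬ ∃ x ∈ C, ¬ R C v x)).congr
    fun _ _ _ _ => by push Not; rfl

instance dfn_exMem [ha : IsVar a] [hR : Dfn (fun C (w : Fin (n + 1) → ZFSet.{u}) =>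
    R C (fun i => w i.castSucc) (w (Fin.last n)))] :
    Dfn (fun C v => ∃ x ∈ a v, R C v x) := by
  exact dfn_ex (R := fun C v x => x ∈ a v ∧ R C v x) inferInstance
    fun C v x hC hv h => hC _ (ha.mem_class hv) _ h.1

instance dfn_allMem [ha : IsVar a] [hR : Dfn (fun C (w : Fin (n + 1) → ZFSet.{u}) =>
    R C (fun i => w i.castSucc) (w (Fin.last n)))] :
    Dfn (fun C v => ∀ x ∈ a v, R C v x) :=
  (inferInstance : Dfn (fun C v => ¬ ∃ x ∈ a v, ¬ R C v x)).congr
    fun _ _ _ _ => by push Not; rfl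

instance dfn_subset [IsVar a] [IsVar b] : Dfn (fun _ v => a v ⊆ b v) := by
  exact (inferInstance : Dfn (fun _ v => ∀ x ∈ a v, x ∈ b v)).congr
    fun _ _ _ _ => Iff.rfl

theorem Fml.realize_rename (C : Set ZFSet.{u}) {m k : ℕ} (φ : Fml m) (f : Fin m → Fin k)
    (v : Fin k → ZFSet.{u}) : Realize C (rename f φ) v ↔ Realize C φ (fun i => v (f i)) := by
  induction φ generalizing k with
  | mem i j => rfl
  | eq i j => rfl
  | not φ ih => simp [rename, Realize, ih]
  | and φ ψ ih ih' => simp [rename, Realize, ih, ih']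
  | ex φ ih =>
    simp only [rename, Realize, ih]
    refine exists_congr fun x => and_congr_right fun _ => ?_
    have : (fun i => (Fin.snoc v x : Fin (k + 1) → ZFSet.{u})
        ((Fin.snoc (fun i => (f i).castSucc) (Fin.last k) : Fin _ → Fin (k + 1)) i)) =
        (Fin.snoc (fun i => v (f i)) x : Fin _ → ZFSet.{u}) := by
      funext i
      refine Fin.lastCases ?_ (fun i => ?_) i <;> simp
    rw [this]

theorem Dfn.subst {k : ℕ} {P : Set ZFSet.{u} → (Fin k → ZFSet.{u}) → Prop} (h : Dfn P)
    (s : Fin k → (Fin n → ZFSet.{u}) → ZFSet.{u}) (hs : ∀ i, IsVar (s i)) :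
    Dfn (fun C v => P C (fun i => s i v)) := by
  choose f hf using fun i => (hs i).out
  obtain ⟨φ, hφ⟩ := h
  refine ⟨φ.rename f, fun C v hC hv => ?_⟩
  rw [Fml.realize_rename, hφ _ _ hC fun i => hv _]
  simp only [hf]

theorem Dfn.subst1 {F : Set ZFSet.{u} → ZFSet.{u} → Prop}
    (h : Dfn (fun C (v : Fin 1 → ZFSet.{u}) => F C (v 0))) [ha : IsVar a] :
    Dfn (fun C v => F C (a v)) :=
  h.subst ![a] (by simpa [Fin.forall_fin_succ])

theorem Dfn.subst2 {F : Set ZFSet.{u} → ZFSet.{u} → ZFSet.{u} → Prop}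
    (h : Dfn (fun C (v : Fin 2 → ZFSet.{u}) => F C (v 0) (v 1))) [ha : IsVar a] [hb : IsVar b] :
    Dfn (fun C v => F C (a v) (b v)) :=
  h.subst ![a, b] (by simp [Fin.forall_fin_succ, ha, hb])

theorem Dfn.subst3 {F : Set ZFSet.{u} → ZFSet.{u} → ZFSet.{u} → ZFSet.{u} → Prop}
    (h : Dfn (fun C (v : Fin 3 → ZFSet.{u}) => F C (v 0) (v 1) (v 2)))
    [ha : IsVar a] [hb : IsVar b] [hc : IsVar c] :
    Dfn (fun C v => F C (a v) (b v) (c v)) :=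
  h.subst ![a, b, c] (by simp [Fin.forall_fin_succ, ha, hb, hc])

theorem Dfn.subst4 {F : Set ZFSet.{u} → ZFSet.{u} → ZFSet.{u} → ZFSet.{u} → ZFSet.{u} → Prop}
    (h : Dfn (fun C (v : Fin 4 → ZFSet.{u}) => F C (v 0) (v 1) (v 2) (v 3)))
    [ha : IsVar a] [hb : IsVar b] [hc : IsVar c] [hd : IsVar d] :
    Dfn (fun C v => F C (a v) (b v) (c v) (d v)) :=
  h.subst ![a, b, c, d] (by simp [Fin.forall_fin_succ, ha, hb, hc, hd])

theorem eq_pair_iff (p b c : ZFSet.{u}) :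
    ((∃ q ∈ p, (∀ x ∈ q, x = b) ∧ b ∈ q) ∧
    (∃ q ∈ p, (∀ x ∈ q, x = b ∨ x = c) ∧ b ∈ q ∧ c ∈ q) ∧
    (∀ q ∈ p, ((∀ x ∈ q, x = b) ∧ b ∈ q) ∨
      ((∀ x ∈ q, x = b ∨ x = c) ∧ b ∈ q ∧ c ∈ q))) ↔ p = b.pair c := by
  have h1 : ∀ p : ZFSet, ((∀ x ∈ p, x = b) ∧ b ∈ p) ↔ p = {b} := fun p => by
    constructor
    · rintro ⟨h, h'⟩
      ext z
      simpa using ⟨h z, fun e => e ▸ h'⟩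
    · rintro rfl; simp
  have h2 : ∀ p : ZFSet, ((∀ x ∈ p, x = b ∨ x = c) ∧ b ∈ p ∧ c ∈ p) ↔
      p = {b, c} := fun p => by
    constructor
    · rintro ⟨h, h', h''⟩
      ext z
      simpa using ⟨h z, fun e => e.elim (· ▸ h') (· ▸ h'')⟩
    · rintro rfl; simp
  simp only [h1, h2, exists_eq_right]
  constructor
  · rintro ⟨h, h', h''⟩
    ext z
    simp only [ZFSet.pair, ZFSet.mem_pair]
    exact ⟨h'' z, fun e => e.elim (· ▸ h) (· ▸ h')⟩
  · intro e
    simp [e, ZFSet.pair]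

instance dfn_isPair [IsVar a] [IsVar b] [IsVar c] : Dfn (fun _ v => a v = (b v).pair (c v)) :=
  Dfn.subst3 (F := fun _ a b c => a = b.pair c)
    (Dfn.congr (inferInstance : Dfn (fun _ (v : Fin 3 → ZFSet.{u}) =>
      (∃ q ∈ v 0, (∀ x ∈ q, x = v 1) ∧ v 1 ∈ q) ∧
      (∃ q ∈ v 0, (∀ x ∈ q, x = v 1 ∨ x = v 2) ∧ v 1 ∈ q ∧ v 2 ∈ q) ∧
      (∀ q ∈ v 0, ((∀ x ∈ q, x = v 1) ∧ v 1 ∈ q) ∨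
      ((∀ x ∈ q, x = v 1 ∨ x = v 2) ∧ v 1 ∈ q ∧ v 2 ∈ q)))) fun _ _ _ _ => eq_pair_iff _ _ _)

theorem TransClass.of_pair {C : Set ZFSet.{u}} (hC : TransClass C) {x y : ZFSet.{u}}
    (h : x.pair y ∈ C) : x ∈ C ∧ y ∈ C := by
  have h2 : ({x, y} : ZFSet) ∈ C := hC _ h _ (by simp [ZFSet.pair])
  exact ⟨hC _ h2 _ (by simp), hC _ h2 _ (by simp)⟩

theorem TransClass.of_pair_mem {C : Set ZFSet.{u}} (hC : TransClass C) {x y f : ZFSet.{u}}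
    (hf : f ∈ C) (h : x.pair y ∈ f) : x ∈ C ∧ y ∈ C :=
  hC.of_pair (hC _ hf _ h)

instance dfn_pairMem [IsVar a] [IsVar b] [IsVar c] : Dfn (fun _ v => (a v).pair (b v) ∈ c v) :=
  (inferInstance : Dfn (fun _ v => ∃ p ∈ c v, p = (a v).pair (b v))).congr
    fun _ _ _ _ => by simp

instance dfn_pairMem' [IsVar a] [IsVar b] [IsVar c] [IsVar d] :
    Dfn (fun _ v => ((a v).pair (b v)).pair (c v) ∈ d v) :=
  (dfn_ex (R := fun _ v x => x = (a v).pair (b v) ∧ x.pair (c v) ∈ d v) inferInstance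
    (fun C v x hC hv h => (hC.of_pair_mem (IsVar.mem_class hv) h.2).1)).congr
    fun _ _ _ _ => by simp

instance dfn_exSnd [IsVar a] [IsVar c] [hR : Dfn (fun C (w : Fin (n + 1) → ZFSet.{u}) =>
    R C (fun i => w i.castSucc) (w (Fin.last n)))] :
    Dfn (fun C v => ∃ x, (c v).pair x ∈ a v ∧ R C v x) :=
  dfn_ex (R := fun C v x => (c v).pair x ∈ a v ∧ R C v x) inferInstance
    fun _ _ _ hC hv h => (hC.of_pair_mem (IsVar.mem_class hv) h.1).2

instance dfn_allSnd [IsVar a] [IsVar c] [hR : Dfn (fun C (w : Fin (n + 1) → ZFSet.{u}) =>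
    R C (fun i => w i.castSucc) (w (Fin.last n)))] :
    Dfn (fun C v => ∀ x, (c v).pair x ∈ a v → R C v x) :=
  (inferInstance : Dfn (fun C v => ¬ ∃ x, (c v).pair x ∈ a v ∧ ¬ R C v x)).congr
    fun _ _ _ _ => by push Not; rfl

instance dfn_exFst [IsVar a] [IsVar c] [hR : Dfn (fun C (w : Fin (n + 1) → ZFSet.{u}) =>
    R C (fun i => w i.castSucc) (w (Fin.last n)))] :
    Dfn (fun C v => ∃ x : ZFSet, x.pair (c v) ∈ a v ∧ R C v x) :=
  dfn_ex (R := fun C v x => x.pair (c v) ∈ a v ∧ R C v x) inferInstance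
    fun _ _ _ hC hv h => (hC.of_pair_mem (IsVar.mem_class hv) h.1).1

instance dfn_allFst [IsVar a] [IsVar c] [hR : Dfn (fun C (w : Fin (n + 1) → ZFSet.{u}) =>
    R C (fun i => w i.castSucc) (w (Fin.last n)))] :
    Dfn (fun C v => ∀ x : ZFSet, x.pair (c v) ∈ a v → R C v x) :=
  (inferInstance : Dfn (fun C v => ¬ ∃ x, x.pair (c v) ∈ a v ∧ ¬ R C v x)).congr
    fun _ _ _ _ => by push Not; rfl

variable {S : Set ZFSet.{u} → (Fin n → ZFSet.{u}) → ZFSet.{u} → ZFSet.{u} → Prop}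

instance dfn_exPair [IsVar a] [hS : Dfn (fun C (w : Fin (n + 1 + 1) → ZFSet.{u}) =>
    S C (fun i => w i.castSucc.castSucc) (w (Fin.last n).castSucc) (w (Fin.last (n + 1))))] :
    Dfn (fun C v => ∃ x y : ZFSet, x.pair y ∈ a v ∧ S C v x y) := by
  refine dfn_ex (R := fun C v x => ∃ y, x.pair y ∈ a v ∧ S C v x y) ?_
    (fun C v x hC hv ⟨y, h⟩ => (hC.of_pair_mem (IsVar.mem_class hv) h.1).1)
  refine dfn_ex (R := fun C w y => (w (Fin.last n)).pair y ∈ a (fun i => w i.castSucc) ∧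
    S C (fun i => w i.castSucc) (w (Fin.last n)) y) ?_
    (fun C v x hC hv h => (hC.of_pair_mem
      (IsVar.mem_class (a := fun w => a (fun i => w i.castSucc)) hv) h.1).2)
  have := IsVar.lift (a := fun w : Fin (n + 1) → ZFSet.{u} => a (fun i => w i.castSucc))
  infer_instance

instance dfn_allPair [IsVar a] [hS : Dfn (fun C (w : Fin (n + 1 + 1) → ZFSet.{u}) =>
    S C (fun i => w i.castSucc.castSucc) (w (Fin.last n).castSucc) (w (Fin.last (n + 1))))] :
    Dfn (fun C v => ∀ x y : ZFSet, x.pair y ∈ a v → S C v x y) :=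
  (inferInstance : Dfn (fun C v => ¬ ∃ x y : ZFSet, x.pair y ∈ a v ∧ ¬ S C v x y)).congr
    fun _ _ _ _ => by push Not; rfl

end Definability

section Transfer

variable {M : Set ZFSet.{u}} (j : ElemEmb (Set.univ : Set ZFSet.{u}) M)

theorem transfer (hM : TransClass M) {n : ℕ}
    (P : Set ZFSet.{u} → (Fin n → ZFSet.{u}) → Prop) [hP : Dfn P]
    (v : Fin n → ZFSet.{u}) : P Set.univ v ↔ P M (fun i => j.toFun (v i)) := by
  obtain ⟨φ, hφ⟩ := hP
  have h1 := hφ Set.univ v (fun _ _ _ _ => trivial) (fun _ => trivial)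
  have h2 := hφ M (fun i => j.toFun (v i)) hM (fun i => j.maps _ trivial)
  exact h1.symm.trans ((j.elem φ v fun _ => trivial).trans h2)

theorem transfer1 (hM : TransClass M) (P : Set ZFSet.{u} → ZFSet.{u} → Prop)
    [hP : Dfn (fun C (v : Fin 1 → ZFSet.{u}) => P C (v 0))] (a : ZFSet.{u}) :
    P Set.univ a ↔ P M (j.toFun a) :=
  transfer j hM (fun C (v : Fin 1 → ZFSet.{u}) => P C (v 0)) ![a]

theorem transfer2 (hM : TransClass M) (P : Set ZFSet.{u} → ZFSet.{u} → ZFSet.{u} → Prop)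
    [hP : Dfn (fun C (v : Fin 2 → ZFSet.{u}) => P C (v 0) (v 1))] (a b : ZFSet.{u}) :
    P Set.univ a b ↔ P M (j.toFun a) (j.toFun b) :=
  transfer j hM (fun C (v : Fin 2 → ZFSet.{u}) => P C (v 0) (v 1)) ![a, b]

theorem transfer3 (hM : TransClass M)
    (P : Set ZFSet.{u} → ZFSet.{u} → ZFSet.{u} → ZFSet.{u} → Prop)
    [hP : Dfn (fun C (v : Fin 3 → ZFSet.{u}) => P C (v 0) (v 1) (v 2))] (a b c : ZFSet.{u}) :
    P Set.univ a b c ↔ P M (j.toFun a) (j.toFun b) (j.toFun c) :=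
  transfer j hM (fun C (v : Fin 3 → ZFSet.{u}) => P C (v 0) (v 1) (v 2)) ![a, b, c]

theorem transfer4 (hM : TransClass M)
    (P : Set ZFSet.{u} → ZFSet.{u} → ZFSet.{u} → ZFSet.{u} → ZFSet.{u} → Prop)
    [hP : Dfn (fun C (v : Fin 4 → ZFSet.{u}) => P C (v 0) (v 1) (v 2) (v 3))]
    (a b c d : ZFSet.{u}) :
    P Set.univ a b c d ↔ P M (j.toFun a) (j.toFun b) (j.toFun c) (j.toFun d) :=
  transfer j hM (fun C (v : Fin 4 → ZFSet.{u}) => P C (v 0) (v 1) (v 2) (v 3)) ![a, b, c, d]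

end Transfer

section Basic

theorem isOrd_iff {x : ZFSet.{u}} : IsOrd x ↔ x.IsOrdinal :=
  isOrdinal_iff_forall_mem_isTransitive.symm

theorem IsOrd.isOrdinal {x : ZFSet.{u}} (h : IsOrd x) : x.IsOrdinal := isOrd_iff.1 h

/-- The graph of `F` on `d`, as a set. -/
noncomputable def graph (d : ZFSet.{u}) (F : ZFSet.{u} → ZFSet.{u}) : ZFSet.{u} :=
  ZFSet.range (fun x : d => (x : ZFSet.{u}).pair (F x))

theorem mem_graph {d p : ZFSet.{u}} {F : ZFSet.{u} → ZFSet.{u}} :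
    p ∈ graph d F ↔ ∃ x ∈ d, p = x.pair (F x) := by
  simp only [graph, ZFSet.mem_range, Subtype.exists]
  exact ⟨fun ⟨x, h, e⟩ => ⟨x, h, e.symm⟩, fun ⟨x, h, e⟩ => ⟨x, h, e.symm⟩⟩

@[simp]
theorem pair_mem_graph {d x y : ZFSet.{u}} {F : ZFSet.{u} → ZFSet.{u}} :
    x.pair y ∈ graph d F ↔ x ∈ d ∧ y = F x := by
  rw [mem_graph]
  constructor
  · rintro ⟨z, hz, e⟩
    obtain ⟨rfl, rfl⟩ := pair_inj.1 e
    exact ⟨hz, rfl⟩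
  · rintro ⟨h, rfl⟩
    exact ⟨x, h, rfl⟩

theorem isFuncOn_graph (d : ZFSet.{u}) (F : ZFSet.{u} → ZFSet.{u}) : IsFuncOn d (graph d F) := by
  refine ⟨fun p hp => ?_, fun a ha => ⟨F a, by simpa using ha, fun b hb => (pair_mem_graph.1 hb).2⟩⟩
  obtain ⟨x, hx, rfl⟩ := mem_graph.1 hp
  exact ⟨x, F x, hx, rfl⟩

theorem card_le_iff {a b : ZFSet.{u}} :
    a.card ≤ b.card ↔ ∃ F : ZFSet.{u} → ZFSet.{u}, (∀ x ∈ a, F x ∈ b) ∧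
      ∀ x ∈ a, ∀ y ∈ a, F x = F y → x = y := by
  rw [← Cardinal.lift_le.{u + 1}, ← cardinalMk_coe_sort, ← cardinalMk_coe_sort]
  constructor
  · rintro ⟨e⟩
    classical
    refine ⟨fun x => if h : x ∈ a then e ⟨x, h⟩ else x, fun x hx => ?_, fun x hx y hy h => ?_⟩
    · simp only [hx, dif_pos]
      exact (e ⟨x, hx⟩).2
    · simp only [hx, hy, dif_pos] at h
      exact congrArg Subtype.val (e.injective (Subtype.ext h))
  · rintro ⟨F, h, h'⟩
    exact ⟨⟨fun x => ⟨F x, h x x.2⟩, fun x y e =>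
      Subtype.ext (h' x x.2 y y.2 (congrArg Subtype.val e))⟩⟩

theorem card_le_of_surj {a b : ZFSet.{u}} (F : ZFSet.{u} → ZFSet.{u})
    (h : ∀ y ∈ b, ∃ x ∈ a, F x = y) : b.card ≤ a.card := by
  choose! G hG hG' using h
  exact card_le_iff.2 ⟨G, hG, fun x hx y hy e => by rw [← hG' x hx, ← hG' y hy, e]⟩

theorem setLeIn_univ {a b : ZFSet.{u}} : SetLeIn Set.univ a b ↔ a.card ≤ b.card := by
  rw [card_le_iff]
  constructor
  · rintro ⟨f, -, h1, h2, h3⟩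
    choose! F hF hF' using h1.2
    exact ⟨F, fun x hx => h2 _ _ (hF x hx), fun x hx y hy e =>
      h3 _ _ (F x) (hF x hx) (e ▸ hF y hy)⟩
  · rintro ⟨F, h, h'⟩
    refine ⟨graph a F, trivial, isFuncOn_graph _ _, fun x y hxy => ?_, fun x x' y hx hx' => ?_⟩
    · obtain ⟨hx, rfl⟩ := pair_mem_graph.1 hxy
      exact h x hx
    · rw [pair_mem_graph] at hx hx'
      exact h' _ hx.1 _ hx'.1 (hx.2.symm.trans hx'.2)

theorem card_eq_card_rank {x : ZFSet.{u}} (hx : x.IsOrdinal) : x.card = x.rank.card := by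
  rw [← Ordinal.card_toZFSet, hx.toZFSet_rank_eq]

theorem IsOrdinal.mem_of_card_lt {x y : ZFSet.{u}} (hx : x.IsOrdinal) (hy : y.IsOrdinal)
    (h : x.card < y.card) : x ∈ y := by
  by_contra hn
  exact h.not_ge (card_mono ((hx.notMem_iff_subset hy).1 hn))

/-- If `a` has smaller cardinality than the ordinal `κ` then it injects into an element of `κ`. -/
theorem exists_mem_card_le {a κ : ZFSet.{u}} (hκ : κ.IsOrdinal) (h : a.card < κ.card) :
    ∃ β ∈ κ, a.card ≤ β.card := by
  have e : a.card.ord.toZFSet.card = a.card := by simp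
  exact ⟨_, IsOrdinal.mem_of_card_lt (isOrdinal_toZFSet _) hκ (by rwa [e]), e.ge⟩

/-- `f` is a single-valued relation. -/
def Func (f : ZFSet.{u}) : Prop := ∀ x y : ZFSet.{u}, x.pair y ∈ f →
  ∀ z : ZFSet.{u}, x.pair z ∈ f → y = z

theorem func_graph (d : ZFSet.{u}) (F : ZFSet.{u} → ZFSet.{u}) : Func (graph d F) :=
  fun x y h z h' => by
    rw [pair_mem_graph] at h h'
    rw [h.2, h'.2]

variable {n : ℕ} {a b c : (Fin n → ZFSet.{u}) → ZFSet.{u}}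

instance dfn_isOrd [IsVar a] : Dfn (fun _ v => IsOrd (a v)) :=
  Dfn.subst1 (F := fun _ a => IsOrd a)
    (inferInstance : Dfn (fun _ (v : Fin 1 → ZFSet.{u}) =>
      (∀ y ∈ v 0, y ⊆ v 0) ∧ ∀ y ∈ v 0, ∀ z ∈ y, z ⊆ y))

instance dfn_func [IsVar a] : Dfn (fun _ v => Func (a v)) :=
  Dfn.subst1 (F := fun _ a => Func a)
    (inferInstance : Dfn (fun _ (v : Fin 1 → ZFSet.{u}) =>
      ∀ x y : ZFSet.{u}, x.pair y ∈ v 0 → ∀ z, x.pair z ∈ v 0 → y = z))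

theorem eq_succ_iff {x y : ZFSet.{u}} :
    ((∀ z ∈ x, z ∈ y ∨ z = y) ∧ y ∈ x ∧ ∀ z ∈ y, z ∈ x) ↔ x = insert y y := by
  constructor
  · rintro ⟨h1, h2, h3⟩
    ext z
    rw [mem_insert_iff]
    exact ⟨fun h => (h1 z h).symm, fun h => h.elim (· ▸ h2) (h3 z)⟩
  · rintro rfl
    simp only [mem_insert_iff]
    tauto

instance dfn_isSucc [IsVar a] [IsVar b] : Dfn (fun _ v => a v = insert (b v) (b v)) :=
  Dfn.subst2 (F := fun _ a b => a = insert b b)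
    (Dfn.congr (inferInstance : Dfn (fun _ (v : Fin 2 → ZFSet.{u}) =>
      (∀ z ∈ v 0, z ∈ v 1 ∨ z = v 1) ∧ v 1 ∈ v 0 ∧ ∀ z ∈ v 1, z ∈ v 0))
      fun _ _ _ _ => eq_succ_iff)

end Basic

section Embedding

variable {M : Set ZFSet.{u}} {j : ElemEmb (Set.univ : Set ZFSet.{u}) M} (hM : TransClass M)

theorem emb_mem (j : ElemEmb (Set.univ : Set ZFSet.{u}) M) (hM : TransClass M) {x y : ZFSet.{u}} :
    j.toFun x ∈ j.toFun y ↔ x ∈ y :=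
  (transfer2 j hM (fun _ a b => a ∈ b) x y).symm

theorem emb_inj (j : ElemEmb (Set.univ : Set ZFSet.{u}) M) (hM : TransClass M) {x y : ZFSet.{u}} :
    j.toFun x = j.toFun y ↔ x = y :=
  (transfer2 j hM (fun _ a b => a = b) x y).symm

theorem emb_subset (j : ElemEmb (Set.univ : Set ZFSet.{u}) M) (hM : TransClass M)
    {x y : ZFSet.{u}} :
    j.toFun x ⊆ j.toFun y ↔ x ⊆ y :=
  (transfer2 j hM (fun _ a b => a ⊆ b) x y).symm

theorem emb_pair (j : ElemEmb (Set.univ : Set ZFSet.{u}) M) (hM : TransClass M) (x y : ZFSet.{u}) :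
    j.toFun (x.pair y) = (j.toFun x).pair (j.toFun y) :=
  (transfer3 j hM (fun _ a b c => a = b.pair c) (x.pair y) x y).1 rfl

theorem emb_pair_mem (j : ElemEmb (Set.univ : Set ZFSet.{u}) M) (hM : TransClass M)
    {x y f : ZFSet.{u}} :
    (j.toFun x).pair (j.toFun y) ∈ j.toFun f ↔ x.pair y ∈ f := by
  rw [← emb_pair j hM, emb_mem j hM]

theorem emb_succ (j : ElemEmb (Set.univ : Set ZFSet.{u}) M) (hM : TransClass M) (x : ZFSet.{u}) :
    j.toFun (insert x x) = insert (j.toFun x) (j.toFun x) :=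
  (transfer2 j hM (fun _ a b => a = insert b b) (insert x x) x).1 rfl

theorem emb_isOrd (j : ElemEmb (Set.univ : Set ZFSet.{u}) M) (hM : TransClass M) {x : ZFSet.{u}} :
    IsOrd (j.toFun x) ↔ IsOrd x :=
  (transfer1 j hM (fun _ a => IsOrd a) x).symm

theorem emb_func (j : ElemEmb (Set.univ : Set ZFSet.{u}) M) (hM : TransClass M) {x : ZFSet.{u}} :
    Func (j.toFun x) ↔ Func x :=
  (transfer1 j hM (fun _ a => Func a) x).symm

theorem emb_empty (j : ElemEmb (Set.univ : Set ZFSet.{u}) M) (hM : TransClass M) :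
    j.toFun ∅ = ∅ := by
  have := (transfer1 j hM (fun _ a => ∀ x ∈ a, x ≠ x) ∅).1 (by simp)
  rw [ZFSet.eq_empty]
  exact fun y hy => this y hy rfl

theorem IsCrit.mem_emb (hM : TransClass M) {κ : ZFSet.{u}} (h : IsCrit j κ) : κ ∈ j.toFun κ := by
  have h1 : (j.toFun κ).IsOrdinal := ((emb_isOrd j hM).2 h.1).isOrdinal
  have h2 : κ ⊆ j.toFun κ := fun α hα => by
    rw [← h.2.2 α hα, emb_mem j hM]
    exact hα
  exact ((h.1.isOrdinal.subset_iff_eq_or_mem h1).1 h2).resolve_left fun e => h.2.1 e.symm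

theorem IsCrit.subset_emb (hM : TransClass M) {κ : ZFSet.{u}} (h : IsCrit j κ) : κ ⊆ j.toFun κ :=
  ((emb_isOrd j hM).2 h.1).1 κ (h.mem_emb hM)

theorem IsCrit.succ_mem (hM : TransClass M) {κ α : ZFSet.{u}} (h : IsCrit j κ) (hα : α ∈ κ) :
    insert α α ∈ κ := by
  have e : j.toFun (insert α α) = insert α α := by rw [emb_succ j hM, h.2.2 α hα]
  rcases (isOrdinal_succ (h.1.isOrdinal.mem hα)).mem_trichotomous h.1.isOrdinal with hs | hs | hs
  · exact hs
  · exact absurd (hs ▸ e) h.2.1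
  · rw [mem_insert_iff] at hs
    rcases hs with rfl | hs
    · exact absurd hα (mem_irrefl _)
    · exact absurd hα (mem_asymm hs)

/-- The set of natural numbers. -/
noncomputable def nats : ZFSet.{u} := Ordinal.omega0.toZFSet

theorem mem_nats {x : ZFSet.{u}} : x ∈ nats ↔ ∃ n : ℕ, x = Ordinal.toZFSet n := by
  simp only [nats, Ordinal.mem_toZFSet_iff, Ordinal.lt_omega0]
  constructor
  · rintro ⟨_, ⟨n, rfl⟩, rfl⟩
    exact ⟨n, rfl⟩
  · rintro ⟨n, rfl⟩
    exact ⟨n, ⟨n, rfl⟩, rfl⟩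

theorem emb_nat (j : ElemEmb (Set.univ : Set ZFSet.{u}) M) (hM : TransClass M) (n : ℕ) :
    j.toFun (Ordinal.toZFSet n) = Ordinal.toZFSet n := by
  induction n with
  | zero => simpa using emb_empty j hM
  | succ n ih =>
    rw [Nat.cast_succ, Ordinal.toZFSet_add_one, emb_succ j hM, ih]

theorem emb_nats (j : ElemEmb (Set.univ : Set ZFSet.{u}) M) (hM : TransClass M) :
    j.toFun nats = nats := by
  have h0 : ∀ x ∈ nats.{u}, (∀ y ∈ x, y ≠ y) ∨ ∃ y ∈ nats.{u}, x = insert y y := by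
    intro x hx
    obtain ⟨n, rfl⟩ := mem_nats.1 hx
    cases n with
    | zero => left; simp
    | succ n =>
      right
      refine ⟨_, mem_nats.2 ⟨n, rfl⟩, ?_⟩
      rw [Nat.cast_succ, Ordinal.toZFSet_add_one]
  have h := (transfer1 j hM (fun _ a => ∀ x ∈ a, (∀ y ∈ x, y ≠ y) ∨ ∃ y ∈ a, x = insert y y)
    nats).1 h0
  ext x
  constructor
  · intro hx
    induction x using ZFSet.inductionOn with
    | _ x ih =>
    rcases h x hx with h' | ⟨y, hy, rfl⟩
    · refine mem_nats.2 ⟨0, ?_⟩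
      rw [ZFSet.eq_empty x |>.2 fun y hy => h' y hy rfl]
      simp
    · obtain ⟨n, rfl⟩ := mem_nats.1 (ih y (by simp) hy)
      refine mem_nats.2 ⟨n + 1, ?_⟩
      rw [Nat.cast_succ, Ordinal.toZFSet_add_one]
  · intro hx
    obtain ⟨n, rfl⟩ := mem_nats.1 hx
    rw [← emb_nat j hM, emb_mem j hM]
    exact hx

theorem IsCrit.nats_mem (hM : TransClass M) {κ : ZFSet.{u}} (h : IsCrit j κ) : nats ∈ κ := by
  rcases (isOrdinal_toZFSet Ordinal.omega0).mem_trichotomous h.1.isOrdinal with h' | h' | h'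
  · exact h'
  · exact absurd (by rw [← h']; exact emb_nats j hM) h.2.1
  · obtain ⟨n, rfl⟩ := mem_nats.1 h'
    exact absurd (emb_nat j hM n) h.2.1

/-- The critical point is above every rank of a moved set. -/
theorem IsCrit.emb_eq (hM : TransClass M) {κ : ZFSet.{u}} (h : IsCrit j κ) (x : ZFSet.{u})
    (hx : x.rank < κ.rank) : j.toFun x = x := by
  induction x using ZFSet.inductionOn with
  | _ x ih₀ =>
  obtain ⟨o, ho⟩ : ∃ o, x.rank = o := ⟨_, rfl⟩
  clear ih₀
  induction o using WellFoundedLT.induction generalizing x with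
  | _ o ih =>
  set r := graph (V_ κ.rank) (fun w => w.rank.toZFSet) with hr
  have h0 : ∀ w α : ZFSet.{u}, w.pair α ∈ r → ∀ z ∈ w, ∃ γ ∈ α, z.pair γ ∈ r := by
    intro w α hw z hz
    obtain ⟨h1, rfl⟩ := pair_mem_graph.1 hw
    have hlt := rank_lt_of_mem hz
    exact ⟨z.rank.toZFSet, by simpa using hlt, pair_mem_graph.2
      ⟨mem_vonNeumann.2 (hlt.trans (mem_vonNeumann.1 h1)), rfl⟩⟩
  have h1 := (transfer1 j hM (fun _ r => ∀ w α : ZFSet.{u}, w.pair α ∈ r →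
    ∀ z ∈ w, ∃ γ ∈ α, z.pair γ ∈ r) r).1 h0
  have h2 : ∀ w α : ZFSet.{u}, w.pair α ∈ j.toFun r → w.rank ≤ α.rank := by
    intro w
    induction w using ZFSet.inductionOn with
    | _ w ih' =>
    intro α hα
    rw [rank_le_iff]
    intro z hz
    obtain ⟨γ, hγ, hzγ⟩ := h1 w α hα z hz
    exact (ih' z hz γ hzγ).trans_lt (rank_lt_of_mem hγ)
  have hβ : x.rank.toZFSet ∈ κ := by
    rwa [← (isOrdinal_toZFSet _).rank_lt_iff_mem h.1.isOrdinal, Ordinal.rank_toZFSet]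
  have h3 : (j.toFun x).rank ≤ x.rank := by
    have : x.pair x.rank.toZFSet ∈ r := by simp [hr, mem_vonNeumann, hx]
    have := h2 _ _ ((emb_pair_mem j hM).2 this)
    rwa [h.2.2 _ hβ, Ordinal.rank_toZFSet] at this
  ext w
  constructor
  · intro hw
    have hlt : w.rank < x.rank := (rank_lt_of_mem hw).trans_le h3
    rwa [← ih w.rank (ho ▸ hlt) w (hlt.trans hx) rfl, emb_mem j hM] at hw
  · intro hw
    have hlt : w.rank < x.rank := rank_lt_of_mem hw
    rwa [← ih w.rank (ho ▸ hlt) w (hlt.trans hx) rfl, emb_mem j hM]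

theorem IsCrit.card_lt (hM : TransClass M) {κ : ZFSet.{u}} (h : IsCrit j κ) (x : ZFSet.{u})
    (hx : x.rank < κ.rank) : x.card < κ.card := by
  by_contra! hle
  obtain ⟨e, he, he'⟩ := card_le_iff.1 hle
  set g := ZFSet.range (fun α : κ => (e α).pair α) with hg
  have hmem : ∀ z α, z.pair α ∈ g ↔ α ∈ κ ∧ z = e α := by
    intro z α
    simp only [hg, ZFSet.mem_range, Subtype.exists, pair_inj]
    constructor
    · rintro ⟨_, h1, rfl, rfl⟩
      exact ⟨h1, rfl⟩
    · rintro ⟨h1, rfl⟩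
      exact ⟨α, h1, rfl, rfl⟩
  have h1 := (transfer3 j hM (fun _ κ x g => ∀ α ∈ κ, ∃ z ∈ x, z.pair α ∈ g) κ x g).1
    (fun α hα => ⟨e α, he α hα, (hmem _ _).2 ⟨hα, rfl⟩⟩)
  have h2 : Func g := by
    intro z α hα β hβ
    rw [hmem] at hα hβ
    exact he' _ hα.1 _ hβ.1 (hα.2.symm.trans hβ.2)
  obtain ⟨z, hz, hzκ⟩ := h1 κ (h.mem_emb hM)
  rw [h.emb_eq hM x hx] at hz
  have hjz : j.toFun z = z := h.emb_eq hM z ((rank_lt_of_mem hz).trans hx)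
  obtain ⟨y, hy, -⟩ := (transfer2 j hM (fun _ z g => ∃ y, z.pair y ∈ g ∧ y = y) z g).2
    ⟨κ, by rwa [hjz], rfl⟩
  have hyκ := ((hmem _ _).1 hy).1
  have h3 := (emb_func j hM).2 h2 z κ hzκ y (by
    rw [← hjz, ← h.2.2 y hyκ]
    exact (emb_pair_mem j hM).2 hy)
  exact mem_irrefl κ (by rw [← h3] at hyκ; exact hyκ)

end Embedding

/-- The instance at `κ` and `f` of the property defining `WSCinSet`. -/
def WSCAt (f κ : ZFSet.{u}) : Prop :=
  ClosurePt f κ ∧ ∃ (M : Set ZFSet.{u}) (j : ElemEmb (Set.univ : Set ZFSet.{u}) M) (y : ZFSet.{u}),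
    TransClass M ∧ IsCrit j κ ∧ κ.pair y ∈ j.toFun f ∧ WCovers M j.toFun κ y ∧ VIncl M y

theorem wscInSet_iff {δ X : ZFSet.{u}} :
    WSCinSet δ X ↔ ∀ f, FuncSelf δ f → ∃ κ ∈ X, WSCAt f κ := Iff.rfl

theorem FuncSelf.exists_fun {δ f : ZFSet.{u}} (h : FuncSelf δ f) :
    ∃ F : ZFSet.{u} → ZFSet.{u}, (∀ a ∈ δ, F a ∈ δ) ∧ f = graph δ F := by
  choose! F hF hF' using h.1.2
  refine ⟨F, fun a ha => h.2 _ _ (hF a ha), ?_⟩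
  ext p
  rw [mem_graph]
  constructor
  · intro hp
    obtain ⟨a, b, ha, rfl⟩ := h.1.1 p hp
    exact ⟨a, ha, by rw [hF' a ha b hp]⟩
  · rintro ⟨a, ha, rfl⟩
    exact hF a ha

theorem funcSelf_graph {δ : ZFSet.{u}} {F : ZFSet.{u} → ZFSet.{u}} (h : ∀ a ∈ δ, F a ∈ δ) :
    FuncSelf δ (graph δ F) := by
  refine ⟨isFuncOn_graph _ _, fun x y hxy => ?_⟩
  obtain ⟨hx, rfl⟩ := pair_mem_graph.1 hxy
  exact h x hx

theorem rank_mono_of_subset {x y : ZFSet.{u}} (h : x ⊆ y) : x.rank ≤ y.rank :=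
  rank_le_iff.2 fun _ hz => rank_lt_of_mem (h hz)

theorem WSCAt.mono {δ κ : ZFSet.{u}} (hδ : δ.IsOrdinal) (hκ : κ ∈ δ) {F G : ZFSet.{u} → ZFSet.{u}}
    (hG : ∀ a ∈ δ, G a ∈ δ) (hFG : ∀ a ∈ δ, F a ⊆ G a) (hF : ∀ a ∈ δ, F a ∈ δ)
    (h : WSCAt (graph δ G) κ) : WSCAt (graph δ F) κ := by
  have hκo : κ.IsOrdinal := hδ.mem hκ
  obtain ⟨hcl, M, j, y, hM, hcrit, hy, hcov, hV⟩ := h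
  refine ⟨fun a b hab ha => ?_, M, j, ?_⟩
  · obtain ⟨haδ, rfl⟩ := pair_mem_graph.1 hab
    have h1 := hcl a (G a) (by simp [haδ]) ha
    have h2 := ((hδ.mem (hF a haδ)).subset_iff_eq_or_mem (hδ.mem (hG a haδ))).1 (hFG a haδ)
    rcases h2 with h2 | h2
    · rwa [h2]
    · exact hκo.isTransitive.mem_trans h2 h1
  · have h1 := (transfer3 j hM (fun _ δ f g => ∀ a ∈ δ, ∃ x, a.pair x ∈ f ∧
      ∀ y, a.pair y ∈ g → x ⊆ y) δ (graph δ F) (graph δ G)).1 (by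
        intro a ha
        refine ⟨F a, by simp [ha], fun y hy => ?_⟩
        obtain ⟨-, rfl⟩ := pair_mem_graph.1 hy
        exact hFG a ha)
    have h2 : κ ∈ j.toFun δ := by
      have h3 : IsOrd (j.toFun δ) := (emb_isOrd j hM).2 (isOrd_iff.2 hδ)
      exact h3.1.mem_trans (hcrit.mem_emb hM) ((emb_mem j hM).2 hκ)
    obtain ⟨x, hx, hxy⟩ := h1 κ h2
    have hxy := hxy y hy
    refine ⟨x, hM, hcrit, hx, ?_, fun z _ hz => hV z trivial
      (hz.trans_le (rank_mono_of_subset hxy))⟩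
    obtain ⟨s, hs, hs', hs''⟩ := hcov
    exact ⟨s, hs, fun α hα => hs' α (hxy hα), hs''⟩

theorem IsOrdinal.union_mem {δ a b : ZFSet.{u}} (hδ : δ.IsOrdinal) (ha : a ∈ δ) (hb : b ∈ δ) :
    a ∪ b ∈ δ := by
  rcases (hδ.mem ha).mem_trichotomous (hδ.mem hb) with h | rfl | h
  · have : a ∪ b = b := by
      ext z
      simpa using fun hz => (hδ.mem hb).isTransitive.mem_trans hz h
    rwa [this]
  · have : a ∪ a = a := by
      ext z
      simp
    rwa [this]
  · have : a ∪ b = a := by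
      ext z
      simpa using fun hz => (hδ.mem ha).isTransitive.mem_trans hz h
    rwa [this]

theorem mem_zdiff {a b x : ZFSet.{u}} : x ∈ zdiff a b ↔ x ∈ a ∧ x ∉ b := by
  simp [zdiff]

theorem mem_zinter {a b x : ZFSet.{u}} : x ∈ zinter a b ↔ x ∈ a ∧ x ∈ b := by
  simp [zinter]

theorem isProperFilterOn_iff {δ : ZFSet.{u}} (hδ : δ.IsOrdinal) :
    IsProperFilterOn δ (Fset δ) ↔ WSCinSet δ δ := by
  have hmono : ∀ {X Y : ZFSet.{u}}, X ⊆ Y → WSCinSet δ X → WSCinSet δ Y := fun hXY h f hf =>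
    (h f hf).imp fun κ hκ => ⟨hXY hκ.1, hκ.2⟩
  constructor
  · rintro ⟨-, -, h, -⟩
    by_contra hn
    exact h ⟨ZFSet.empty_subset δ, fun h' => hn (hmono (fun x hx => (mem_zdiff.1 hx).1) h')⟩
  · intro h
    refine ⟨⟨δ, fun x hx => hx, fun h' => ?_⟩, fun X hX => hX.1, fun h' => ?_,
      fun X hX Y hY hXY => ⟨hY, fun h' => hX.2 (hmono (fun x hx => ?_) h')⟩,
      fun X hX Y hY => ⟨fun x hx => hX.1 (mem_zinter.1 hx).1, fun h' => ?_⟩⟩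
    · obtain ⟨κ, hκ, -⟩ := h' (graph δ id) (funcSelf_graph fun a ha => ha)
      exact (mem_zdiff.1 hκ).2 (mem_zdiff.1 hκ).1
    · refine h'.2 (hmono (fun x hx => mem_zdiff.2 ⟨hx, by simp⟩) h)
    · rw [mem_zdiff] at hx ⊢
      exact ⟨hx.1, fun hx' => hx.2 (hXY hx')⟩
    · have h1 := hX.2
      have h2 := hY.2
      rw [wscInSet_iff] at h1 h2
      push Not at h1 h2
      obtain ⟨f, hf, hf'⟩ := h1
      obtain ⟨g, hg, hg'⟩ := h2
      obtain ⟨F, hF, rfl⟩ := hf.exists_fun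
      obtain ⟨G, hG, rfl⟩ := hg.exists_fun
      have hFG : ∀ a ∈ δ, F a ∪ G a ∈ δ := fun a ha => IsOrdinal.union_mem hδ (hF a ha) (hG a ha)
      obtain ⟨κ, hκ, hat⟩ := wscInSet_iff.1 h' _ (funcSelf_graph hFG)
      obtain ⟨hκδ, hκ⟩ := mem_zdiff.1 hκ
      rw [mem_zinter, not_and_or] at hκ
      rcases hκ with hκ | hκ
      · exact hf' κ (mem_zdiff.2 ⟨hκδ, hκ⟩) (hat.mono hδ hκδ hFG
          (fun a _ x hx => by simp [hx]) hF)
      · exact hg' κ (mem_zdiff.2 ⟨hκδ, hκ⟩) (hat.mono hδ hκδ hFG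
          (fun a _ x hx => by simp [hx]) hG)

section Collapse

/-- Mostowski collapse of a well-founded set-like relation. -/
theorem exists_collapse {T : Type*} {r : T → T → Prop} (wf : WellFounded r)
    (hs : ∀ x, Small.{u} {y // r y x}) :
    ∃ c : T → ZFSet.{u}, ∀ x z, z ∈ c x ↔ ∃ y, r y x ∧ c y = z := by
  let c : T → ZFSet.{u} := wf.fix fun x F =>
    have := hs x
    ZFSet.range (fun y : {y // r y x} => F y y.2)
  refine ⟨c, fun x z => ?_⟩
  have := hs x
  have e : c x = ZFSet.range (fun y : {y // r y x} => c y) := wf.fix_eq _ x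
  rw [e, ZFSet.mem_range]
  exact ⟨fun ⟨y, hy⟩ => ⟨y, y.2, hy⟩, fun ⟨y, hy, e⟩ => ⟨⟨y, hy⟩, e⟩⟩

variable {T : Type*} {r : T → T → Prop} {c : T → ZFSet.{u}}

theorem collapse_injective
    (htri : ∀ x y, r x y ∨ x = y ∨ r y x) (hc : ∀ x z, z ∈ c x ↔ ∃ y, r y x ∧ c y = z) :
    Function.Injective c := by
  intro x y e
  rcases htri x y with h | h | h
  · have : c x ∈ c y := (hc _ _).2 ⟨x, h, rfl⟩
    exact absurd (e ▸ this) (mem_irrefl _)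
  · exact h
  · have : c y ∈ c x := (hc _ _).2 ⟨y, h, rfl⟩
    exact absurd (e ▸ this) (mem_irrefl _)

theorem collapse_isOrdinal (htrans : ∀ x y z, r x y → r y z → r x z)
    (hc : ∀ x z, z ∈ c x ↔ ∃ y, r y x ∧ c y = z) (x : T) : (c x).IsOrdinal := by
  have h : ∀ x, (c x).IsTransitive := by
    intro x y hy z hz
    obtain ⟨y, hyx, rfl⟩ := (hc _ _).1 hy
    obtain ⟨z, hzy, rfl⟩ := (hc _ _).1 hz
    exact (hc _ _).2 ⟨z, htrans _ _ _ hzy hyx, rfl⟩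
  rw [isOrdinal_iff_forall_mem_isTransitive]
  refine ⟨h x, fun y hy => ?_⟩
  obtain ⟨y, -, rfl⟩ := (hc _ _).1 hy
  exact h y

end Collapse

section WellOrderCode

/-- There is an injection of the universe into the ordinals which is monotone in rank and
whose initial segments are bounded in rank. -/
theorem exists_code : ∃ h : ZFSet.{u} → ZFSet.{u}, Function.Injective h ∧
    (∀ x, (h x).IsOrdinal) ∧ (∀ x y, x.rank < y.rank → h x ∈ h y) ∧
    (∀ x z, z ∈ h x → ∃ y, y.rank ≤ x.rank ∧ h y = z) := by
  let r : ZFSet.{u} → ZFSet.{u} → Prop := fun x y =>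
    x.rank < y.rank ∨ (x.rank = y.rank ∧ WellOrderingRel x y)
  have hwf : WellFounded r := by
    have : r = InvImage (Prod.Lex (· < ·) WellOrderingRel) (fun x : ZFSet.{u} => (x.rank, x)) := by
      funext x y
      simp [r, InvImage, Prod.lex_def]
    rw [this]
    exact InvImage.wf _ (WellFounded.prod_lex wellFounded_lt WellOrderingRel.isWellOrder.wf)
  have hle : ∀ x y, r x y → x.rank ≤ y.rank := fun x y h => h.elim le_of_lt fun h => h.1.le
  have hs : ∀ x, Small.{u} {y // r y x} := fun x =>
    small_of_injective (β := ↥(V_ (Order.succ x.rank)))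
      (f := fun y => ⟨y.1, mem_vonNeumann.2 (Order.lt_succ_of_le (hle _ _ y.2))⟩)
      fun y z e => Subtype.ext (Subtype.mk.inj e)
  obtain ⟨c, hc⟩ := exists_collapse hwf hs
  refine ⟨c, collapse_injective (fun x y => ?_) hc, collapse_isOrdinal (fun x y z => ?_) hc,
    fun x y hxy => (hc _ _).2 ⟨x, Or.inl hxy, rfl⟩, fun x z hz => ?_⟩
  · rcases lt_trichotomy x.rank y.rank with h | h | h
    · exact Or.inl (Or.inl h)
    · rcases trichotomous_of WellOrderingRel x y with h' | h' | h'
      · exact Or.inl (Or.inr ⟨h, h'⟩)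
      · exact Or.inr (Or.inl h')
      · exact Or.inr (Or.inr (Or.inr ⟨h.symm, h'⟩))
    · exact Or.inr (Or.inr (Or.inl h))
  · rintro (h1 | ⟨h1, h1'⟩) (h2 | ⟨h2, h2'⟩)
    · exact Or.inl (h1.trans h2)
    · exact Or.inl (h2 ▸ h1)
    · exact Or.inl (h1 ▸ h2)
    · exact Or.inr ⟨h1.trans h2, trans_of WellOrderingRel h1' h2'⟩
  · obtain ⟨y, hy, rfl⟩ := (hc _ _).1 hz
    exact ⟨y, hle _ _ hy, rfl⟩

end WellOrderCode

section Pairing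

/-- The Gödel ordering of pairs of ordinals. -/
def GLt (a b c d : ZFSet.{u}) : Prop :=
  ((a ∈ c ∨ a ∈ d) ∧ (b ∈ c ∨ b ∈ d)) ∨
    (¬ ((c ∈ a ∨ c ∈ b) ∧ (d ∈ a ∨ d ∈ b)) ∧ (a ∈ c ∨ (a = c ∧ b ∈ d)))

instance dfn_gLt {n : ℕ} {a b c d : (Fin n → ZFSet.{u}) → ZFSet.{u}} [IsVar a] [IsVar b]
    [IsVar c] [IsVar d] : Dfn (fun _ v => GLt (a v) (b v) (c v) (d v)) := by
  unfold GLt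
  infer_instance

/-- The Gödel ordering of pairs of ordinals. -/
def OLt (p q : Ordinal.{u} × Ordinal.{u}) : Prop :=
  max p.1 p.2 < max q.1 q.2 ∨ (max p.1 p.2 = max q.1 q.2 ∧ (p.1 < q.1 ∨ (p.1 = q.1 ∧ p.2 < q.2)))

theorem gLt_iff {a b c d : ZFSet.{u}} (ha : a.IsOrdinal) (hb : b.IsOrdinal) (hc : c.IsOrdinal)
    (hd : d.IsOrdinal) : GLt a b c d ↔ OLt (a.rank, b.rank) (c.rank, d.rank) := by
  have e : a = c ↔ a.rank = c.rank := (ha.rank_inj hc).symm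
  simp only [GLt, OLt, ← ha.rank_lt_iff_mem hc, ← ha.rank_lt_iff_mem hd, ← hb.rank_lt_iff_mem hc,
    ← hb.rank_lt_iff_mem hd, ← hc.rank_lt_iff_mem ha, ← hc.rank_lt_iff_mem hb,
    ← hd.rank_lt_iff_mem ha, ← hd.rank_lt_iff_mem hb, e, ← lt_max_iff, ← max_lt_iff]
  constructor
  · rintro (h | ⟨h, h'⟩)
    · exact Or.inl h
    · rcases (not_lt.1 h).lt_or_eq with h | h
      · exact Or.inl h
      · exact Or.inr ⟨h, h'⟩
  · rintro (h | ⟨h, h'⟩)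
    · exact Or.inl h
    · exact Or.inr ⟨h.le.not_gt, h'⟩

theorem wf_oLt : WellFounded OLt.{u} := by
  have : OLt.{u} = InvImage (Prod.Lex (· < ·) (Prod.Lex (· < ·) (· < ·)))
      (fun p : Ordinal.{u} × Ordinal.{u} => (max p.1 p.2, p.1, p.2)) := by
    funext p q
    simp [OLt, InvImage, Prod.lex_def]
  rw [this]
  exact InvImage.wf _ (WellFounded.prod_lex wellFounded_lt
    (WellFounded.prod_lex wellFounded_lt wellFounded_lt))

theorem OLt.le {p q : Ordinal.{u} × Ordinal.{u}} (h : OLt p q) :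
    max p.1 p.2 ≤ max q.1 q.2 := h.elim le_of_lt fun h => h.1.le

/-- Gödel pairing. -/
theorem exists_pairing : ∃ P : Ordinal.{u} × Ordinal.{u} → ZFSet.{u}, Function.Injective P ∧
    (∀ p, (P p).IsOrdinal) ∧ (∀ p z, z ∈ P p ↔ ∃ q, OLt q p ∧ P q = z) := by
  have hs : ∀ x, Small.{u} {y // OLt.{u} y x} := fun x =>
    small_of_injective (β := ↥(Set.Iic (max x.1 x.2)) × ↥(Set.Iic (max x.1 x.2)))
      (f := fun y => (⟨y.1.1, (le_max_left _ _).trans y.2.le⟩,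
        ⟨y.1.2, (le_max_right _ _).trans y.2.le⟩))
      fun y z e => by
        simp only [Prod.mk.injEq] at e
        exact Subtype.ext (Prod.ext (Subtype.mk.inj e.1) (Subtype.mk.inj e.2))
  obtain ⟨P, hP⟩ := exists_collapse wf_oLt hs
  refine ⟨P, collapse_injective (fun x y => ?_) hP,
    collapse_isOrdinal (fun x y z => ?_) hP, hP⟩
  · rcases x with ⟨a, b⟩
    rcases y with ⟨c, d⟩
    simp only [OLt, Prod.mk.injEq]
    rcases lt_trichotomy (max a b) (max c d) with h | h | h
    · exact Or.inl (Or.inl h)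
    · rcases lt_trichotomy a c with h1 | h1 | h1
      · exact Or.inl (Or.inr ⟨h, Or.inl h1⟩)
      · rcases lt_trichotomy b d with h2 | h2 | h2
        · exact Or.inl (Or.inr ⟨h, Or.inr ⟨h1, h2⟩⟩)
        · exact Or.inr (Or.inl ⟨h1, h2⟩)
        · exact Or.inr (Or.inr (Or.inr ⟨h.symm, Or.inr ⟨h1.symm, h2⟩⟩))
      · exact Or.inr (Or.inr (Or.inr ⟨h.symm, Or.inl h1⟩))
    · exact Or.inr (Or.inr (Or.inl h))
  · rintro (h1 | ⟨h1, h1'⟩) (h2 | ⟨h2, h2'⟩)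
    · exact Or.inl (h1.trans h2)
    · exact Or.inl (h2 ▸ h1)
    · exact Or.inl (h1 ▸ h2)
    · refine Or.inr ⟨h1.trans h2, ?_⟩
      rcases h1' with h1' | ⟨h1', h1''⟩ <;> rcases h2' with h2' | ⟨h2', h2''⟩
      · exact Or.inl (h1'.trans h2')
      · exact Or.inl (h2' ▸ h1')
      · exact Or.inl (h1' ▸ h2')
      · exact Or.inr ⟨h1'.trans h2', h1''.trans h2''⟩

end Pairing

theorem IsCard.card_lt {δ α : ZFSet.{u}} (h : IsCard δ) (hα : α ∈ δ) : α.card < δ.card :=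
  not_le.1 fun hle => h.2 α hα (setLeIn_univ.2 hle)

theorem card_nats : (nats : ZFSet.{u}).card = ℵ₀ := by
  simp [nats]

theorem IsCard.succ_mem {δ α : ZFSet.{u}} (h : IsCard δ) (hω : nats ∈ δ) (hα : α ∈ δ) :
    insert α α ∈ δ := by
  have h1 : ℵ₀ ≤ δ.card := by
    rw [← card_nats]
    exact (h.card_lt hω).le
  exact IsOrdinal.mem_of_card_lt (isOrdinal_succ (h.1.isOrdinal.mem hα)) h.1.isOrdinal
    (card_insert_le.trans_lt (add_lt_of_lt h1 (h.card_lt hα) (one_lt_aleph0.trans_le h1)))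

theorem _root_.ZFSet.IsOrdinal.succ_lt_rank {x : ZFSet.{u}} (hx : x.IsOrdinal)
    (h : ∀ α ∈ x, insert α α ∈ x) {o : Ordinal.{u}} (ho : o < x.rank) : Order.succ o < x.rank := by
  have h1 : o.toZFSet ∈ x := by
    rwa [← (isOrdinal_toZFSet _).rank_lt_iff_mem hx, Ordinal.rank_toZFSet]
  have h2 := rank_lt_of_mem (h _ h1)
  rwa [rank_insert, Ordinal.rank_toZFSet, max_eq_left (Order.le_succ o)] at h2

theorem IsCard.succ_lt_rank {δ : ZFSet.{u}} (h : IsCard δ) (hω : nats ∈ δ) {o : Ordinal.{u}}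
    (ho : o < δ.rank) : Order.succ o < δ.rank :=
  h.1.isOrdinal.succ_lt_rank (fun _ => h.succ_mem hω) ho

theorem WoodinSC.isCard {δ : ZFSet.{u}} (h : WoodinSC δ) : IsCard δ := h.1

theorem WoodinSC.nats_mem {δ : ZFSet.{u}} (h : WoodinSC δ) : nats ∈ δ := by
  obtain ⟨κ, hκ, h'⟩ := h.2 ∅ trivial (ZFSet.empty_subset _)
  obtain ⟨M, -, hM, j, hj, -⟩ := h' κ (Or.inr rfl) hκ
  exact h.1.1.1.mem_trans (hj.nats_mem hM) hκ

theorem WoodinSC.exists_crit {δ α : ZFSet.{u}} (h : WoodinSC δ) (hα : α ∈ δ) :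
    ∃ κ ∈ δ, α ∈ κ ∧ ∃ (M : Set ZFSet.{u}) (j : ElemEmb (Set.univ : Set ZFSet.{u}) M),
      TransClass M ∧ IsCrit j κ := by
  obtain ⟨κ, hκ, h'⟩ := h.2 {α} trivial fun x hx => by
    rw [ZFSet.mem_singleton] at hx
    rwa [hx]
  have hδ := h.1.1.isOrdinal
  have hα' : insert α α ∈ δ := h.isCard.succ_mem h.nats_mem hα
  have hαo := hδ.mem hα
  have hκo := hδ.mem hκ
  by_cases hακ : α ∈ κ
  · obtain ⟨M, -, hM, j, hj, -⟩ := h' κ (Or.inr rfl) hκ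
    exact ⟨κ, hκ, hακ, M, j, hM, hj⟩
  · have hsub : κ ⊆ α := (hαo.notMem_iff_subset hκo).1 hακ
    have hle : κ ∈ insert α α := by
      rw [mem_insert_iff]
      exact (hκo.subset_iff_eq_or_mem hαo).1 hsub
    obtain ⟨M, -, hM, j, hj, hlam, -, hA⟩ := h' (insert α α) (Or.inl hle) hα'
    have h1 := (hA α (by simp)).1 (by simp)
    have h2 := (transfer2 j hM (fun _ A α => ∀ x ∈ A, x = α) {α} α).1 (by simp) α h1
    have h3 : α ∈ j.toFun κ := ((emb_isOrd j hM).2 hj.1).1.mem_trans (by simp) hlam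
    have h4 := (emb_subset j hM).2 hsub h3
    rw [← h2] at h4
    exact absurd h4 (mem_irrefl _)

theorem WoodinSC.card_lt {δ : ZFSet.{u}} (h : WoodinSC δ) {x : ZFSet.{u}} (hx : x.rank < δ.rank) :
    x.card < δ.card := by
  have h1 : x.rank.toZFSet ∈ δ := by
    rwa [← (isOrdinal_toZFSet _).rank_lt_iff_mem h.1.1.isOrdinal, Ordinal.rank_toZFSet]
  obtain ⟨κ, hκ, hx', M, j, hM, hj⟩ := h.exists_crit h1
  have h2 := rank_lt_of_mem hx'
  rw [Ordinal.rank_toZFSet] at h2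
  exact (hj.card_lt hM x h2).trans (h.isCard.card_lt hκ)

theorem rank_prod_le (x y : ZFSet.{u}) :
    (x.prod y).rank ≤ Order.succ (Order.succ (max x.rank y.rank)) := by
  have : x.prod y ⊆ (x ∪ y).powerset.powerset := by
    intro p hp
    obtain ⟨a, ha, b, hb, rfl⟩ := mem_prod.1 hp
    simp only [mem_powerset, ZFSet.pair]
    intro q hq
    rw [mem_powerset]
    intro r hr
    rw [mem_union]
    rcases mem_pair.1 hq with rfl | rfl
    · rw [mem_singleton.1 hr]
      exact Or.inl ha
    · rcases mem_pair.1 hr with rfl | rfl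
      exacts [Or.inl ha, Or.inr hb]
  refine (rank_mono_of_subset this).trans ?_
  simp

/-- The agreement of a binary relation with its image below any given bound. -/
theorem exists_agree {δ B : ZFSet.{u}} (h : WoodinSC δ) :
    ∃ κ ∈ δ, ∀ θ ∈ δ, ∃ (M : Set ZFSet.{u}) (j : ElemEmb (Set.univ : Set ZFSet.{u}) M),
      TransClass M ∧ IsCrit j κ ∧ θ ∈ j.toFun κ ∧ κ ∈ j.toFun δ ∧
      (∀ X : ZFSet.{u}, (∀ x ∈ X, x ∈ M) → X.card ≤ θ.card →
        ∃ s ∈ M, X ⊆ s ∧ CardLtIn M s (j.toFun κ)) ∧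
      ∀ a ∈ θ, ∀ b ∈ θ, (a.pair b ∈ B ↔ a.pair b ∈ j.toFun B) := by
  have hδ := h.1.1.isOrdinal
  obtain ⟨P, hinj, hord, hP⟩ := exists_pairing.{u}
  set pz : ZFSet.{u} → ZFSet.{u} → ZFSet.{u} := fun a b => P (a.rank, b.rank) with hpz
  have hpz_inj : ∀ {a b a' b' : ZFSet.{u}}, a.IsOrdinal → b.IsOrdinal → a'.IsOrdinal →
      b'.IsOrdinal → pz a b = pz a' b' → a = a' ∧ b = b' := by
    intro a b a' b' ha hb ha' hb' e
    have := hinj e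
    rw [Prod.mk.injEq, ha.rank_inj ha', hb.rank_inj hb'] at this
    exact this
  have hmem : ∀ {a b z : ZFSet.{u}}, a.IsOrdinal → b.IsOrdinal → (z ∈ pz a b ↔
      ∃ a' b' : ZFSet.{u}, a'.IsOrdinal ∧ b'.IsOrdinal ∧ GLt a' b' a b ∧ pz a' b' = z) := by
    intro a b z ha hb
    rw [hP]
    constructor
    · rintro ⟨⟨p, q⟩, hpq, rfl⟩
      refine ⟨p.toZFSet, q.toZFSet, isOrdinal_toZFSet _, isOrdinal_toZFSet _, ?_, by simp [hpz]⟩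
      rw [gLt_iff (isOrdinal_toZFSet _) (isOrdinal_toZFSet _) ha hb]
      simpa using hpq
    · rintro ⟨a', b', ha', hb', hlt, rfl⟩
      exact ⟨_, (gLt_iff ha' hb' ha hb).1 hlt, rfl⟩
  have hpzδ : ∀ a ∈ δ, ∀ b ∈ δ, pz a b ∈ δ := by
    intro a ha b hb
    have hs := h.isCard.succ_mem h.nats_mem (IsOrdinal.union_mem hδ ha hb)
    set s := insert (a ∪ b) (a ∪ b) with hsdef
    have hso := hδ.mem hs
    have hrank : (s.prod s).rank < δ.rank := by
      refine (rank_prod_le s s).trans_lt ?_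
      rw [max_self]
      exact h.isCard.succ_lt_rank h.nats_mem (h.isCard.succ_lt_rank h.nats_mem (rank_lt_of_mem hs))
    refine IsOrdinal.mem_of_card_lt (hord _) hδ (lt_of_le_of_lt ?_ (h.card_lt hrank))
    have hchoose : ∃ F : ZFSet.{u} → ZFSet.{u}, ∀ x y : ZFSet.{u}, F (x.pair y) = pz x y := by
      classical
      refine ⟨fun p => if hp : ∃ x y : ZFSet.{u}, p = x.pair y then
        pz hp.choose hp.choose_spec.choose else ∅, fun x y => ?_⟩
      have hp : ∃ x' y' : ZFSet.{u}, x.pair y = x'.pair y' := ⟨x, y, rfl⟩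
      simp only [dif_pos hp]
      have := pair_inj.1 hp.choose_spec.choose_spec
      exact congrArg₂ pz this.1.symm this.2.symm
    obtain ⟨F, hF⟩ := hchoose
    refine card_le_of_surj F fun z hz => ?_
    obtain ⟨a', b', ha', hb', hlt, rfl⟩ := (hmem (hδ.mem ha) (hδ.mem hb)).1 hz
    rw [gLt_iff ha' hb' (hδ.mem ha) (hδ.mem hb)] at hlt
    have hle := hlt.le
    refine ⟨a'.pair b', ?_, hF _ _⟩
    have hsr : s.rank = Order.succ (max a.rank b.rank) := by
      rw [hsdef, rank_insert, rank_union]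
      simp
    rw [pair_mem_prod, ← ha'.rank_lt_iff_mem hso, ← hb'.rank_lt_iff_mem hso, hsr,
      Order.lt_succ_iff, Order.lt_succ_iff]
    exact ⟨(le_max_left _ _).trans hle, (le_max_right _ _).trans hle⟩
  set A := ZFSet.sep (fun z => ∃ a ∈ δ, ∃ b ∈ δ, a.pair b ∈ B ∧ z = pz a b) δ with hA
  have hAB : ∀ a ∈ δ, ∀ b ∈ δ, (a.pair b ∈ B ↔ pz a b ∈ A) := by
    intro a ha b hb
    simp only [hA, mem_sep]
    constructor
    · exact fun hab => ⟨hpzδ a ha b hb, a, ha, b, hb, hab, rfl⟩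
    · rintro ⟨-, a', ha', b', hb', hab, e⟩
      obtain ⟨rfl, rfl⟩ := hpz_inj (hδ.mem ha) (hδ.mem hb) (hδ.mem ha') (hδ.mem hb') e
      exact hab
  set Ps := ZFSet.range (fun p : ↥δ × ↥δ =>
    ((p.1 : ZFSet.{u}).pair p.2).pair (pz p.1 p.2)) with hPs
  have hPs_mem : ∀ q z : ZFSet.{u}, q.pair z ∈ Ps ↔
      ∃ a ∈ δ, ∃ b ∈ δ, q = a.pair b ∧ z = pz a b := by
    intro q z
    simp only [hPs, ZFSet.mem_range, Prod.exists, Subtype.exists, pair_inj]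
    constructor
    · rintro ⟨a, ha, b, hb, rfl, rfl⟩
      exact ⟨a, ha, b, hb, rfl, rfl⟩
    · rintro ⟨a, ha, b, hb, rfl, rfl⟩
      exact ⟨a, ha, b, hb, rfl, rfl⟩
  obtain ⟨κ, hκ, hsc⟩ := h.2 A trivial sep_subset
  refine ⟨κ, hκ, fun θ hθ => ?_⟩
  have hκo := hδ.mem hκ
  have hθo := hδ.mem hθ
  have hlam := IsOrdinal.union_mem hδ (IsOrdinal.union_mem hδ hκ hθ) (hpzδ θ hθ θ hθ)
  set lam := κ ∪ θ ∪ pz θ θ with hlamdef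
  have hlamo := hδ.mem hlam
  have hκlam : κ ⊆ lam := fun x hx => by simp [hlamdef, hx]
  have hθlam : θ ⊆ lam := fun x hx => by simp [hlamdef, hx]
  obtain ⟨M, -, hM, j, hj, hlj, hcov, hagr⟩ := hsc lam
    ((hκo.subset_iff_eq_or_mem hlamo).1 hκlam).symm hlam
  have hjδ : (j.toFun δ).IsOrdinal := ((emb_isOrd j hM).2 h.1.1).isOrdinal
  have hjκ : (j.toFun κ).IsOrdinal := ((emb_isOrd j hM).2 hj.1).isOrdinal
  have hθj : θ ∈ j.toFun κ := by
    rcases (hθo.subset_iff_eq_or_mem hlamo).1 hθlam with e | e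
    · rwa [e]
    · exact hjκ.isTransitive.mem_trans e hlj
  have hθδ : θ ∈ j.toFun δ := hjδ.isTransitive.mem_trans hθj ((emb_mem j hM).2 hκ)
  refine ⟨M, j, hM, hj, hθj,
    hjδ.isTransitive.mem_trans (hj.mem_emb hM) ((emb_mem j hM).2 hκ), fun X hX hXθ =>
    hcov X trivial hX (setLeIn_univ.2 (hXθ.trans (card_mono hθlam))), fun a ha b hb => ?_⟩
  have t1 := (transfer4 j hM (fun _ δ Ps A B => ∀ a ∈ δ, ∀ b ∈ δ, ∃ q z : ZFSet.{u},
    q.pair z ∈ Ps ∧ q = a.pair b ∧ (a.pair b ∈ B ↔ z ∈ A)) δ Ps A B).1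
    fun a ha b hb => ⟨_, _, (hPs_mem _ _).2 ⟨a, ha, b, hb, rfl, rfl⟩, rfl, hAB a ha b hb⟩
  have t2 := (transfer2 j hM (fun _ δ Ps => ∀ q z : ZFSet.{u}, q.pair z ∈ Ps →
      ∀ a ∈ δ, ∀ b ∈ δ, q = a.pair b →
      (∀ w ∈ z, ∃ q' w' : ZFSet.{u}, q'.pair w' ∈ Ps ∧ ∃ a' ∈ δ, ∃ b' ∈ δ,
        q' = a'.pair b' ∧ GLt a' b' a b ∧ w' = w) ∧
      (∀ a' ∈ δ, ∀ b' ∈ δ, GLt a' b' a b → ∃ q' w' : ZFSet.{u}, q'.pair w' ∈ Ps ∧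
        q' = a'.pair b' ∧ w' ∈ z)) δ Ps).1 (by
    intro q z hqz a ha b hb e
    obtain ⟨a₁, -, b₁, -, e', rfl⟩ := (hPs_mem _ _).1 hqz
    obtain ⟨rfl, rfl⟩ := pair_inj.1 (e.symm.trans e')
    have hao := hδ.mem ha
    have hbo := hδ.mem hb
    refine ⟨fun w hw => ?_, fun a' ha' b' hb' hlt => ⟨_, _, (hPs_mem _ _).2
      ⟨a', ha', b', hb', rfl, rfl⟩, rfl,
      (hmem hao hbo).2 ⟨a', b', hδ.mem ha', hδ.mem hb', hlt, rfl⟩⟩⟩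
    obtain ⟨a', b', ha', hb', hlt, rfl⟩ := (hmem hao hbo).1 hw
    have hle := ((gLt_iff ha' hb' hao hbo).1 hlt).le
    have hm : max a.rank b.rank < δ.rank := max_lt (rank_lt_of_mem ha) (rank_lt_of_mem hb)
    have ha'δ : a' ∈ δ := by
      rw [← ha'.rank_lt_iff_mem hδ]
      exact ((le_max_left _ _).trans hle).trans_lt hm
    have hb'δ : b' ∈ δ := by
      rw [← hb'.rank_lt_iff_mem hδ]
      exact ((le_max_right _ _).trans hle).trans_lt hm
    exact ⟨_, _, (hPs_mem _ _).2 ⟨a', ha'δ, b', hb'δ, rfl, rfl⟩, a', ha'δ, b', hb'δ, rfl, hlt,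
      rfl⟩)
  have key : ∀ p : Ordinal.{u} × Ordinal.{u}, ∀ a ∈ j.toFun δ, ∀ b ∈ j.toFun δ,
      (a.rank, b.rank) = p → ∀ z : ZFSet.{u}, (a.pair b).pair z ∈ j.toFun Ps → z = pz a b := by
    intro p
    induction p using wf_oLt.induction with
    | _ p ih =>
    rintro a ha b hb rfl z hz
    obtain ⟨h1, h2⟩ := t2 _ _ hz a ha b hb rfl
    have hao := hjδ.mem ha
    have hbo := hjδ.mem hb
    ext w
    rw [hmem hao hbo]
    constructor
    · intro hw
      obtain ⟨q', w', hqw, a', ha', b', hb', rfl, hlt, rfl⟩ := h1 w hw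
      exact ⟨a', b', hjδ.mem ha', hjδ.mem hb', hlt,
        (ih _ ((gLt_iff (hjδ.mem ha') (hjδ.mem hb') hao hbo).1 hlt) a' ha' b' hb' rfl _ hqw).symm⟩
    · rintro ⟨a', b', ha'o, hb'o, hlt, rfl⟩
      have hlt' := (gLt_iff ha'o hb'o hao hbo).1 hlt
      have hle := hlt'.le
      have hm : max a.rank b.rank < (j.toFun δ).rank :=
        max_lt (rank_lt_of_mem ha) (rank_lt_of_mem hb)
      have ha' : a' ∈ j.toFun δ := by
        rw [← ha'o.rank_lt_iff_mem hjδ]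
        exact ((le_max_left _ _).trans hle).trans_lt hm
      have hb' : b' ∈ j.toFun δ := by
        rw [← hb'o.rank_lt_iff_mem hjδ]
        exact ((le_max_right _ _).trans hle).trans_lt hm
      obtain ⟨q', w', hqw, rfl, hw'⟩ := h2 a' ha' b' hb' hlt
      rwa [← ih _ hlt' a' ha' b' hb' rfl _ hqw]
  have haδ' := hjδ.isTransitive.mem_trans ha hθδ
  have hbδ' := hjδ.isTransitive.mem_trans hb hθδ
  have haδ := hδ.isTransitive.mem_trans ha hθ
  have hbδ := hδ.isTransitive.mem_trans hb hθ
  obtain ⟨q, z, hqz, rfl, hz⟩ := t1 a haδ' b hbδ'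
  obtain rfl := key _ a haδ' b hbδ' rfl z hqz
  rw [hz, hAB a haδ b hbδ]
  refine hagr _ ?_
  have : pz a b ∈ pz θ θ := by
    refine (hmem hθo hθo).2 ⟨a, b, hδ.mem haδ, hδ.mem hbδ, Or.inl ⟨Or.inl ha, Or.inl hb⟩, rfl⟩
  simp [hlamdef, this]

theorem WSCinSet_of_woodinSC {δ : ZFSet.{u}} (h : WoodinSC δ) : WSCinSet δ δ := by
  rw [wscInSet_iff]
  intro f₀ hf₀
  obtain ⟨F₀, hF₀, rfl⟩ := hf₀.exists_fun
  have hδ := h.1.1.isOrdinal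
  set F : ZFSet.{u} → ZFSet.{u} := fun a => F₀ a ∪ insert a a with hFdef
  have hsucc : ∀ a ∈ δ, insert a a ∈ δ := fun a ha => h.isCard.succ_mem h.nats_mem ha
  have hF : ∀ a ∈ δ, F a ∈ δ := fun a ha => IsOrdinal.union_mem hδ (hF₀ a ha) (hsucc a ha)
  have hFinfl : ∀ a, a ∈ F a := fun a => by simp [hFdef]
  suffices ∃ κ ∈ δ, WSCAt (graph δ F) κ by
    obtain ⟨κ, hκ, hκ'⟩ := this
    exact ⟨κ, hκ, hκ'.mono hδ hκ hF (fun a _ x hx => by simp [hFdef, hx]) hF₀⟩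
  obtain ⟨c, hcinj, hcord, hcrank, hcseg⟩ := exists_code.{u}
  have hcδ : ∀ x : ZFSet.{u}, x.rank < δ.rank → c x ∈ δ := by
    intro x hx
    have h1 : (V_ (Order.succ x.rank)).card < δ.card := by
      refine h.card_lt ?_
      rw [rank_vonNeumann]
      exact h.isCard.succ_lt_rank h.nats_mem hx
    refine IsOrdinal.mem_of_card_lt (hcord x) hδ (lt_of_le_of_lt ?_ h1)
    refine card_le_of_surj c fun z hz => ?_
    obtain ⟨y, hy, rfl⟩ := hcseg x z hz
    exact ⟨y, by rwa [mem_vonNeumann, Order.lt_succ_iff], rfl⟩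
  set B := ZFSet.sep (fun p => ∃ a b : ZFSet.{u}, p = a.pair b ∧
    ((∃ x y : ZFSet.{u}, x ∈ y ∧ y.rank < δ.rank ∧ a = c x ∧ b = c y) ∨ a = F b)) (δ.prod δ) with hB
  have hB_mem : ∀ a b : ZFSet.{u}, a.pair b ∈ B ↔ (a ∈ δ ∧ b ∈ δ) ∧
      ((∃ x y : ZFSet.{u}, x ∈ y ∧ y.rank < δ.rank ∧ a = c x ∧ b = c y) ∨ a = F b) := by
    intro a b
    rw [hB, mem_sep, pair_mem_prod]
    refine and_congr_right fun _ => ⟨?_, fun hab => ⟨a, b, rfl, hab⟩⟩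
    rintro ⟨a', b', e, hab⟩
    obtain ⟨rfl, rfl⟩ := pair_inj.1 e
    exact hab
  have hB_code : ∀ {x y : ZFSet.{u}}, x ∈ y → y.rank < δ.rank → (c x).pair (c y) ∈ B := by
    intro x y hxy hy
    exact (hB_mem _ _).2 ⟨⟨hcδ x ((rank_lt_of_mem hxy).trans hy), hcδ y hy⟩,
      Or.inl ⟨x, y, hxy, hy, rfl, rfl⟩⟩
  have hB_code' : ∀ {a b : ZFSet.{u}}, a ∈ b → a.pair b ∈ B →
      ∃ x y : ZFSet.{u}, x ∈ y ∧ y.rank < δ.rank ∧ a = c x ∧ b = c y := by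
    intro a b hab h'
    rcases ((hB_mem _ _).1 h').2 with h' | rfl
    · exact h'
    · exact absurd hab (mem_asymm (hFinfl b))
  have hB_val : ∀ a ∈ δ, ∀ b ∈ δ, b ∈ a → (a.pair b ∈ B ↔ b.pair a ∈ graph δ F) := by
    intro a ha b hb hba
    rw [hB_mem, pair_mem_graph]
    constructor
    · rintro ⟨-, ⟨x, y, hxy, hy, rfl, rfl⟩ | e⟩
      · exact absurd hba (mem_asymm (hcrank _ _ (rank_lt_of_mem hxy)))
      · exact ⟨hb, e⟩
    · exact fun e => ⟨⟨ha, hb⟩, Or.inr e.2⟩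
  set Cc := ZFSet.range (fun x : ↥(V_ δ.rank : ZFSet.{u}) => (c x).pair (x : ZFSet.{u})) with hCc
  have hCc_mem : ∀ a x : ZFSet.{u}, a.pair x ∈ Cc ↔ x.rank < δ.rank ∧ a = c x := by
    intro a x
    simp only [hCc, ZFSet.mem_range, Subtype.exists, pair_inj]
    constructor
    · rintro ⟨x', hx', rfl, rfl⟩
      exact ⟨mem_vonNeumann.1 hx', rfl⟩
    · rintro ⟨hx, rfl⟩
      exact ⟨x, mem_vonNeumann.2 hx, rfl, rfl⟩
  obtain ⟨κ, hκ, hagree⟩ := exists_agree (B := B) h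
  refine ⟨κ, hκ, ?_, ?_⟩
  · intro α β hαβ hα
    obtain ⟨hαδ, rfl⟩ := pair_mem_graph.1 hαβ
    have hθ : insert (F α ∪ κ) (F α ∪ κ) ∈ δ := hsucc _ (IsOrdinal.union_mem hδ (hF α hαδ) hκ)
    obtain ⟨M, j, hM, hj, hθj, hκj, -, hag⟩ := hagree _ hθ
    have hθo := hδ.mem hθ
    have hun := hδ.mem (IsOrdinal.union_mem hδ (hF α hαδ) hκ)
    have hFo := hδ.mem (hF α hαδ)
    have hκo := hδ.mem hκ
    have hFθ : F α ∈ insert (F α ∪ κ) (F α ∪ κ) := by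
      rw [mem_insert_iff]
      exact (hFo.subset_iff_eq_or_mem hun).1 fun x hx => by simp [hx]
    have hjκ : (j.toFun κ).IsOrdinal := ((emb_isOrd j hM).2 hj.1).isOrdinal
    have hjδ : (j.toFun δ).IsOrdinal := ((emb_isOrd j hM).2 h.1.1).isOrdinal
    have hFjκ : F α ∈ j.toFun κ := hjκ.isTransitive.mem_trans hFθ hθj
    have hjκδ : j.toFun κ ∈ j.toFun δ := (emb_mem j hM).2 hκ
    have t := (transfer3 j hM (fun _ δ B f => ∀ a ∈ δ, ∀ b ∈ δ, b ∈ a →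
      (a.pair b ∈ B ↔ b.pair a ∈ f)) δ B (graph δ F)).1 hB_val
    have h1 : (F α).pair α ∈ j.toFun B := (hag _ hFθ α
      (hθo.isTransitive.mem_trans (hFinfl α) hFθ)).1
      ((hB_val _ (hF α hαδ) α hαδ (hFinfl α)).2 hαβ)
    have h2 := (t _ (hjδ.isTransitive.mem_trans hFjκ hjκδ) α
      (hjδ.isTransitive.mem_trans (hj.subset_emb hM hα) hjκδ) (hFinfl α)).1 h1
    have h3 : α.pair (j.toFun (F α)) ∈ j.toFun (graph δ F) := by
      have := (emb_pair_mem j hM).2 hαβ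
      rwa [hj.2.2 α hα] at this
    have h4 : j.toFun (F α) = F α := ((emb_func j hM).2 (func_graph δ F) _ _ h2 _ h3).symm
    by_contra hn
    have h5 := (emb_subset j hM).2 ((hFo.notMem_iff_subset hκo).1 hn)
    rw [h4] at h5
    exact mem_irrefl _ (h5 hFjκ)
  · set y := F κ with hy
    have hyδ : y ∈ δ := hF κ hκ
    have hcy : c (insert y y) ∈ δ := hcδ _ (rank_lt_of_mem (hsucc y hyδ))
    have hu := IsOrdinal.union_mem hδ hyδ hcy
    have hθ := hsucc _ hu
    set θ := insert (y ∪ c (insert y y)) (y ∪ c (insert y y)) with hθdef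
    obtain ⟨M, j, hM, hj, hθj, hκj, hcov, hag⟩ := hagree θ hθ
    have hyo := hδ.mem hyδ
    have hθo := hδ.mem hθ
    have hjδ : (j.toFun δ).IsOrdinal := ((emb_isOrd j hM).2 h.1.1).isOrdinal
    have hyθ : y ∈ θ := by
      rw [hθdef, mem_insert_iff]
      exact (hyo.subset_iff_eq_or_mem (hδ.mem hu)).1 fun x hx => by simp [hx]
    have hcyθ : ∀ x ∈ c (insert y y), x ∈ θ := fun x hx => by simp [hθdef, hx]
    have hθδ : ∀ x ∈ θ, x ∈ j.toFun δ := fun x hx => hjδ.isTransitive.mem_trans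
      hx (hjδ.isTransitive.mem_trans hθj ((emb_mem j hM).2 hκ))
    have t := (transfer3 j hM (fun _ δ B f => ∀ a ∈ δ, ∀ b ∈ δ, b ∈ a →
      (a.pair b ∈ B ↔ b.pair a ∈ f)) δ B (graph δ F)).1 hB_val
    have hκθ : κ ∈ θ := hθo.isTransitive.mem_trans (hFinfl κ) hyθ
    refine ⟨M, j, y, hM, hj, ?_, ?_, ?_⟩
    · exact (t y (hθδ y hyθ) κ (hθδ κ hκθ) (hFinfl κ)).1 ((hag y hyθ κ hκθ).1
        ((hB_val y hyδ κ hκ (hFinfl κ)).2 (pair_mem_graph.2 ⟨hκ, rfl⟩)))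
    · obtain ⟨s, hs, hXs, hcard⟩ := hcov (ZFSet.range fun α : ↥y => j.toFun (α : ZFSet.{u}))
        (fun x hx => by
          obtain ⟨a, rfl⟩ := ZFSet.mem_range.1 hx
          exact j.maps _ trivial)
        ((card_le_of_surj j.toFun fun x hx => by
          obtain ⟨a, rfl⟩ := ZFSet.mem_range.1 hx
          exact ⟨a, a.2, rfl⟩).trans (card_mono (hθo.isTransitive.subset_of_mem hyθ)))
      exact ⟨s, hs, fun α hα => hXs (ZFSet.mem_range.2 ⟨⟨α, hα⟩, rfl⟩), hcard⟩
    · have t1 := (transfer2 j hM (fun _ Cc B => ∀ β x : ZFSet.{u}, β.pair x ∈ Cc →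
          (∀ α ∈ β, α.pair β ∈ B → ∃ z, α.pair z ∈ Cc ∧ z ∈ x) ∧
          (∀ z ∈ x, ∃ α : ZFSet.{u}, α.pair z ∈ Cc ∧ (α ∈ β ∧ α.pair β ∈ B))) Cc B).1 (by
        intro β x hβ
        obtain ⟨hx, rfl⟩ := (hCc_mem _ _).1 hβ
        refine ⟨fun α hα hαB => ?_, fun z hz => ?_⟩
        · obtain ⟨z, x', hzx, hx', rfl, e⟩ := hB_code' hα hαB
          obtain rfl := hcinj e
          exact ⟨z, (hCc_mem _ _).2 ⟨(rank_lt_of_mem hzx).trans hx', rfl⟩, hzx⟩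
        · exact ⟨c z, (hCc_mem _ _).2 ⟨(rank_lt_of_mem hz).trans hx, rfl⟩,
            hcrank _ _ (rank_lt_of_mem hz), hB_code hz hx⟩)
      have t2 := (transfer3 j hM (fun _ δ Cc B => ∀ β ∈ δ, ∀ α ∈ β, α.pair β ∈ B →
          ∃ z, α.pair z ∈ Cc ∧ z = z) δ Cc B).1 (by
        intro β hβ α hα hαB
        obtain ⟨z, x', hzx, hx', rfl, e⟩ := hB_code' hα hαB
        exact ⟨z, (hCc_mem _ _).2 ⟨(rank_lt_of_mem hzx).trans hx', rfl⟩, rfl⟩)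
      have key : ∀ x : ZFSet.{u}, x.rank < δ.rank → c x ∈ θ → ∀ x' : ZFSet.{u},
          (c x).pair x' ∈ j.toFun Cc → x' = x := by
        intro x
        induction x using ZFSet.inductionOn with
        | _ x ih =>
        intro hx hxθ x' hx'
        obtain ⟨h1, h2⟩ := t1 _ _ hx'
        ext z
        constructor
        · intro hz
          obtain ⟨α, hαz, hα, hαB⟩ := h2 z hz
          have hαθ := hθo.isTransitive.mem_trans hα hxθ
          obtain ⟨w, x'', hw, hx'', rfl, e⟩ := hB_code' hα ((hag _ hαθ _ hxθ).2 hαB)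
          obtain rfl := hcinj e
          rwa [ih w hw ((rank_lt_of_mem hw).trans hx) hαθ z hαz]
        · intro hz
          have hzx := hcrank _ _ (rank_lt_of_mem hz)
          have hzθ := hθo.isTransitive.mem_trans hzx hxθ
          obtain ⟨z', hz', hz'x⟩ := h1 _ hzx ((hag _ hzθ _ hxθ).1 (hB_code hz hx))
          rwa [← ih z hz ((rank_lt_of_mem hz).trans hx) hzθ z' hz']
      intro x _ hx
      have hx' : x.rank < y.rank := hx
      have hxx : x ∈ ({x} : ZFSet.{u}) := by simp
      have hrs : ({x} : ZFSet.{u}).rank ≤ y.rank := by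
        rw [rank_singleton]
        exact Order.succ_le_of_lt hx'
      have hyr := rank_lt_of_mem hyδ
      have h1 : c x ∈ c {x} := hcrank _ _ (rank_lt_of_mem hxx)
      have h2 : c {x} ∈ θ := hcyθ _ (hcrank _ _ (hrs.trans_lt (rank_lt_of_mem (mem_insert _ _))))
      have h3 := hθo.isTransitive.mem_trans h1 h2
      obtain ⟨x', hxx', -⟩ := t2 _ (hθδ _ h2) _ h1
        ((hag _ h3 _ h2).1 (hB_code hxx (hrs.trans_lt hyr)))
      obtain rfl := key x (hx'.trans hyr) h3 x' hxx'
      exact (hM.of_pair_mem (j.maps _ trivial) hxx').2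

section Ultrapower

variable {D : Type w} {ι : Type*}

/-- `g` depends only on the class of its argument under one of the relations `r i`. -/
def Meas {α : Type*} (r : ι → D → D → Prop) (g : D → α) : Prop :=
  ∃ i, ∀ a b, r i a b → g a = g b

/-- Countably complete ultrafilters for the measurable sets of a countably directed family. -/
structure IsUlt (r : ι → D → D → Prop) (U : Set (Set D)) : Prop where
  dir : ∀ s : ℕ → ι, ∃ i, ∀ a b, r i a b → ∀ n, r (s n) a b
  fip : ∀ s : ℕ → Set D, (∀ n, s n ∈ U) → ∃ a, ∀ n, a ∈ s n
  ult : ∀ Z : Set D, Meas r (· ∈ Z) → Z ∈ U ∨ Zᶜ ∈ U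

variable {r : ι → D → D → Prop} {U : Set (Set D)}

theorem IsUlt.fip_countable (h : IsUlt r U) (hne : U.Nonempty) {β : Type*} [Countable β]
    (s : β → Set D) (hs : ∀ n, s n ∈ U) : ∃ a, ∀ n, a ∈ s n := by
  rcases isEmpty_or_nonempty β with hβ | hβ
  · obtain ⟨Z, hZ⟩ := hne
    obtain ⟨a, -⟩ := h.fip (fun _ => Z) fun _ => hZ
    exact ⟨a, fun n => hβ.elim n⟩
  · obtain ⟨e, he⟩ := exists_surjective_nat β
    obtain ⟨a, ha⟩ := h.fip (fun n => s (e n)) fun n => hs _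
    refine ⟨a, fun n => ?_⟩
    obtain ⟨m, rfl⟩ := he n
    exact ha m

theorem IsUlt.mem_of (h : IsUlt r U) {β : Type*} [Countable β] (s : β → Set D)
    (hs : ∀ n, s n ∈ U) {Z : Set D} (hZ : Meas r (· ∈ Z)) (hsub : ∀ a, (∀ n, a ∈ s n) → a ∈ Z) :
    Z ∈ U := by
  rcases h.ult Z hZ with h' | h'
  · exact h'
  · obtain ⟨a, ha⟩ := h.fip_countable ⟨_, h'⟩ (fun n : Option β => n.elim Zᶜ s)
      (by rintro (_ | n); exacts [h', hs n])
    exact absurd (hsub a fun n => ha (some n)) (ha none)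

theorem IsUlt.mono (h : IsUlt r U) {Y Z : Set D} (hY : Y ∈ U) (hZ : Meas r (· ∈ Z))
    (hsub : Y ⊆ Z) : Z ∈ U :=
  h.mem_of (fun _ : Unit => Y) (fun _ => hY) hZ fun _ ha => hsub (ha ())

theorem IsUlt.inter (h : IsUlt r U) {X Y Z : Set D} (hX : X ∈ U) (hY : Y ∈ U)
    (hZ : Meas r (· ∈ Z)) (hsub : ∀ a, a ∈ X → a ∈ Y → a ∈ Z) : Z ∈ U :=
  h.mem_of (fun b : Bool => if b then X else Y) (by simp [hX, hY]) hZ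
    fun a ha => hsub a (by simpa using ha true) (by simpa using ha false)

theorem IsUlt.compl_mem (h : IsUlt r U) {Z : Set D} (hZ : Meas r (· ∈ Z)) :
    Zᶜ ∈ U ↔ Z ∉ U := by
  refine ⟨fun h1 h2 => ?_, fun h1 => (h.ult Z hZ).resolve_left h1⟩
  obtain ⟨a, ha⟩ := h.fip_countable ⟨_, h1⟩ (fun b : Bool => if b then Z else Zᶜ) (by simp [h1, h2])
  exact absurd (by simpa using ha true) (by simpa using ha false)

theorem IsUlt.meas_pi (h : IsUlt r U) [hι : Nonempty ι] {β : Type*} [Countable β] {α : Type*}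
    {v : β → D → α} (hv : ∀ b, Meas r (v b)) : Meas r (fun a b => v b a) := by
  choose s hs using hv
  rcases isEmpty_or_nonempty β with hβ | hβ
  · exact ⟨hι.some, fun a b _ => funext fun x => hβ.elim x⟩
  · obtain ⟨e, he⟩ := exists_surjective_nat β
    obtain ⟨i, hi⟩ := h.dir fun n => s (e n)
    refine ⟨i, fun a b hab => funext fun x => ?_⟩
    obtain ⟨n, rfl⟩ := he x
    exact hs _ _ _ (hi a b hab n)

theorem Meas.comp {α β : Type*} {g : D → α} (hg : Meas r g) (f : α → β) :
    Meas r (fun a => f (g a)) :=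
  hg.imp fun _ hi a b hab => congrArg f (hi a b hab)

theorem IsUlt.meas₂ (h : IsUlt r U) {α β : Type*} {f : D → α} {g : D → α} (hf : Meas r f)
    (hg : Meas r g) (F : α → α → β) : Meas r (fun a => F (f a) (g a)) := by
  have : Nonempty ι := ⟨hf.choose⟩
  have h1 := h.meas_pi (v := fun b : Bool => if b then f else g) (by simp [hf, hg])
  simpa using h1.comp fun p => F (p true) (p false)

/-- A countably complete ultrafilter on the measurable sets yields a well-founded ultrapower. -/
theorem IsUlt.exists_ultrapower (h : IsUlt r U) [Nonempty ι] [Small.{u} D] :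
    ∃ (N : Set ZFSet.{u}) (c : (D → ZFSet.{u}) → ZFSet.{u}), TransClass N ∧
      (∀ z, z ∈ N ↔ ∃ g, Meas r g ∧ c g = z) ∧
      ∀ (n : ℕ) (φ : Fml n) (v : Fin n → D → ZFSet.{u}), (∀ i, Meas r (v i)) →
        (φ.Realize N (fun i => c (v i)) ↔ {a | φ.Realize Set.univ (fun i => v i a)} ∈ U) := by
  classical
  let T := {g : D → ZFSet.{u} // Meas r g}
  let R : T → T → Prop := fun g k => {a | g.1 a ∈ k.1 a} ∈ U
  let Q : T → T → Prop := fun g k => {a | g.1 a = k.1 a} ∈ U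
  have hm : ∀ (g k : T) (P : ZFSet.{u} → ZFSet.{u} → Prop), Meas r (· ∈ {a | P (g.1 a) (k.1 a)}) :=
    fun g k P => h.meas₂ g.2 k.2 P
  have hRQ : ∀ {g k k' : T}, R g k → Q k k' → R g k' := fun {g k k'} h1 h2 =>
    h.inter h1 h2 (hm _ _ _) fun a (h1 : _ ∈ _) (h2 : _ = _) => by
      change g.1 a ∈ k'.1 a
      rwa [← h2]
  have hQR : ∀ {g g' k : T}, Q g g' → R g k → R g' k := fun {g g' k} h1 h2 =>
    h.inter h1 h2 (hm _ _ _) fun a (h1 : _ = _) (h2 : _ ∈ _) => by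
      change g'.1 a ∈ k.1 a
      rwa [← h1]
  have hQs : ∀ {g k : T}, Q g k → Q k g := fun h1 =>
    h.mono h1 (hm _ _ _) fun a (h1 : _ = _) => h1.symm
  have hwf : WellFounded R := by
    rw [wellFounded_iff_isEmpty_descending_chain]
    refine ⟨fun ⟨s, hs⟩ => ?_⟩
    obtain ⟨a, ha⟩ := h.fip _ hs
    exact (wellFounded_iff_isEmpty_descending_chain.1 ZFSet.mem_wf).elim ⟨fun n => (s n).1 a, ha⟩
  let trunc : T → T → T := fun g k => ⟨fun a => if g.1 a ∈ k.1 a then g.1 a else ∅,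
    h.meas₂ g.2 k.2 fun x y => if x ∈ y then x else ∅⟩
  let R' : T → T → Prop := fun g k => R g k ∧ ∀ a, g.1 a ∈ insert ∅ (k.1 a)
  have htr : ∀ {g k : T}, R g k → R' (trunc g k) k ∧ Q g (trunc g k) := by
    intro g k hgk
    have hQ : Q g (trunc g k) := h.mono hgk (hm _ _ _) fun a (ha : _ ∈ _) => by
      exact (if_pos ha).symm
    refine ⟨⟨hQR hQ hgk, fun a => ?_⟩, hQ⟩
    by_cases ha : g.1 a ∈ k.1 a <;> simp [trunc, ha]
  obtain ⟨c, hc⟩ := exists_collapse (r := R') (Subrelation.wf (fun h' => h'.1) hwf) (by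
    intro k
    refine small_of_injective (β := (a : D) → {z // z ∈ insert ∅ (k.1 a)})
      (f := fun g a => ⟨g.1.1 a, g.2.2 a⟩) fun g g' e => ?_
    refine Subtype.ext (Subtype.ext (funext fun a => ?_))
    exact congrArg Subtype.val (congrFun e a))
  have hcQ : ∀ g k : T, Q g k → c g = c k := by
    intro g
    induction g using hwf.induction with
    | _ g ih =>
    intro k hgk
    ext z
    rw [hc, hc]
    constructor
    · rintro ⟨y, hy, rfl⟩
      obtain ⟨h1, h2⟩ := htr (hRQ hy.1 hgk)
      exact ⟨_, h1, (ih y hy.1 _ h2).symm⟩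
    · rintro ⟨y, hy, rfl⟩
      obtain ⟨h1, h2⟩ := htr (hRQ hy.1 (hQs hgk))
      exact ⟨_, h1, ih _ h1.1 _ (hQs h2)⟩
  have hcR : ∀ (g : T) (z : ZFSet.{u}), z ∈ c g ↔ ∃ y, R y g ∧ c y = z := by
    intro g z
    rw [hc]
    constructor
    · rintro ⟨y, hy, e⟩
      exact ⟨y, hy.1, e⟩
    · rintro ⟨y, hy, rfl⟩
      exact ⟨_, (htr hy).1, (hcQ _ _ (htr hy).2).symm⟩
  have hcinj : ∀ g k : T, c g = c k → Q g k := by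
    intro g
    induction g using hwf.induction with
    | _ g ih =>
    intro k e
    by_contra hn
    have hne : {a | g.1 a = k.1 a}ᶜ ∈ U := (h.compl_mem (hm g k _)).2 hn
    have hex : ∀ x y : ZFSet.{u}, ∃ z, x ≠ y → ((z ∈ x ∧ z ∉ y) ∨ (z ∈ y ∧ z ∉ x)) := by
      intro x y
      by_contra! hz
      have := (hz ∅).1
      exact this (ZFSet.ext fun z => ⟨fun hzx => (hz z).2.1 hzx,
        fun hzy => (hz z).2.2 hzy⟩)
    choose ch hch using hex
    let y : T := ⟨fun a => ch (g.1 a) (k.1 a), h.meas₂ g.2 k.2 ch⟩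
    have hnm : ∀ x y : T, ¬ R x y → {a | x.1 a ∉ y.1 a} ∈ U := fun x y hxy =>
      (h.compl_mem (hm x y (· ∈ ·))).2 hxy
    by_cases hyg : R y g
    · have h1 : R y k := by
        have : c y ∈ c k := by
          rw [← e, hcR]
          exact ⟨y, hyg, rfl⟩
        obtain ⟨y', hy', e'⟩ := (hcR k _).1 this
        exact hQR (hQs (ih y hyg y' e'.symm)) hy'
      obtain ⟨a, ha⟩ := h.fip_countable ⟨_, hne⟩ (fun i : Fin 3 => ![_, _, _] i)
        (by simp [Fin.forall_fin_succ]; exact ⟨hne, hyg, h1⟩)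
      simp only [Fin.forall_fin_succ] at ha
      have h2 := hch _ _ ha.1
      have h3 : ch (g.1 a) (k.1 a) ∈ g.1 a := ha.2.1
      have h4 : ch (g.1 a) (k.1 a) ∈ k.1 a := ha.2.2.1
      tauto
    · have h1 : ¬ R y k := by
        intro hyk
        have : c y ∈ c g := by
          rw [e, hcR]
          exact ⟨y, hyk, rfl⟩
        obtain ⟨y', hy', e'⟩ := (hcR g _).1 this
        exact hyg (hQR (ih y' hy' y e') hy')
      obtain ⟨a, ha⟩ := h.fip_countable ⟨_, hne⟩ (fun i : Fin 3 => ![_, _, _] i)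
        (by simp [Fin.forall_fin_succ]; exact ⟨hne, hnm _ _ hyg, hnm _ _ h1⟩)
      simp only [Fin.forall_fin_succ] at ha
      have h2 := hch _ _ ha.1
      have h3 : ch (g.1 a) (k.1 a) ∉ g.1 a := ha.2.1
      have h4 : ch (g.1 a) (k.1 a) ∉ k.1 a := ha.2.2.1
      tauto
  refine ⟨Set.range c, fun g => if hg : Meas r g then c ⟨g, hg⟩ else ∅, ?_, ?_, ?_⟩
  · rintro _ ⟨g, rfl⟩ z hz
    obtain ⟨y, -, rfl⟩ := (hcR _ _).1 hz
    exact ⟨y, rfl⟩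
  · intro z
    constructor
    · rintro ⟨g, rfl⟩
      exact ⟨g.1, g.2, dif_pos g.2⟩
    · rintro ⟨g, hg, rfl⟩
      exact ⟨⟨g, hg⟩, by simp [hg]⟩
  · have key : ∀ (n : ℕ) (φ : Fml n) (v : Fin n → T),
        (φ.Realize (Set.range c) (fun i => c (v i)) ↔
          {a | φ.Realize Set.univ (fun i => (v i).1 a)} ∈ U) := by
      have hmeas : ∀ {n : ℕ} (v : Fin n → T) (P : (Fin n → ZFSet.{u}) → Prop),
          Meas r (· ∈ {a | P (fun i => (v i).1 a)}) := fun v P =>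
        (h.meas_pi fun i => (v i).2).comp P
      intro n φ
      induction φ with
      | mem i k =>
        intro v
        simp only [Fml.Realize]
        rw [hcR]
        constructor
        · rintro ⟨y, hy, e⟩
          exact hQR (hcinj _ _ e) hy
        · exact fun h' => ⟨_, h', rfl⟩
      | eq i k => exact fun v => ⟨hcinj _ _, hcQ _ _⟩
      | not φ ih =>
        intro v
        simp only [Fml.Realize]
        rw [ih, ← h.compl_mem (hmeas v _)]
        rfl
      | and φ ψ ihφ ihψ =>
        intro v
        simp only [Fml.Realize]
        rw [ihφ, ihψ]
        constructor
        · exact fun h' => h.inter h'.1 h'.2 (hmeas v fun x => φ.Realize _ x ∧ ψ.Realize _ x)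
            fun a h1 h2 => ⟨h1, h2⟩
        · exact fun h' => ⟨h.mono h' (hmeas v _) fun a ha => ha.1,
            h.mono h' (hmeas v _) fun a ha => ha.2⟩
      | @ex n φ ih =>
        intro v
        have hsnoc : ∀ y : T, (Fin.snoc (fun i => c (v i)) (c y) : Fin (n + 1) → ZFSet.{u}) =
            fun i => c ((Fin.snoc v y : Fin (n + 1) → T) i) := by
          intro y
          funext i
          refine Fin.lastCases ?_ (fun i => ?_) i <;> simp
        have hsnoc' : ∀ (y : T) (a : D), (fun i => ((Fin.snoc v y : Fin (n + 1) → T) i).1 a) =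
            (Fin.snoc (fun i => (v i).1 a) (y.1 a) : Fin (n + 1) → ZFSet.{u}) := by
          intro y a
          funext i
          refine Fin.lastCases ?_ (fun i => ?_) i <;> simp
        simp only [Fml.Realize]
        constructor
        · rintro ⟨_, ⟨y, rfl⟩, hy⟩
          rw [hsnoc, ih] at hy
          refine h.mono hy (hmeas v fun x => ∃ z ∈ Set.univ, φ.Realize Set.univ (Fin.snoc x z))
            fun a ha => ⟨y.1 a, trivial, ?_⟩
          have : φ.Realize Set.univ _ := ha
          rwa [hsnoc'] at this
        · intro h'
          have hex : ∀ x : Fin n → ZFSet.{u}, ∃ z : ZFSet.{u},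
              (∃ z ∈ Set.univ, φ.Realize Set.univ (Fin.snoc x z)) →
                φ.Realize Set.univ (Fin.snoc x z) := by
            intro x
            by_cases hx : ∃ z ∈ Set.univ, φ.Realize Set.univ (Fin.snoc x z)
            · obtain ⟨z, -, hz⟩ := hx
              exact ⟨z, fun _ => hz⟩
            · exact ⟨∅, fun hx' => absurd hx' hx⟩
          choose ch hch using hex
          let y : T := ⟨fun a => ch fun i => (v i).1 a, (h.meas_pi fun i => (v i).2).comp ch⟩
          refine ⟨c y, ⟨y, rfl⟩, ?_⟩
          rw [hsnoc, ih]
          refine h.mono h' (hmeas _ _) fun a ha => ?_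
          change φ.Realize Set.univ _
          rw [hsnoc']
          exact hch _ ha
    intro n φ v hv
    have := key n φ fun i => ⟨v i, hv i⟩
    simpa [hv] using this

end Ultrapower

section Predicates

/-- The relations `t` and `t'` agree on the range of `e`. -/
def Agree (e t t' : ZFSet.{u}) : Prop :=
  ∀ i ξ : ZFSet.{u}, i.pair ξ ∈ e →
    (∀ v, ξ.pair v ∈ t → ξ.pair v ∈ t') ∧ ∀ v, ξ.pair v ∈ t' → ξ.pair v ∈ t

/-- `e` is a partial function from `ω` to `l`. -/
def CFun (ω l e : ZFSet.{u}) : Prop :=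
  Func e ∧ ∀ q ∈ e, ∃ i ∈ ω, ∃ ξ ∈ l, q = i.pair ξ

/-- Membership of `(t, p)` in `X` depends only on `p` and the restriction of `t` to the range
of `e`. -/
def Supp (O e X : ZFSet.{u}) : Prop :=
  ∀ t p : ZFSet.{u}, t.pair p ∈ O → ∀ t', t'.pair p ∈ O → Agree e t t' →
    t.pair p ∈ X → t'.pair p ∈ X

/-- The section of `G` at `(t, p)` depends only on `p` and the restriction of `t` to the range
of `e`. -/
def SuppRel (O e G : ZFSet.{u}) : Prop :=
  ∀ t p : ZFSet.{u}, t.pair p ∈ O → ∀ t', t'.pair p ∈ O → Agree e t t' →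
    ∀ q v : ZFSet.{u}, q.pair v ∈ G → q = t.pair p → (t'.pair p).pair v ∈ G

/-- Countable completeness. -/
def WitFip (C : Set ZFSet.{u}) (ω O E : ZFSet.{u}) : Prop :=
  ∀ g ∈ C, CFun ω E g → ∃ o ∈ O, ∀ i X : ZFSet.{u}, i.pair X ∈ g → o ∈ X

/-- The ultrafilter property for sets of countable support. -/
def WitUlt (C : Set ZFSet.{u}) (ω l O E : ZFSet.{u}) : Prop :=
  ∀ X ∈ C, ∀ Y ∈ C, ∀ e ∈ C, CFun ω l e → Supp O e X → Supp O e Y →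
    X ⊆ O → Y ⊆ O → (∀ o ∈ O, o ∈ X ∨ o ∈ Y) → X ∈ E ∨ Y ∈ E

/-- Almost every `t` has exactly one value at each `ξ ∈ l`, and it lies in `κ`. -/
def WitVal (κ l E : ZFSet.{u}) : Prop :=
  ∀ ξ ∈ l, ∃ X ∈ E, ∀ t p : ZFSet.{u}, t.pair p ∈ X →
    ∃ v ∈ κ, ξ.pair v ∈ t ∧ ∀ v', ξ.pair v' ∈ t → v' = v

/-- Almost every `t` is increasing. -/
def WitMono (l E : ZFSet.{u}) : Prop :=
  ∀ ξ ∈ l, ∀ η ∈ ξ, ∃ X ∈ E, ∀ t p : ZFSet.{u}, t.pair p ∈ X →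
    ∀ v, η.pair v ∈ t → ∀ w, ξ.pair w ∈ t → v ∈ w

/-- Normality: a function regressive at `ξ` is represented by some `η ∈ ξ`. -/
def WitNormal (C : Set ZFSet.{u}) (ω l O E : ZFSet.{u}) : Prop :=
  ∀ ξ ∈ l, ∀ G ∈ C, ∀ e ∈ C, CFun ω l e → SuppRel O e G →
    (∃ X ∈ E, ∀ t p : ZFSet.{u}, t.pair p ∈ X →
      ∃ q v : ZFSet.{u}, q.pair v ∈ G ∧ (q = t.pair p ∧ ∀ v', ξ.pair v' ∈ t → v ∈ v')) →
    ∃ η ∈ ξ, ∃ X ∈ E, ∀ t p : ZFSet.{u}, t.pair p ∈ X →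
      ∀ v, η.pair v ∈ t → (t.pair p).pair v ∈ G

/-- Almost every `t` is the identity at each `ξ ∈ κ`. -/
def WitCrit (κ E : ZFSet.{u}) : Prop :=
  ∀ ξ ∈ κ, ∃ X ∈ E, ∀ t p : ZFSet.{u}, t.pair p ∈ X → ∀ v, ξ.pair v ∈ t → v = ξ

/-- The values of almost every `t` reflect membership in `A`. -/
def WitAgree (l A E : ZFSet.{u}) : Prop :=
  ∀ ξ ∈ l, (ξ ∈ A → ∃ X ∈ E, ∀ t p : ZFSet.{u}, t.pair p ∈ X → ∀ v, ξ.pair v ∈ t → v ∈ A) ∧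
    (ξ ∉ A → ∃ X ∈ E, ∀ t p : ZFSet.{u}, t.pair p ∈ X → ∀ v, ξ.pair v ∈ t → v ∉ A)

/-- Fineness. -/
def WitFine (l E : ZFSet.{u}) : Prop :=
  ∀ α ∈ l, ∃ X ∈ E, ∀ t p : ZFSet.{u}, t.pair p ∈ X → ∃ i : ZFSet.{u}, i.pair α ∈ p ∧ i = i

/-- Almost every `p` is a function with domain bounded in `κ`. -/
def WitSmall (κ E : ZFSet.{u}) : Prop :=
  ∃ X ∈ E, ∀ t p : ZFSet.{u}, t.pair p ∈ X →
    Func p ∧ ∃ β ∈ κ, ∀ i a : ZFSet.{u}, i.pair a ∈ p → i ∈ β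

/-- `E` generates, on the set `O` of pairs, an ultrafilter witnessing strong compactness. -/
def Wit (C : Set ZFSet.{u}) (ω κ l A O E : ZFSet.{u}) : Prop :=
  (∀ o ∈ O, ∃ t ∈ C, ∃ p ∈ C, o = t.pair p) ∧ (∀ X ∈ E, X ⊆ O) ∧
  WitFip C ω O E ∧ WitUlt C ω l O E ∧ WitVal κ l E ∧ WitMono l E ∧ WitNormal C ω l O E ∧
  WitCrit κ E ∧ WitAgree l A E ∧ WitFine l E ∧ WitSmall κ E

variable {n : ℕ} {a b c d e f : (Fin n → ZFSet.{u}) → ZFSet.{u}}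

instance dfn_agree [IsVar a] [IsVar b] [IsVar c] : Dfn (fun _ v => Agree (a v) (b v) (c v)) :=
  Dfn.subst3 (F := fun _ a b c => Agree a b c) (by
    unfold Agree
    infer_instance)

instance dfn_cFun [IsVar a] [IsVar b] [IsVar c] : Dfn (fun _ v => CFun (a v) (b v) (c v)) :=
  Dfn.subst3 (F := fun _ a b c => CFun a b c) (by
    unfold CFun
    infer_instance)

instance dfn_supp [IsVar a] [IsVar b] [IsVar c] : Dfn (fun _ v => Supp (a v) (b v) (c v)) :=
  Dfn.subst3 (F := fun _ a b c => Supp a b c) (by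
    unfold Supp
    infer_instance)

instance dfn_suppRel [IsVar a] [IsVar b] [IsVar c] : Dfn (fun _ v => SuppRel (a v) (b v) (c v)) :=
  Dfn.subst3 (F := fun _ a b c => SuppRel a b c) (by
    unfold SuppRel
    infer_instance)

instance dfn_witFip [IsVar a] [IsVar b] [IsVar c] :
    Dfn (fun C v => WitFip C (a v) (b v) (c v)) :=
  Dfn.subst3 (F := fun C a b c => WitFip C a b c) (by
    unfold WitFip
    infer_instance)

instance dfn_witUlt [IsVar a] [IsVar b] [IsVar c] [IsVar d] :
    Dfn (fun C v => WitUlt C (a v) (b v) (c v) (d v)) :=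
  Dfn.subst4 (F := fun C a b c d => WitUlt C a b c d) (by
    unfold WitUlt
    infer_instance)

instance dfn_witVal [IsVar a] [IsVar b] [IsVar c] :
    Dfn (fun _ v => WitVal (a v) (b v) (c v)) :=
  Dfn.subst3 (F := fun _ a b c => WitVal a b c) (by
    unfold WitVal
    infer_instance)

instance dfn_witMono [IsVar a] [IsVar b] :
    Dfn (fun _ v => WitMono (a v) (b v)) :=
  Dfn.subst2 (F := fun _ a b => WitMono a b) (by
    unfold WitMono
    infer_instance)

instance dfn_witNormal [IsVar a] [IsVar b] [IsVar c] [IsVar d] :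
    Dfn (fun C v => WitNormal C (a v) (b v) (c v) (d v)) :=
  Dfn.subst4 (F := fun C a b c d => WitNormal C a b c d) (by
    unfold WitNormal
    infer_instance)

instance dfn_witCrit [IsVar a] [IsVar b] :
    Dfn (fun _ v => WitCrit (a v) (b v)) :=
  Dfn.subst2 (F := fun _ a b => WitCrit a b) (by
    unfold WitCrit
    infer_instance)

instance dfn_witAgree [IsVar a] [IsVar b] [IsVar c] :
    Dfn (fun _ v => WitAgree (a v) (b v) (c v)) :=
  Dfn.subst3 (F := fun _ a b c => WitAgree a b c) (by
    unfold WitAgree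
    infer_instance)

instance dfn_witFine [IsVar a] [IsVar b] :
    Dfn (fun _ v => WitFine (a v) (b v)) :=
  Dfn.subst2 (F := fun _ a b => WitFine a b) (by
    unfold WitFine
    infer_instance)

instance dfn_witSmall [IsVar a] [IsVar b] :
    Dfn (fun _ v => WitSmall (a v) (b v)) :=
  Dfn.subst2 (F := fun _ a b => WitSmall a b) (by
    unfold WitSmall
    infer_instance)

instance dfn_wit [IsVar a] [IsVar b] [IsVar c] [IsVar d] [IsVar e] [IsVar f] :
    Dfn (fun C v => Wit C (a v) (b v) (c v) (d v) (e v) (f v)) := by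
  unfold Wit
  infer_instance

instance dfn_isFuncOn [IsVar a] [IsVar b] : Dfn (fun _ v => IsFuncOn (a v) (b v)) :=
  (Dfn.subst2 (F := fun C a b => (∀ p ∈ b, ∃ x ∈ a, ∃ y ∈ C, p = x.pair y) ∧
    ∀ x ∈ a, ∃ y, x.pair y ∈ b ∧ ∀ z, x.pair z ∈ b → z = y) inferInstance).congr
  fun C v hC hv => by
    unfold IsFuncOn ExistsUnique
    refine and_congr (forall₂_congr fun p hp => ?_) Iff.rfl
    constructor
    · rintro ⟨x, hx, y, -, e⟩
      exact ⟨x, y, hx, e⟩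
    · rintro ⟨x, y, hx, rfl⟩
      exact ⟨x, hx, y, (hC.of_pair_mem (IsVar.mem_class hv) hp).2, rfl⟩

instance dfn_mapsInto [IsVar a] [IsVar b] : Dfn (fun _ v => MapsInto (a v) (b v)) :=
  Dfn.subst2 (F := fun _ a b => MapsInto a b) (by
    unfold MapsInto
    infer_instance)

instance dfn_injFun [IsVar a] : Dfn (fun _ v => InjFun (a v)) :=
  (Dfn.subst1 (F := fun _ a => ∀ x y : ZFSet.{u}, x.pair y ∈ a →
    ∀ x', x'.pair y ∈ a → x = x') inferInstance).congr fun _ _ _ _ =>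
    ⟨fun h x x' y h1 h2 => h x y h1 x' h2, fun h x y h1 x' h2 => h x x' y h1 h2⟩

instance dfn_cardLtIn [IsVar a] [IsVar b] : Dfn (fun C v => CardLtIn C (a v) (b v)) :=
  (Dfn.subst2 (F := fun C a b => ∃ β ∈ b, ∃ f ∈ C, IsFuncOn a f ∧ MapsInto f β ∧ InjFun f)
    inferInstance).congr fun _ _ _ _ =>
    ⟨fun ⟨β, hβ, f, hf, h⟩ => ⟨β, f, hβ, hf, h⟩, fun ⟨β, f, hβ, hf, h⟩ => ⟨β, hβ, f, hf, h⟩⟩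

end Predicates

section Enumeration

theorem exists_cFun {l : ZFSet.{u}} {S : Set ZFSet.{u}} (hS : S.Countable) (hl : ∀ x ∈ S, x ∈ l) :
    ∃ e, CFun nats l e ∧ ∀ ξ, ξ ∈ S ↔ ∃ i : ZFSet.{u}, i.pair ξ ∈ e := by
  rcases S.eq_empty_or_nonempty with rfl | hne
  · exact ⟨∅, ⟨fun x y h => by simp at h, fun q h => by simp at h⟩, by simp⟩
  · obtain ⟨f, rfl⟩ := hS.exists_eq_range hne
    choose! k hk using fun x : ZFSet.{u} => (mem_nats (x := x)).1
    have hk' : ∀ n : ℕ, k (Ordinal.toZFSet n) = n := fun n => by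
      have := hk _ (mem_nats.2 ⟨n, rfl⟩)
      exact_mod_cast Ordinal.toZFSet_injective this.symm
    refine ⟨graph nats fun x => f (k x), ⟨func_graph _ _, fun q hq => ?_⟩, fun ξ => ?_⟩
    · obtain ⟨x, hx, rfl⟩ := mem_graph.1 hq
      exact ⟨x, hx, _, hl _ ⟨_, rfl⟩, rfl⟩
    · simp only [pair_mem_graph]
      constructor
      · rintro ⟨n, rfl⟩
        exact ⟨_, mem_nats.2 ⟨n, rfl⟩, by rw [hk']⟩
      · rintro ⟨i, -, rfl⟩
        exact ⟨_, rfl⟩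

theorem CFun.mem {l e i ξ : ZFSet.{u}} {ω : ZFSet.{u}} (h : CFun ω l e) (hi : i.pair ξ ∈ e) :
    i ∈ ω ∧ ξ ∈ l := by
  obtain ⟨i', h1, ξ', h2, e⟩ := h.2 _ hi
  obtain ⟨rfl, rfl⟩ := pair_inj.1 e
  exact ⟨h1, h2⟩

theorem CFun.countable {l e : ZFSet.{u}} (h : CFun nats l e) :
    {ξ | ∃ i : ZFSet.{u}, i.pair ξ ∈ e}.Countable := by
  refine (Set.countable_range fun n : ℕ =>
    Classical.epsilon fun ξ : ZFSet.{u} => (Ordinal.toZFSet n).pair ξ ∈ e).mono ?_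
  rintro ξ ⟨i, hi⟩
  obtain ⟨n, rfl⟩ := mem_nats.1 (h.mem hi).1
  have := Classical.epsilon_spec (p := fun ξ : ZFSet.{u} => (Ordinal.toZFSet n).pair ξ ∈ e) ⟨ξ, hi⟩
  exact ⟨n, h.1 _ _ this _ hi⟩

theorem exists_cFun_iUnion {l : ZFSet.{u}} (s : ℕ → ZFSet.{u}) (hs : ∀ n, CFun nats l (s n)) :
    ∃ e, CFun nats l e ∧
      ∀ n (i ξ : ZFSet.{u}), i.pair ξ ∈ s n → ∃ i' : ZFSet.{u}, i'.pair ξ ∈ e := by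
  obtain ⟨e, he, h⟩ := exists_cFun (l := l) (Set.countable_iUnion fun n => (hs n).countable) (by
    intro x hx
    obtain ⟨n, i, hi⟩ := Set.mem_iUnion.1 hx
    exact ((hs n).mem hi).2)
  exact ⟨e, he, fun n i ξ hi => (h ξ).1 (Set.mem_iUnion.2 ⟨n, i, hi⟩)⟩

end Enumeration

section Embedding

variable {D : Type w} {ι : Type*} {r : ι → D → D → Prop} {U : Set (Set D)}

theorem IsUlt.exists_emb (h : IsUlt r U) [Nonempty ι] [Small.{u} D] :
    ∃ (N : Set ZFSet.{u}) (c : (D → ZFSet.{u}) → ZFSet.{u})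
      (i : ElemEmb (Set.univ : Set ZFSet.{u}) N), TransClass N ∧
      (∀ z, z ∈ N ↔ ∃ g, Meas r g ∧ c g = z) ∧ (∀ x, i.toFun x = c fun _ => x) ∧
      ∀ P : Set ZFSet.{u} → ZFSet.{u} → ZFSet.{u} → Prop,
        Dfn (fun C (v : Fin 2 → ZFSet.{u}) => P C (v 0) (v 1)) → ∀ f g, Meas r f → Meas r g →
          (P N (c f) (c g) ↔ {a | P Set.univ (f a) (g a)} ∈ U) := by
  obtain ⟨N, c, hN, hc, los⟩ := h.exists_ultrapower
  have hconst : ∀ x : ZFSet.{u}, Meas r fun _ => x := fun x =>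
    ⟨Classical.arbitrary ι, fun _ _ _ => rfl⟩
  refine ⟨N, c, ⟨fun x => c fun _ => x, fun x _ => (hc _).2 ⟨_, hconst x, rfl⟩,
    fun {n} φ v _ => ?_⟩, hN, hc, fun _ => rfl, fun P hP f g hf hg => ?_⟩
  · rw [los n φ (fun i _ => v i) fun i => hconst _]
    constructor
    · intro hφ
      simp only [hφ, Set.ofPred_true]
      rcases h.ult Set.univ ⟨Classical.arbitrary ι, by simp⟩ with h' | h'
      · exact h'
      · obtain ⟨a, ha⟩ := h.fip (fun _ => _) fun _ => h'
        exact absurd (ha 0) (by simp)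
    · intro hφ
      obtain ⟨a, ha⟩ := h.fip (fun _ => _) fun _ => hφ
      exact ha 0
  · obtain ⟨φ, hφ⟩ := hP
    have h0 : ∀ i, Meas r ((![f, g] : Fin 2 → D → ZFSet.{u}) i) := by
      simp [Fin.forall_fin_succ, hf, hg]
    have h1 := los 2 φ ![f, g] h0
    rw [hφ N _ hN fun i => (hc _).2 ⟨_, h0 i, rfl⟩] at h1
    have h2 : ∀ a, _ ↔ _ := fun a => hφ Set.univ (fun i => (![f, g] : Fin 2 → D → ZFSet.{u}) i a)
      (fun _ _ _ _ => trivial) (fun _ => trivial)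
    simp only [h2] at h1
    exact h1

end Embedding

section Witness

/-- The pairs `(t, p)` that belong to `O`. -/
abbrev Pts (O : ZFSet.{u}) : Type (u + 1) := {q : ZFSet.{u} × ZFSet.{u} // q.1.pair q.2 ∈ O}

instance small_pts (O : ZFSet.{u}) : Small.{u} (Pts O) :=
  small_of_injective (β := O) (f := fun q : Pts O => ⟨q.1.1.pair q.1.2, q.2⟩) (by
    rintro ⟨⟨a, b⟩, hq⟩ ⟨⟨a', b'⟩, hq'⟩ h
    simpa [pair_inj] using h)

/-- Having the same second coordinate, and first coordinates that agree on the range of `e`. -/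
def wRel (O l : ZFSet.{u}) (e : {e : ZFSet.{u} // CFun nats l e}) (a b : Pts O) : Prop :=
  a.1.2 = b.1.2 ∧ Agree e a.1.1 b.1.1

/-- The sets of points that have a subset coded by a member of `E`. -/
def wUlt (O E : ZFSet.{u}) : Set (Set (Pts O)) :=
  {Z | ∃ X ∈ E, ∀ a : Pts O, a.1.1.pair a.1.2 ∈ X → a ∈ Z}

variable {κ l A O E : ZFSet.{u}}

theorem meas_wRel {α : Type*} {g : Pts O → α} {S : Set ZFSet.{u}} (hS : S.Countable)
    (hl : ∀ x ∈ S, x ∈ l) (hg : ∀ a b : Pts O, a.1.2 = b.1.2 →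
      (∀ ξ ∈ S, ∀ v, ξ.pair v ∈ a.1.1 ↔ ξ.pair v ∈ b.1.1) → g a = g b) : Meas (wRel O l) g := by
  obtain ⟨e, he, h⟩ := exists_cFun hS hl
  refine ⟨⟨e, he⟩, fun a b hab => hg a b hab.1 fun ξ hξ v => ?_⟩
  obtain ⟨i, hi⟩ := (h ξ).1 hξ
  exact ⟨(hab.2 i ξ hi).1 v, (hab.2 i ξ hi).2 v⟩

theorem Wit.isUlt (h : Wit Set.univ nats κ l A O E) : IsUlt (wRel O l) (wUlt O E) := by
  obtain ⟨hO, hE, hfip, hult, -⟩ := h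
  refine ⟨fun s => ?_, fun s hs => ?_, fun Z hZ => ?_⟩
  · obtain ⟨e, he, h⟩ := exists_cFun_iUnion (fun n => (s n).1) fun n => (s n).2
    refine ⟨⟨e, he⟩, fun a b hab n => ⟨hab.1, fun i ξ hi => ?_⟩⟩
    obtain ⟨i', hi'⟩ := h n i ξ hi
    exact hab.2 i' ξ hi'
  · choose X hX hXs using hs
    obtain ⟨g, hg, h⟩ := exists_cFun (l := E) (Set.countable_range X)
      (by rintro _ ⟨n, rfl⟩; exact hX n)
    obtain ⟨o, ho, h'⟩ := hfip g trivial hg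
    obtain ⟨t, -, p, -, rfl⟩ := hO o ho
    refine ⟨⟨(t, p), ho⟩, fun n => hXs n _ ?_⟩
    obtain ⟨i, hi⟩ := (h (X n)).1 ⟨n, rfl⟩
    exact h' i _ hi
  · obtain ⟨⟨e, he⟩, h⟩ := hZ
    have key : ∀ Z : Set (Pts O), (∀ a b, wRel O l ⟨e, he⟩ a b → (a ∈ Z) = (b ∈ Z)) →
        Supp O e (ZFSet.sep (fun o => ∃ a ∈ Z, o = a.1.1.pair a.1.2) O) := by
      intro Z h t p htp t' htp' hag hX
      obtain ⟨-, a, ha, e⟩ := mem_sep.1 hX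
      refine mem_sep.2 ⟨htp', ⟨(t', p), htp'⟩, ?_, rfl⟩
      obtain ⟨e1, e2⟩ := pair_inj.1 e
      rw [← h a ⟨(t', p), htp'⟩ ⟨e2.symm, e1 ▸ hag⟩]
      exact ha
    have sub : ∀ Z : Set (Pts O), ZFSet.sep (fun o => ∃ a ∈ Z, o = a.1.1.pair a.1.2) O ∈ E →
        Z ∈ wUlt O E := by
      refine fun Z hZ => ⟨_, hZ, fun a ha => ?_⟩
      obtain ⟨-, b, hb, e⟩ := mem_sep.1 ha
      obtain ⟨e1, e2⟩ := pair_inj.1 e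
      have : a = b := Subtype.ext (Prod.ext e1 e2)
      exact this ▸ hb
    refine (hult _ trivial _ trivial e trivial he (key Z h) (key Zᶜ fun a b hab => ?_)
      (fun _ => fun ho => (mem_sep.1 ho).1) (fun _ => fun ho => (mem_sep.1 ho).1) ?_).imp (sub Z)
        (sub Zᶜ)
    · simp only [Set.mem_compl_iff, h a b hab]
    · intro o ho
      obtain ⟨t, -, p, -, rfl⟩ := hO o ho
      by_cases hZ : (⟨(t, p), ho⟩ : Pts O) ∈ Z
      · exact Or.inl (mem_sep.2 ⟨ho, _, hZ, rfl⟩)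
      · exact Or.inr (mem_sep.2 ⟨ho, ⟨(t, p), ho⟩, hZ, rfl⟩)

/-- The value of `t` at `ξ`. -/
noncomputable def wVal (κ ξ : ZFSet.{u}) (a : Pts O) : ZFSet.{u} :=
  ⋃₀ (ZFSet.sep (fun v => ξ.pair v ∈ a.1.1) κ : ZFSet.{u})

theorem meas_wVal {ξ : ZFSet.{u}} (hξ : ξ ∈ l) : Meas (wRel O l) (wVal (O := O) κ ξ) :=
  meas_wRel (Set.countable_singleton ξ) (by simpa) fun a b _ hab => by
    unfold wVal
    simp only [hab ξ rfl]

/-- `wVal κ ξ a` is the only value of `t` at `ξ`. -/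
def Good (κ ξ : ZFSet.{u}) (a : Pts O) : Prop :=
  wVal κ ξ a ∈ κ ∧ ∀ v, ξ.pair v ∈ a.1.1 ↔ v = wVal κ ξ a

theorem Wit.good_mem (h : Wit Set.univ nats κ l A O E) {ξ : ZFSet.{u}} (hξ : ξ ∈ l) :
    {a : Pts O | Good κ ξ a} ∈ wUlt O E := by
  obtain ⟨X, hX, hv⟩ := h.2.2.2.2.1 ξ hξ
  refine ⟨X, hX, fun a ha => ?_⟩
  obtain ⟨v, hv, h1, h2⟩ := hv _ _ ha
  have : wVal κ ξ a = v := by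
    have e : (ZFSet.sep (fun v => ξ.pair v ∈ a.1.1) κ : ZFSet.{u}) = {v} := by
      ext z
      rw [mem_sep, mem_singleton]
      exact ⟨fun hz => h2 z hz.2, fun e => e ▸ ⟨hv, h1⟩⟩
    rw [wVal, e, sUnion_singleton]
  refine ⟨this ▸ hv, fun w => ?_⟩
  rw [this]
  exact ⟨h2 w, fun e => e ▸ h1⟩

end Witness

section Construction

variable {κ l A O E : ZFSet.{u}}

theorem Good.eq {ξ v : ZFSet.{u}} {a : Pts O} (h : Good κ ξ a) (hv : ξ.pair v ∈ a.1.1) :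
    v = wVal κ ξ a := (h.2 v).1 hv

theorem Good.pair_mem {ξ : ZFSet.{u}} {a : Pts O} (h : Good κ ξ a) :
    ξ.pair (wVal κ ξ a) ∈ a.1.1 := (h.2 _).2 rfl

theorem Wit.wVal_mem_wVal (h : Wit Set.univ nats κ l A O E) (hl : l.IsTransitive) {ξ η : ZFSet.{u}}
    (hξ : ξ ∈ l) (hη : η ∈ ξ) : {a : Pts O | wVal κ η a ∈ wVal κ ξ a} ∈ wUlt O E := by
  obtain ⟨X, hX, hv⟩ := h.2.2.2.2.2.1 ξ hξ η hη
  refine h.isUlt.mem_of (β := Option Bool) (fun b => match b with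
    | none => {a | a.1.1.pair a.1.2 ∈ X}
    | some true => {a | Good κ ξ a}
    | some false => {a | Good κ η a}) ?_ ?_ fun a ha => ?_
  · rintro (_ | _ | _)
    · exact ⟨X, hX, fun a ha => ha⟩
    · exact h.good_mem (hl.mem_trans hη hξ)
    · exact h.good_mem hξ
  · exact h.isUlt.meas₂ (meas_wVal (hl.mem_trans hη hξ)) (meas_wVal hξ) (· ∈ ·)
  · exact hv _ _ (ha none) _ (Good.pair_mem (ha (some false))) _ (Good.pair_mem (ha (some true)))

/-- Almost all points `a` that belong to `X` and are good at `ξ` satisfy `Q`. -/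
theorem Wit.mem_of_good (h : Wit Set.univ nats κ l A O E) {ξ X : ZFSet.{u}} (hξ : ξ ∈ l)
    (hX : X ∈ E)
    {Q : Set (Pts O)} (hQ : Meas (wRel O l) (· ∈ Q))
    (hs : ∀ a : Pts O, a.1.1.pair a.1.2 ∈ X → Good κ ξ a → a ∈ Q) : Q ∈ wUlt O E :=
  h.isUlt.inter (X := {a | a.1.1.pair a.1.2 ∈ X}) ⟨X, hX, fun _ ha => ha⟩ (h.good_mem hξ) hQ hs

theorem Wit.exists_normal (h : Wit Set.univ nats κ l A O E) (hl : l.IsTransitive) {ξ : ZFSet.{u}}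
    (hξ : ξ ∈ l)
    {g : Pts O → ZFSet.{u}} (hg : Meas (wRel O l) g) (hgξ : {a | g a ∈ wVal κ ξ a} ∈ wUlt O E) :
    ∃ η ∈ ξ, {a | wVal κ η a = g a} ∈ wUlt O E := by
  obtain ⟨⟨e, he⟩, hge⟩ := id hg
  let G : ZFSet.{u} := ZFSet.range fun a : Pts O => (a.1.1.pair a.1.2).pair (g a)
  have hG : ∀ (a : Pts O) v, (a.1.1.pair a.1.2).pair v ∈ G ↔ v = g a := by
    intro a v
    simp only [G, ZFSet.mem_range]
    constructor
    · rintro ⟨b, hb⟩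
      obtain ⟨h1, h2⟩ := pair_inj.1 hb
      obtain ⟨h3, h4⟩ := pair_inj.1 h1
      rw [← h2, show b = a from Subtype.ext (Prod.ext h3 h4)]
    · rintro rfl
      exact ⟨a, rfl⟩
  have hsupp : SuppRel O e G := by
    rintro t p htp t' htp' hag q v hq rfl
    rw [hG ⟨(t, p), htp⟩] at hq
    exact (hG ⟨(t', p), htp'⟩ v).2 (hq.trans (hge _ _ ⟨rfl, hag⟩))
  obtain ⟨X, hX, hXg⟩ := h.isUlt.inter hgξ (h.good_mem hξ)
    (Z := {a | g a ∈ wVal κ ξ a ∧ ∀ v, ξ.pair v ∈ a.1.1 → v = wVal κ ξ a}) (by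
      obtain ⟨⟨e', he'⟩, h'⟩ := id hg
      refine meas_wRel (S := {ζ | ∃ i : ZFSet.{u}, i.pair ζ ∈ e'} ∪ {ξ})
        (he'.countable.union (Set.countable_singleton _)) ?_ fun a b h1 h2 => ?_
      · rintro x (⟨i, hi⟩ | rfl)
        exacts [(he'.mem hi).2, hξ]
      · have e1 : g a = g b := h' a b ⟨h1, fun i ζ hi =>
          ⟨fun v => (h2 ζ (Or.inl ⟨i, hi⟩) v).1, fun v => (h2 ζ (Or.inl ⟨i, hi⟩) v).2⟩⟩
        have e2 : wVal κ ξ a = wVal κ ξ b := by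
          unfold wVal
          simp only [h2 ξ (Or.inr rfl)]
        simp only [Set.mem_ofPred_eq, e1, e2, h2 ξ (Or.inr rfl)])
    fun a h1 h2 => ⟨h1, fun v hv => h2.eq hv⟩
  obtain ⟨η, hη, Y, hY, hYg⟩ := h.2.2.2.2.2.2.1 ξ hξ G trivial e trivial he hsupp
    ⟨X, hX, fun t p htp =>
    ⟨t.pair p, g ⟨(t, p), h.2.1 X hX htp⟩, (hG ⟨(t, p), h.2.1 X hX htp⟩ _).2 rfl, rfl, fun v' hv' =>
      by
      have := hXg ⟨(t, p), h.2.1 X hX htp⟩ htp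
      rw [this.2 v' hv']
      exact this.1⟩⟩
  have hηl := hl.mem_trans hη hξ
  refine ⟨η, hη, h.mem_of_good hηl hY (h.isUlt.meas₂ (meas_wVal hηl) hg (· = ·)) fun a ha hgood =>
    ?_⟩
  exact (hG a _).1 (hYg _ _ ha _ hgood.pair_mem)

/-- The value of `t'` at each point of the range of `e` is at most `wVal κ lam a`. -/
def Near (κ lam e : ZFSet.{u}) (a a' : Pts O) : Prop :=
  a'.1.2 = a.1.2 ∧ ∀ k ξ : ZFSet.{u}, k.pair ξ ∈ e →
    ∃ v, (v ∈ wVal κ lam a ∨ v = wVal κ lam a) ∧ ∀ w, ξ.pair w ∈ a'.1.1 ↔ w = v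

/-- A function representing a set that covers `X`. -/
noncomputable def wCover (κ lam X : ZFSet.{u}) (F : ZFSet.{u} → ZFSet.{u})
    (g : ZFSet.{u} → Pts O → ZFSet.{u}) (e : ZFSet.{u} → ZFSet.{u}) (a : Pts O) : ZFSet.{u} :=
  ZFSet.range fun q : {q : X × Pts O // (∃ i : ZFSet.{u}, i.pair (F q.1) ∈ a.1.2) ∧
    Near κ lam (e q.1) a q.2} => g q.1.1 q.1.2

variable {lam X : ZFSet.{u}} {F : ZFSet.{u} → ZFSet.{u}} {g : ZFSet.{u} → Pts O → ZFSet.{u}}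
  {e : ZFSet.{u} → ZFSet.{u}}

theorem mem_wCover {a : Pts O} {z : ZFSet.{u}} : z ∈ wCover κ lam X F g e a ↔
    ∃ x ∈ X, ∃ a', (∃ i : ZFSet.{u}, i.pair (F x) ∈ a.1.2) ∧
      Near κ lam (e x) a a' ∧ z = g x a' := by
  rw [wCover, ZFSet.mem_range]
  constructor
  · rintro ⟨⟨⟨x, a'⟩, h1, h2⟩, rfl⟩
    exact ⟨x, x.2, a', h1, h2, rfl⟩
  · rintro ⟨x, hx, a', h1, h2, rfl⟩
    exact ⟨⟨⟨⟨x, hx⟩, a'⟩, h1, h2⟩, rfl⟩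

theorem meas_wCover (hlam : lam ∈ l) : Meas (wRel O l) (wCover (O := O) κ lam X F g e) :=
  meas_wRel (Set.countable_singleton lam) (by simpa) fun a b h1 h2 => by
    have e2 : wVal κ lam a = wVal κ lam b := by
      unfold wVal
      simp only [h2 lam rfl]
    ext z
    simp only [mem_wCover, Near, h1, e2]

theorem card_wCover_le (hF : ∀ x ∈ X, ∀ y ∈ X, F x = F y → x = y) (he : ∀ x ∈ X, CFun nats l (e x))
    (hg : ∀ x ∈ X, ∀ a b : Pts O, a.1.2 = b.1.2 → Agree (e x) a.1.1 b.1.1 → g x a = g x b)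
    {a : Pts O} {β : ZFSet.{u}} (hp : Func a.1.2)
    (hβ : ∀ i x : ZFSet.{u}, i.pair x ∈ a.1.2 → i ∈ β) :
    (wCover κ lam X F g e a).card ≤
      (β.prod (nats.prod (insert (wVal κ lam a) (wVal κ lam a))).powerset).card := by
  set τ := wVal κ lam a with hτ
  let u : ZFSet.{u} → Pts O → ZFSet.{u} := fun x a' =>
    ZFSet.sep (fun q => ∃ k v ξ : ZFSet.{u}, q = k.pair v ∧ k.pair ξ ∈ e x ∧ ξ.pair v ∈ a'.1.1)
      (nats.prod (insert τ τ))
  let R : ZFSet.{u} → ZFSet.{u} → Prop := fun q z => ∃ x ∈ X, ∃ a', ∃ i : ZFSet.{u}, i.pair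
    (F x) ∈ a.1.2 ∧
    Near κ lam (e x) a a' ∧ q = i.pair (u x a') ∧ z = g x a'
  have hR : ∀ q z z', R q z → R q z' → z = z' := by
    rintro q z z' ⟨x, hx, a', i, hi, hn, rfl, rfl⟩ ⟨x', hx', a'', i', hi', hn', e', rfl⟩
    obtain ⟨rfl, hu⟩ := pair_inj.1 e'
    obtain rfl := hF x hx x' hx' (hp _ _ hi _ hi')
    refine hg x hx _ _ (hn.1.trans hn'.1.symm) fun k ξ hk => ?_
    obtain ⟨v, hv, hv'⟩ := hn.2 k ξ hk
    obtain ⟨w, hw, hw'⟩ := hn'.2 k ξ hk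
    have h1 : k.pair v ∈ u x a' := mem_sep.2 ⟨mem_prod.2 ⟨k, ((he x hx).mem hk).1, v,
      by rw [mem_insert_iff]; exact hv.symm, rfl⟩, k, v, ξ, rfl, hk, (hv' v).2 rfl⟩
    rw [hu] at h1
    obtain ⟨-, k', v', ξ', e1, hk', hξ'⟩ := mem_sep.1 h1
    obtain ⟨rfl, rfl⟩ := pair_inj.1 e1
    obtain rfl := (he x hx).1 _ _ hk _ hk'
    obtain rfl := (hw' v).1 hξ'
    exact ⟨fun z hz => (hw' z).2 ((hv' z).1 hz), fun z hz => (hv' z).2 ((hw' z).1 hz)⟩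
  refine card_le_of_surj (fun q => Classical.epsilon (R q)) fun z hz => ?_
  obtain ⟨x, hx, a', ⟨i, hi⟩, hn, rfl⟩ := mem_wCover.1 hz
  have hRx : R (i.pair (u x a')) (g x a') := ⟨x, hx, a', i, hi, hn, rfl, rfl⟩
  refine ⟨i.pair (u x a'), ?_, hR _ _ _ (Classical.epsilon_spec ⟨_, hRx⟩) hRx⟩
  rw [pair_mem_prod, mem_powerset]
  exact ⟨hβ _ _ hi, fun q => fun hq => (mem_sep.1 hq).1⟩

theorem IsCrit.cardLtIn {M : Set ZFSet.{u}} {j : ElemEmb (Set.univ : Set ZFSet.{u}) M}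
    (hM : TransClass M) (h : IsCrit j κ) {β τ c : ZFSet.{u}} (hβ : β ∈ κ) (hτ : τ ∈ κ)
    (hc : c.card ≤ (β.prod (nats.prod (insert τ τ)).powerset).card) : CardLtIn Set.univ c κ := by
  have hκ := h.1.isOrdinal
  have hs := fun o ho => hκ.succ_lt_rank (fun α hα => h.succ_mem hM hα) (o := o) ho
  have hprod : ∀ x y : ZFSet.{u}, x.rank < κ.rank → y.rank < κ.rank → (x.prod y).rank < κ.rank :=
    fun x y hx hy => (rank_prod_le x y).trans_lt (hs _ (hs _ (max_lt hx hy)))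
  have h1 : (β.prod (nats.prod (insert τ τ)).powerset).rank < κ.rank := by
    refine hprod _ _ (rank_lt_of_mem hβ) ?_
    rw [rank_powerset]
    exact hs _ (hprod _ _ (rank_lt_of_mem (h.nats_mem hM)) (rank_lt_of_mem (h.succ_mem hM hτ)))
  obtain ⟨γ, hγ, hle⟩ := exists_mem_card_le hκ (hc.trans_lt (h.card_lt hM _ h1))
  obtain ⟨f, hf, h'⟩ := setLeIn_univ.2 hle
  exact ⟨γ, f, hγ, hf, h'⟩

end Construction

theorem Wit.lamSCFor {κ lam A O E : ZFSet.{u}} (hlam : lam.IsOrdinal) (hκ : oLe κ lam)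
    (h : Wit Set.univ nats κ (insert lam lam) A O E) : LamSCFor κ lam A := by
  obtain ⟨l, hl⟩ : ∃ l, l = insert lam lam := ⟨_, rfl⟩
  rw [← hl] at h
  have hlO : l.IsOrdinal := hl ▸ isOrdinal_succ hlam
  have hlT : l.IsTransitive := hlO.isTransitive
  have hmem : ∀ {ξ}, ξ ∈ l ↔ ξ = lam ∨ ξ ∈ lam := by simp [hl]
  have hlaml : lam ∈ l := hmem.2 (Or.inl rfl)
  have hκl : κ ∈ l := hmem.2 hκ.symm
  have hκO : κ.IsOrdinal := hlO.mem hκl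
  have hU := h.isUlt
  obtain ⟨e₀, he₀, -⟩ := exists_cFun (l := l) Set.countable_empty (by simp)
  have : Nonempty {e : ZFSet.{u} // CFun nats l e} := ⟨⟨e₀, he₀⟩⟩
  obtain ⟨N, c, i, hN, hNc, hi, los⟩ := hU.exists_emb
  have hconst : ∀ x : ZFSet.{u}, Meas (wRel O l) fun _ => x := fun x =>
    ⟨⟨e₀, he₀⟩, fun _ _ _ => rfl⟩
  have hcmem := fun f g => los (fun _ a b => a ∈ b) inferInstance f g
  have hceq := fun f g => los (fun _ a b => a = b) inferInstance f g
  have hval : ∀ ξ ∈ l, c (wVal κ ξ) = ξ := by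
    intro ξ
    induction ξ using ZFSet.inductionOn with | _ ξ ih => ?_
    intro hξ
    ext z
    constructor
    · intro hz
      obtain ⟨g, hg, rfl⟩ := (hNc z).1 (hN _ ((hNc _).2 ⟨_, meas_wVal hξ, rfl⟩) _ hz)
      obtain ⟨η, hη, h'⟩ := h.exists_normal hlT hξ hg ((hcmem _ _ hg (meas_wVal hξ)).1 hz)
      rw [← (hceq _ _ (meas_wVal (hlT.mem_trans hη hξ)) hg).2 h', ih η hη (hlT.mem_trans hη hξ)]
      exact hη
    · intro hz
      have hzl := hlT.mem_trans hz hξ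
      have := (hcmem _ _ (meas_wVal hzl) (meas_wVal hξ)).2 (h.wVal_mem_wVal hlT hξ hz)
      rwa [ih z hz hzl] at this
  have hlk : ∀ ξ ∈ l, ξ ∈ i.toFun κ := fun ξ hξ => by
    have := (hcmem _ _ (meas_wVal hξ) (hconst κ)).2
      (hU.mono (h.good_mem hξ) (hU.meas₂ (meas_wVal hξ) (hconst κ) (· ∈ ·)) fun a ha => ha.1)
    rwa [hval ξ hξ, ← hi] at this
  have hcrit : IsCrit i κ := by
    refine ⟨isOrd_iff.2 hκO, fun e => ?_, fun α hα => ?_⟩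
    · have := hlk κ hκl
      rw [e] at this
      exact ZFSet.mem_irrefl _ this
    · have hαl := hlT.mem_trans hα hκl
      obtain ⟨X, hX, hv⟩ := h.2.2.2.2.2.2.2.1 α hα
      have := (hceq _ _ (meas_wVal hαl) (hconst α)).2 (h.mem_of_good hαl hX
        (hU.meas₂ (meas_wVal hαl) (hconst α) (· = ·)) fun a ha hg => hv _ _ ha _ hg.pair_mem)
      rw [hi, ← this, hval α hαl]
  refine ⟨N, Set.subset_univ _, hN, i, hcrit, hlk lam hlaml, ?_, ?_⟩
  · intro X _ hXN hXl
    rw [setLeIn_univ, card_le_iff] at hXl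
    obtain ⟨F, hFl, hF⟩ := hXl
    choose! g hg hgx using fun x hx => (hNc x).1 (hXN hx)
    choose! e' he' using hg
    let e : ZFSet.{u} → ZFSet.{u} := fun x => (e' x).1
    have he : ∀ x, CFun nats l (e x) := fun x => (e' x).2
    have hG := meas_wCover (O := O) (κ := κ) (X := X) (F := F) (g := g) (e := e) hlaml
    have hgm : ∀ x ∈ X, Meas (wRel O l) (g x) := fun x hx => ⟨e' x, he' x hx⟩
    refine ⟨c (wCover κ lam X F g e), (hNc _).2 ⟨_, hG, rfl⟩, fun x => fun hx => ?_, ?_⟩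
    · rw [← hgx x hx, hcmem _ _ (hgm x hx) hG]
      obtain ⟨Y, hY, hYf⟩ := h.2.2.2.2.2.2.2.2.2.1 (F x) (hmem.2 (Or.inr (hFl x hx)))
      have hcount := (he x).countable
      have := hcount.to_subtype
      refine hU.mem_of (β := Option ({ξ | ∃ i : ZFSet.{u}, i.pair ξ ∈ e x})) (fun b => match b with
        | none => {a | a.1.1.pair a.1.2 ∈ Y}
        | some ξ => {a | Good κ ξ.1 a ∧ (wVal κ ξ.1 a ∈ wVal κ lam a ∨ wVal κ ξ.1 a =
          wVal κ lam a)})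
        ?_ (hU.meas₂ (hgm x hx) hG (· ∈ ·)) fun a ha => ?_
      · rintro (_ | ⟨ξ, k, hk⟩)
        · exact ⟨Y, hY, fun a ha => ha⟩
        · have hξ := ((he x).mem hk).2
          have hm : Meas (wRel O l) (· ∈ {a : Pts O | Good κ ξ a ∧
              (wVal κ ξ a ∈ wVal κ lam a ∨ wVal κ ξ a = wVal κ lam a)}) := by
            refine meas_wRel (S := {ξ, lam}) (by simp) (by simp [hξ, hlaml]) fun a b h1 h2 => ?_
            have e1 : wVal κ lam a = wVal κ lam b := by
              unfold wVal
              simp only [h2 lam (by simp)]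
            have e2 : wVal κ ξ a = wVal κ ξ b := by
              unfold wVal
              simp only [h2 ξ (by simp)]
            simp only [Good, Set.mem_ofPred_eq, e1, e2, h2 ξ (by simp)]
          rcases hmem.1 hξ with rfl | hξ'
          · exact hU.mono (h.good_mem hξ) hm fun a ha => ⟨ha, Or.inr rfl⟩
          · exact hU.inter (h.good_mem hξ) (h.wVal_mem_wVal hlT hlaml hξ') hm
              fun a h1 h2 => ⟨h1, Or.inl h2⟩
      · obtain ⟨k, hk, -⟩ := hYf _ _ (ha none)
        refine mem_wCover.2 ⟨x, hx, a, ⟨k, hk⟩, ⟨rfl, fun k ξ hξ => ?_⟩, rfl⟩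
        have := ha (some ⟨ξ, k, hξ⟩)
        exact ⟨_, this.2, this.1.2⟩
    · rw [hi, los (fun C a b => CardLtIn C a b) inferInstance _ _ hG (hconst κ)]
      obtain ⟨Y, hY, hYs⟩ := h.2.2.2.2.2.2.2.2.2.2
      refine h.mem_of_good hlaml hY (hU.meas₂ hG (hconst κ) (CardLtIn Set.univ)) fun a ha hgood =>
        ?_
      obtain ⟨hp, β, hβ, hβ'⟩ := hYs _ _ ha
      exact hcrit.cardLtIn hN hβ hgood.1 (card_wCover_le hF (fun x _ => he x)
        (fun x hx a b h1 h2 => he' x hx a b ⟨h1, h2⟩) hp hβ')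
  · intro ξ hξ
    have hξl : ξ ∈ l := hmem.2 (Or.inr hξ)
    obtain ⟨h1, h2⟩ := h.2.2.2.2.2.2.2.2.1 ξ hξl
    have hA := hcmem _ _ (meas_wVal (κ := κ) hξl) (hconst A)
    rw [hval ξ hξl, ← hi] at hA
    rw [hA]
    have hm := hU.meas₂ (meas_wVal (κ := κ) hξl) (hconst A) (· ∈ ·)
    constructor
    · intro hξA
      obtain ⟨X, hX, hv⟩ := h1 hξA
      exact h.mem_of_good hξl hX hm fun a ha hg => hv _ _ ha _ hg.pair_mem
    · intro hξU
      by_contra hξA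
      obtain ⟨X, hX, hv⟩ := h2 hξA
      refine (hU.compl_mem hm).1 (h.mem_of_good hξl hX ?_ fun a ha hg =>
        hv _ _ ha _ hg.pair_mem) hξU
      exact hm.comp Not

section Derivation

variable {M : Set ZFSet.{u}} {j : ElemEmb (Set.univ : Set ZFSet.{u}) M} {κ l A p e e' : ZFSet.{u}}
  {T : ZFSet.{u} → ZFSet.{u}}

theorem emb_cFun_mem (hM : TransClass M) (he : CFun nats l e) {i b : ZFSet.{u}}
    (h : i.pair b ∈ j.toFun e) : ∃ a, i.pair a ∈ e ∧ b = j.toFun a := by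
  have h1 := (transfer3 j hM (fun _ a b c => CFun a b c) nats l e).1 he
  rw [emb_nats j hM] at h1
  have hi : j.toFun i = i := by
    obtain ⟨n, rfl⟩ := mem_nats.1 (h1.mem h).1
    exact emb_nat j hM n
  obtain ⟨a, ha, -⟩ := (transfer2 j hM (fun _ a b => ∃ x, a.pair x ∈ b ∧ x = x) i e).2
    ⟨b, hi.symm ▸ h, rfl⟩
  have h2 := (emb_pair_mem j hM).2 ha
  rw [hi] at h2
  exact ⟨a, ha, h1.1 _ _ h _ h2⟩

/-- The index set of the derived ultrafilter. -/
noncomputable def wO (κ l : ZFSet.{u}) : ZFSet.{u} := (l.prod κ).powerset.prod (κ.prod l).powerset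

theorem mem_wO {t p : ZFSet.{u}} : t.pair p ∈ wO κ l ↔
    (∀ q ∈ t, ∃ a ∈ l, ∃ b ∈ κ, q = a.pair b) ∧ ∀ q ∈ p, ∃ a ∈ κ, ∃ b ∈ l, q = a.pair b := by
  rw [wO, pair_mem_prod, mem_powerset, mem_powerset]
  exact and_congr ⟨fun h q hq => mem_prod.1 (h hq), fun h q => fun hq => mem_prod.2 (h q hq)⟩
    ⟨fun h q hq => mem_prod.1 (h hq), fun h q => fun hq => mem_prod.2 (h q hq)⟩

/-- The derived ultrafilter: the sets `X` of countable support `e` with `(T e, p) ∈ j X`. -/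
noncomputable def wE (j : ElemEmb (Set.univ : Set ZFSet.{u}) M) (κ l p : ZFSet.{u})
    (T : ZFSet.{u} → ZFSet.{u}) : ZFSet.{u} :=
  ZFSet.sep (fun X => ∃ e, CFun nats l e ∧ Supp (wO κ l) e X ∧ (T e).pair p ∈ j.toFun X)
    (wO κ l).powerset

/-- `p` enumerates a cover of `j '' l`, and `T e` is the inverse of `j` on the image of the range
of `e`. -/
structure IsSeed (j : ElemEmb (Set.univ : Set ZFSet.{u}) M) (κ l p : ZFSet.{u})
    (T : ZFSet.{u} → ZFSet.{u}) : Prop where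
  trans : TransClass M
  crit : IsCrit j κ
  ord : l.IsTransitive
  le : l ⊆ j.toFun κ
  mem_iff : ∀ {e}, CFun nats l e →
    ∀ {b a : ZFSet.{u}}, b.pair a ∈ T e ↔ b = j.toFun a ∧ ∃ i : ZFSet.{u}, i.pair a ∈ e
  mem_class : ∀ {e}, CFun nats l e → T e ∈ M
  mem_emb : ∀ {e}, CFun nats l e → (T e).pair p ∈ j.toFun (wO κ l)
  func : Func p
  bdd : ∃ β ∈ j.toFun κ, ∀ i a : ZFSet.{u}, i.pair a ∈ p → i ∈ β
  fine : ∀ α ∈ l, ∃ i : ZFSet.{u}, i.pair (j.toFun α) ∈ p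

theorem IsCrit.exists_isSeed (hM : TransClass M) (hj : IsCrit j κ) (hl : l.IsTransitive)
    (hlκ : l ⊆ j.toFun κ) (hcov : WCovers M j.toFun κ l) (hcl : ∀ e, CFun nats l e → e ∈ M) :
    ∃ p T, IsSeed j κ l p T := by
  obtain ⟨s, hs, hls, β, c, hβ, hc, hcf, hcβ, hci⟩ := hcov
  have hjκ := (emb_isOrd j hM).2 hj.1
  obtain ⟨p, hp, hp1, hp2, hp3⟩ := (transfer2 j hM (fun C κ l => ∀ c ∈ C, ∃ p ∈ C,
    (∀ q ∈ p, ∃ b ∈ κ, ∃ ξ ∈ l, q = b.pair ξ) ∧ (∀ b ξ : ZFSet.{u}, b.pair ξ ∈ p → ξ.pair b ∈ c) ∧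
    ∀ ξ b : ZFSet.{u}, ξ.pair b ∈ c → b ∈ κ → ξ ∈ l → b.pair ξ ∈ p) κ l).1 (by
      intro c _
      refine ⟨ZFSet.sep (fun q => ∃ b ξ : ZFSet.{u}, q = b.pair ξ ∧ ξ.pair b ∈ c) (κ.prod l),
        trivial,
        fun q hq => ?_, fun b ξ hq => ?_, fun ξ b h hb hξ => ?_⟩
      · exact mem_prod.1 (mem_sep.1 hq).1
      · obtain ⟨-, b', ξ', e, h⟩ := mem_sep.1 hq
        obtain ⟨rfl, rfl⟩ := pair_inj.1 e
        exact h
      · exact mem_sep.2 ⟨pair_mem_prod.2 ⟨hb, hξ⟩, b, ξ, rfl, h⟩) c hc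
  have hex : ∀ e, CFun nats l e → ∃ t ∈ M, (∀ q ∈ t, ∃ b ∈ j.toFun l, ∃ a ∈ j.toFun κ, q =
    b.pair a) ∧
      ∀ b ∈ j.toFun l, ∀ a ∈ j.toFun κ,
        (b.pair a ∈ t ↔ ∃ i : ZFSet.{u}, i.pair b ∈ j.toFun e ∧ i.pair a ∈ e) := by
    intro e he
    refine (transfer2 j hM (fun C κ l => ∀ e' ∈ C, ∀ e ∈ C, ∃ t ∈ C,
      (∀ q ∈ t, ∃ b ∈ l, ∃ a ∈ κ, q = b.pair a) ∧
      ∀ b ∈ l, ∀ a ∈ κ, (b.pair a ∈ t ↔ ∃ i : ZFSet.{u}, i.pair b ∈ e' ∧ i.pair a ∈ e)) κ l).1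
      (fun e' _ e _ => ?_) _ (j.maps e trivial) e (hcl e he)
    refine ⟨ZFSet.sep (fun q => ∃ b a i : ZFSet.{u}, q = b.pair a ∧ i.pair b ∈ e' ∧ i.pair a ∈ e)
      (l.prod κ), trivial, fun q hq => mem_prod.1 (mem_sep.1 hq).1, fun b hb a ha => ?_⟩
    rw [mem_sep, pair_mem_prod]
    constructor
    · rintro ⟨-, b', a', i, e, h⟩
      obtain ⟨rfl, rfl⟩ := pair_inj.1 e
      exact ⟨i, h⟩
    · rintro ⟨i, h⟩
      exact ⟨⟨hb, ha⟩, b, a, i, rfl, h⟩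
  choose! T hTM hT1 hT2 using hex
  refine ⟨p, T, hM, hj, hl, hlκ, fun {e} he {b a} => ?_, fun he => hTM _ he, fun {e} he => ?_, ?_,
    ⟨β, hβ, fun i a hi => hcβ _ _ (hp2 _ _ hi)⟩, fun α hα => ?_⟩
  · have key : (∃ i : ZFSet.{u}, i.pair b ∈ j.toFun e ∧ i.pair a ∈ e) ↔
        b = j.toFun a ∧ ∃ i : ZFSet.{u}, i.pair a ∈ e := by
      constructor
      · rintro ⟨i, h1, h2⟩
        obtain ⟨a', h3, rfl⟩ := emb_cFun_mem hM he h1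
        rw [he.1 _ _ h3 _ h2]
        exact ⟨rfl, i, h2⟩
      · rintro ⟨rfl, i, h⟩
        obtain ⟨n, rfl⟩ := mem_nats.1 (he.mem h).1
        have := (emb_pair_mem j hM).2 h
        rw [emb_nat j hM] at this
        exact ⟨_, this, h⟩
    rw [← key]
    constructor
    · intro h
      obtain ⟨b', hb', a', ha', e1⟩ := hT1 e he _ h
      obtain ⟨rfl, rfl⟩ := pair_inj.1 e1
      exact (hT2 e he _ hb' _ ha').1 h
    · intro h
      obtain ⟨rfl, i, hi⟩ := key.1 h
      have ha := (he.mem hi).2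
      exact (hT2 e he _ ((emb_mem j hM).2 ha) _ (hlκ ha)).2 h
  · exact (transfer3 j hM (fun C O κ l => ∀ t ∈ C, ∀ p ∈ C,
      (∀ q ∈ t, ∃ a ∈ l, ∃ b ∈ κ, q = a.pair b) →
      (∀ q ∈ p, ∃ a ∈ κ, ∃ b ∈ l, q = a.pair b) → t.pair p ∈ O) (wO κ l) κ l).1
      (fun t _ p _ h1 h2 => mem_wO.2 ⟨h1, h2⟩) _ (hTM e he) _ hp (hT1 e he) hp1
  · exact fun i a h a' h' => hci _ _ _ (hp2 _ _ h) (hp2 _ _ h')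
  · obtain ⟨b, hb, -⟩ := hcf.2 _ (hls α hα)
    exact ⟨b, hp3 _ _ hb (hjκ.1.mem_trans (hcβ _ _ hb) hβ) ((emb_mem j hM).2 hα)⟩

theorem IsSeed.agree (h : IsSeed j κ l p T) {e₀ : ZFSet.{u}} (h₀ : CFun nats l e₀)
    (he : CFun nats l e)
    (he' : CFun nats l e')
    (hs : ∀ i ξ : ZFSet.{u}, i.pair ξ ∈ e₀ → ∃ k : ZFSet.{u}, k.pair ξ ∈ e)
    (hs' : ∀ i ξ : ZFSet.{u}, i.pair ξ ∈ e₀ → ∃ k : ZFSet.{u}, k.pair ξ ∈ e') :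
    Agree (j.toFun e₀) (T e) (T e') := by
  intro i ξ hi
  obtain ⟨a, ha, rfl⟩ := emb_cFun_mem h.trans h₀ hi
  refine ⟨fun v hv => ?_, fun v hv => ?_⟩
  · obtain ⟨e1, -⟩ := (h.mem_iff he).1 hv
    obtain rfl := (emb_inj j h.trans).1 e1
    exact (h.mem_iff he').2 ⟨rfl, hs' _ _ ha⟩
  · obtain ⟨e1, -⟩ := (h.mem_iff he').1 hv
    obtain rfl := (emb_inj j h.trans).1 e1
    exact (h.mem_iff he).2 ⟨rfl, hs _ _ ha⟩

theorem IsSeed.mem_emb_of_supp (h : IsSeed j κ l p T) {e₀ X : ZFSet.{u}} (h₀ : CFun nats l e₀)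
    (he : CFun nats l e) (he' : CFun nats l e')
    (hs : ∀ i ξ : ZFSet.{u}, i.pair ξ ∈ e₀ → ∃ k : ZFSet.{u}, k.pair ξ ∈ e)
    (hs' : ∀ i ξ : ZFSet.{u}, i.pair ξ ∈ e₀ → ∃ k : ZFSet.{u}, k.pair ξ ∈ e')
    (hX : Supp (wO κ l) e₀ X) (hm : (T e).pair p ∈ j.toFun X) : (T e').pair p ∈ j.toFun X :=
  (transfer3 j h.trans (fun _ a b c => Supp a b c) (wO κ l) e₀ X).1 hX _ _ (h.mem_emb he) _
    (h.mem_emb he') (h.agree h₀ he he' hs hs') hm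

theorem mem_wE_of {X : ZFSet.{u}} (he : CFun nats l e) (hX : X ⊆ wO κ l) (hs : Supp (wO κ l) e X)
    (hm : (T e).pair p ∈ j.toFun X) : X ∈ wE j κ l p T :=
  mem_sep.2 ⟨mem_powerset.2 hX, e, he, hs, hm⟩

theorem IsSeed.exists_mem_wE (h : IsSeed j κ l p T)
    (φ : ZFSet.{u} → ZFSet.{u} → ZFSet.{u} → ZFSet.{u} → Prop)
    [hφ : Dfn (fun _ (v : Fin 4 → ZFSet.{u}) => φ (v 0) (v 1) (v 2) (v 3))] (x y : ZFSet.{u})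
    {S : Set ZFSet.{u}} (hS : S.Countable) (hSl : ∀ ξ ∈ S, ξ ∈ l)
    (hsupp : ∀ t t' q : ZFSet.{u}, t.pair q ∈ wO κ l → t'.pair q ∈ wO κ l →
      (∀ ξ ∈ S, ∀ v, ξ.pair v ∈ t ↔ ξ.pair v ∈ t') → φ x y t q → φ x y t' q)
    (hm : ∀ e, CFun nats l e → (∀ b a : ZFSet.{u}, b.pair a ∈ T e ↔ b = j.toFun a ∧ a ∈ S) →
      φ (j.toFun x) (j.toFun y) (T e) p) :
    ∃ X ∈ wE j κ l p T, ∀ t q : ZFSet.{u}, t.pair q ∈ X → φ x y t q := by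
  obtain ⟨e, he, hSe⟩ := exists_cFun hS hSl
  let X := ZFSet.sep (fun o => ∀ t q : ZFSet.{u}, o = t.pair q → φ x y t q) (wO κ l)
  have hX : ∀ t q : ZFSet.{u}, t.pair q ∈ X ↔ t.pair q ∈ wO κ l ∧ φ x y t q := by
    intro t q
    rw [mem_sep]
    refine and_congr_right fun _ => ⟨fun h => h t q rfl, fun h t' q' e => ?_⟩
    obtain ⟨rfl, rfl⟩ := pair_inj.1 e
    exact h
  refine ⟨X, mem_wE_of he (fun o => fun ho => (mem_sep.1 ho).1) ?_ ?_, fun t q htq =>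
    ((hX t q).1 htq).2⟩
  · intro t q htq t' ht'q hag hx
    refine (hX _ _).2 ⟨ht'q, hsupp t t' q htq ht'q (fun ξ hξ v => ?_) ((hX _ _).1 hx).2⟩
    obtain ⟨i, hi⟩ := (hSe ξ).1 hξ
    exact ⟨(hag i ξ hi).1 v, (hag i ξ hi).2 v⟩
  · have inst : ∀ {n : ℕ} (a b c d : (Fin n → ZFSet.{u}) → ZFSet.{u}) [IsVar a] [IsVar b] [IsVar c]
        [IsVar d], Dfn (fun _ v => φ (a v) (b v) (c v) (d v)) :=
      fun a b c d => Dfn.subst4 (F := fun _ => φ) hφ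
    refine (transfer4 j h.trans (fun C O X x y => ∀ t ∈ C, ∀ q ∈ C, t.pair q ∈ O → φ x y t q →
      t.pair q ∈ X) (wO κ l) X x y).1 (fun t _ q _ h1 h2 => (hX t q).2 ⟨h1, h2⟩) (T e)
        (h.mem_class he) p
      (h.trans.of_pair_mem (j.maps _ trivial) (h.mem_emb he)).2 (h.mem_emb he)
        (hm e he fun b a => ?_)
    rw [h.mem_iff he, hSe]

end Derivation

section WitOfSeed

variable {M : Set ZFSet.{u}} {j : ElemEmb (Set.univ : Set ZFSet.{u}) M} {κ l A p : ZFSet.{u}}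
  {T : ZFSet.{u} → ZFSet.{u}}

theorem IsSeed.witFip (h : IsSeed j κ l p T) : WitFip M nats (wO κ l) (wE j κ l p T) := by
  intro g _ hg
  have hX : ∀ X : {X : ZFSet.{u} // ∃ i : ZFSet.{u}, i.pair X ∈ g}, ∃ e, CFun nats l e ∧
      Supp (wO κ l) e X ∧ (T e).pair p ∈ j.toFun X := by
    rintro ⟨X, i, hi⟩
    exact (mem_sep.1 (hg.mem hi).2).2
  choose s hs hs1 hs2 using hX
  have hc : {X : ZFSet.{u} | ∃ i : ZFSet.{u}, i.pair X ∈ g}.Countable := hg.countable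
  have : Countable {X : ZFSet.{u} // ∃ i : ZFSet.{u}, i.pair X ∈ g} := hc.to_subtype
  obtain ⟨e, he, hse⟩ := exists_cFun (l := l)
    (S := ⋃ X, {ξ : ZFSet.{u} | ∃ i : ZFSet.{u}, i.pair ξ ∈ s X})
    (Set.countable_iUnion fun X => (hs X).countable) (fun ξ hξ => by
      obtain ⟨X, i, hi⟩ := Set.mem_iUnion.1 hξ
      exact ((hs X).mem hi).2)
  obtain ⟨o, ho, h1⟩ := (transfer2 j h.trans (fun _ g O => ∃ o ∈ O, ∀ i X : ZFSet.{u},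
    i.pair X ∈ g → o ∈ X) g (wO κ l)).2 ⟨_, h.mem_emb he, fun i Y hY => by
      obtain ⟨X, hX, rfl⟩ := emb_cFun_mem h.trans hg hY
      exact h.mem_emb_of_supp (hs ⟨X, i, hX⟩) (hs ⟨X, i, hX⟩) he (fun k ξ hk => ⟨k, hk⟩)
        (fun k ξ hk => (hse ξ).1 (Set.mem_iUnion.2 ⟨_, k, hk⟩)) (hs1 _) (hs2 _)⟩
  exact ⟨o, ho, h1⟩

theorem IsSeed.witUlt (h : IsSeed j κ l p T) : WitUlt M nats l (wO κ l) (wE j κ l p T) := by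
  intro X _ Y _ e _ he hX hY hXO hYO hU
  rcases (transfer3 j h.trans (fun _ O X Y => ∀ o ∈ O, o ∈ X ∨ o ∈ Y) (wO κ l) X Y).1 hU _
    (h.mem_emb he) with h1 | h1
  · exact .inl (mem_wE_of he hXO hX h1)
  · exact .inr (mem_wE_of he hYO hY h1)

theorem IsSeed.witVal (h : IsSeed j κ l p T) : WitVal κ l (wE j κ l p T) := by
  intro ξ hξ
  refine h.exists_mem_wE (fun κ ξ t _ => ∃ v ∈ κ, ξ.pair v ∈ t ∧ ∀ v', ξ.pair v' ∈ t → v' = v) κ ξ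
    (Set.countable_singleton ξ) (by rintro _ rfl; exact hξ) ?_ ?_
  · rintro t t' q - - hag ⟨v, hv, h1, h2⟩
    exact ⟨v, hv, (hag _ rfl _).1 h1, fun v' hv' => h2 v' ((hag _ rfl _).2 hv')⟩
  · exact fun e he hT => ⟨ξ, h.le hξ, (hT _ _).2 ⟨rfl, rfl⟩, fun v' hv' => ((hT _ _).1 hv').2⟩

theorem IsSeed.witMono (h : IsSeed j κ l p T) : WitMono l (wE j κ l p T) := by
  intro ξ hξ η hη
  refine h.exists_mem_wE (fun ξ η t _ => ∀ v, η.pair v ∈ t → ∀ v', ξ.pair v' ∈ t → v ∈ v') ξ η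
    (S := {ξ, η}) (Set.toFinite _).countable ?_ ?_ ?_
  · rintro _ (rfl | rfl)
    · exact hξ
    · exact h.ord.mem_trans hη hξ
  · exact fun t t' q _ _ hag h1 v hv v' hv' =>
      h1 v ((hag _ (.inr rfl) _).2 hv) v' ((hag _ (.inl rfl) _).2 hv')
  · intro e he hT v hv v' hv'
    rwa [← (emb_inj j h.trans).1 ((hT _ _).1 hv).1, ← (emb_inj j h.trans).1 ((hT _ _).1 hv').1]

theorem IsSeed.witNormal (h : IsSeed j κ l p T) :
    WitNormal M nats l (wO κ l) (wE j κ l p T) := by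
  rintro ξ hξ G - e - he hG ⟨X, hX, hXG⟩
  obtain ⟨-, e₁, he₁, hs₁, hm₁⟩ := mem_sep.1 hX
  obtain ⟨e', he', hse'⟩ := exists_cFun (l := l)
    (S := {η | ∃ i : ZFSet.{u}, i.pair η ∈ e} ∪ {η | ∃ i : ZFSet.{u}, i.pair η ∈ e₁} ∪ {ξ})
    ((he.countable.union he₁.countable).union (Set.countable_singleton ξ)) (by
      rintro η ((⟨i, hi⟩ | ⟨i, hi⟩) | rfl)
      · exact (he.mem hi).2
      · exact (he₁.mem hi).2
      · exact hξ)
  have hm' := h.mem_emb_of_supp he₁ he₁ he' (fun k ξ hk => ⟨k, hk⟩)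
    (fun k ξ hk => (hse' ξ).1 (.inl (.inr ⟨k, hk⟩))) hs₁ hm₁
  obtain ⟨_, η, hηG, rfl, hηv⟩ := (transfer3 j h.trans (fun _ X G ξ => ∀ t p : ZFSet.{u},
    t.pair p ∈ X → ∃ q v : ZFSet.{u}, q.pair v ∈ G ∧
      (q = t.pair p ∧ ∀ v', ξ.pair v' ∈ t → v ∈ v')) X G ξ).1 hXG _ _ hm'
  have hηξ : η ∈ ξ := hηv ξ ((h.mem_iff he').2 ⟨rfl, (hse' ξ).1 (.inr rfl)⟩)
  refine ⟨η, hηξ, h.exists_mem_wE (fun G η t q => ∀ v, η.pair v ∈ t → (t.pair q).pair v ∈ G) G η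
    (S := {η | ∃ i : ZFSet.{u}, i.pair η ∈ e} ∪ {η})
    (he.countable.union (Set.countable_singleton η)) ?_ ?_ ?_⟩
  · rintro η ((⟨i, hi⟩) | rfl)
    · exact (he.mem hi).2
    · exact h.ord.mem_trans hηξ hξ
  · exact fun t t' q ht ht' hag h1 v hv => hG t q ht t' ht'
      (fun i ζ hi => ⟨fun v => (hag ζ (.inl ⟨i, hi⟩) v).1, fun v => (hag ζ (.inl ⟨i, hi⟩) v).2⟩)
      _ v (h1 v ((hag η (.inr rfl) v).2 hv)) rfl
  · intro e'' he'' hT v hv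
    obtain rfl := (emb_inj j h.trans).1 ((hT _ _).1 hv).1
    refine (transfer3 j h.trans (fun _ a b c => SuppRel a b c) (wO κ l) e G).1 hG _ _
      (h.mem_emb he') _ (h.mem_emb he'') (h.agree he he' he''
        (fun i ζ hi => (hse' ζ).1 (.inl (.inl ⟨i, hi⟩))) fun i ζ hi => ?_) _ _ hηG rfl
    exact ((h.mem_iff he'').1 ((hT _ ζ).2 ⟨rfl, .inl ⟨i, hi⟩⟩)).2

theorem IsSeed.witCrit (h : IsSeed j κ l p T) (hκ : κ ∈ l) : WitCrit κ (wE j κ l p T) := by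
  intro ξ hξ
  refine h.exists_mem_wE (fun ξ _ t _ => ∀ v, ξ.pair v ∈ t → v = ξ) ξ ξ
    (Set.countable_singleton ξ) (by rintro _ rfl; exact h.ord.mem_trans hξ hκ) ?_ ?_
  · exact fun t t' q _ _ hag h1 v hv => h1 v ((hag _ rfl _).2 hv)
  · intro e he hT v hv
    rw [h.crit.2.2 ξ hξ]
    exact ((hT _ _).1 hv).2

theorem IsSeed.witAgree (h : IsSeed j κ l p T) : WitAgree l (j.toFun A) (wE j κ l p T) := by
  have hA : ∀ X ∈ wE j κ l p T, ∀ t q ξ v : ZFSet.{u}, t.pair q ∈ X → ξ.pair v ∈ t →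
      (v ∈ A ↔ v ∈ j.toFun A) := by
    intro X hX t q ξ v ht hv
    obtain ⟨a, -, b, hb, e⟩ := (mem_wO.1 (mem_powerset.1 (mem_sep.1 hX).1 ht)).1 _ hv
    obtain ⟨-, rfl⟩ := pair_inj.1 e
    have := emb_mem j h.trans (x := v) (y := A)
    rwa [h.crit.2.2 v hb, Iff.comm] at this
  intro ξ hξ
  refine ⟨fun hξA => ?_, fun hξA => ?_⟩
  · obtain ⟨X, hX, h1⟩ := h.exists_mem_wE (fun A ξ t _ => ∀ v, ξ.pair v ∈ t → v ∈ A) A ξ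
      (Set.countable_singleton ξ) (by rintro _ rfl; exact hξ)
      (fun t t' q _ _ hag h1 v hv => h1 v ((hag _ rfl _).2 hv)) (fun e he hT v hv => by
        rw [((hT _ _).1 hv).2]
        exact hξA)
    exact ⟨X, hX, fun t q ht v hv => (hA X hX t q ξ v ht hv).1 (h1 t q ht v hv)⟩
  · obtain ⟨X, hX, h1⟩ := h.exists_mem_wE (fun A ξ t _ => ∀ v, ξ.pair v ∈ t → v ∉ A) A ξ
      (Set.countable_singleton ξ) (by rintro _ rfl; exact hξ)
      (fun t t' q _ _ hag h1 v hv => h1 v ((hag _ rfl _).2 hv)) (fun e he hT v hv => by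
        rw [((hT _ _).1 hv).2]
        exact hξA)
    exact ⟨X, hX, fun t q ht v hv hvA => h1 t q ht v hv ((hA X hX t q ξ v ht hv).2 hvA)⟩

theorem IsSeed.witFine (h : IsSeed j κ l p T) : WitFine l (wE j κ l p T) := by
  intro α hα
  refine h.exists_mem_wE (fun α _ _ q => ∃ i : ZFSet.{u}, i.pair α ∈ q ∧ i = i) α α
    Set.countable_empty (fun _ h => h.elim) (fun _ _ _ _ _ _ h => h) fun e he _ => ?_
  obtain ⟨i, hi⟩ := h.fine α hα
  exact ⟨i, hi, rfl⟩

theorem IsSeed.witSmall (h : IsSeed j κ l p T) : WitSmall κ (wE j κ l p T) :=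
  h.exists_mem_wE (fun κ _ _ q => Func q ∧ ∃ β ∈ κ, ∀ i a : ZFSet.{u}, i.pair a ∈ q → i ∈ β) κ κ
    Set.countable_empty (fun _ h => h.elim) (fun _ _ _ _ _ _ h => h) fun _ _ _ => ⟨h.func, h.bdd⟩

theorem IsSeed.wit (h : IsSeed j κ l p T) (hκ : κ ∈ l) (hO : wO κ l ∈ M) :
    Wit M nats κ l (j.toFun A) (wO κ l) (wE j κ l p T) := by
  refine ⟨fun o ho => ?_, fun X hX => mem_powerset.1 (mem_sep.1 hX).1, h.witFip, h.witUlt, h.witVal,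
    h.witMono, h.witNormal, h.witCrit hκ, h.witAgree, h.witFine, h.witSmall⟩
  obtain ⟨t, -, q, -, rfl⟩ := mem_prod.1 ho
  have := h.trans.of_pair_mem hO ho
  exact ⟨t, this.1, q, this.2, rfl⟩

theorem IsCrit.exists_wit (hM : TransClass M) (hj : IsCrit j κ) {y : ZFSet.{u}} (hy : y.IsOrdinal)
    (hsucc : ∀ x ∈ y, insert x x ∈ y) (hl : l.IsOrdinal) (hly : l ∈ y) (hκ : κ ∈ l)
    (hyκ : y ∈ j.toFun κ) (hcov : WCovers M j.toFun κ y) (hV : VIncl M y) :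
    ∃ O ∈ M, ∃ E ∈ M, Wit M nats κ l (j.toFun A) O E := by
  have hjκ := ((emb_isOrd j hM).2 hj.1).isOrdinal
  have hlr : l.rank < y.rank := rank_lt_of_mem hly
  have hs : ∀ {o : Ordinal.{u}}, o < y.rank → Order.succ o < y.rank := hy.succ_lt_rank hsucc
  have hκl : κ.rank ≤ l.rank := (rank_lt_of_mem hκ).le
  have hp : ∀ {x z : ZFSet.{u}}, x.rank < y.rank → z.rank < y.rank → (x.prod z).rank < y.rank := by
    intro x z hx hz
    exact (rank_prod_le x z).trans_lt (hs (hs (max_lt hx hz)))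
  have hpw : ∀ {x : ZFSet.{u}}, x.rank < y.rank → x.powerset.rank < y.rank := by
    intro x hx
    rw [rank_powerset]
    exact hs hx
  have hOr : (wO κ l).rank < y.rank :=
    hp (hpw (hp hlr (hκl.trans_lt hlr))) (hpw (hp (hκl.trans_lt hlr) hlr))
  have hO : wO κ l ∈ M := hV _ trivial hOr
  obtain ⟨p, T, h⟩ := hj.exists_isSeed (l := l) hM hl.isTransitive
    (fun x => fun hx => hjκ.isTransitive.mem_trans (hy.isTransitive.mem_trans hx hly) hyκ)
    (by
      obtain ⟨s, hs, h1, h2⟩ := hcov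
      exact ⟨s, hs, fun α hα => h1 α (hy.isTransitive.mem_trans hα hly), h2⟩)
    (fun e he => hV _ trivial (by
      refine (rank_mono_of_subset (y := (nats.prod l)) ?_).trans_lt ?_
      · exact fun q => fun hq => mem_prod.2 (he.2 q hq)
      · exact hp ((rank_lt_of_mem (hj.nats_mem hM)).trans_le hκl |>.trans hlr) hlr))
  refine ⟨_, hO, wE j κ l p T, hV _ trivial ?_, h.wit hκ hO⟩
  exact (rank_mono_of_subset fun X => fun hX => (mem_sep.1 hX).1).trans_lt (hpw hOr)

end WitOfSeed

section Reflection

theorem WSCinSet.nats_mem {δ : ZFSet.{u}} (hδ : IsCard δ) (h : WSCinSet δ δ) : nats ∈ δ := by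
  obtain ⟨κ, hκ, -, M, j, y, hM, hj, -⟩ := h (graph δ id) (funcSelf_graph fun _ h => h)
  exact hδ.1.1.mem_trans (hj.nats_mem hM) hκ

theorem IsCard.exists_limit {δ l : ZFSet.{u}} (hδ : IsCard δ) (hω : nats ∈ δ) (hl : l ∈ δ) :
    ∃ y ∈ δ, y.IsOrdinal ∧ l ∈ y ∧ ∀ x ∈ y, insert x x ∈ y := by
  have hlo := hδ.1.isOrdinal.mem hl
  refine ⟨(l.rank + Ordinal.omega0).toZFSet, IsOrdinal.mem_of_card_lt (isOrdinal_toZFSet _)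
    hδ.1.isOrdinal ?_, isOrdinal_toZFSet _, ?_, fun x hx => ?_⟩
  · have h1 := hδ.card_lt hl
    have h2 := hδ.card_lt hω
    rw [card_nats] at h2
    rw [card_eq_card_rank hlo] at h1
    simpa using Cardinal.add_lt_of_lt h2.le h1 h2
  · rw [← hlo.rank_lt_iff_mem (isOrdinal_toZFSet _), Ordinal.rank_toZFSet]
    exact lt_add_of_pos_right _ Ordinal.omega0_pos
  · obtain ⟨o, ho, rfl⟩ := Ordinal.mem_toZFSet_iff.1 hx
    rw [← Ordinal.toZFSet_add_one]
    exact Ordinal.mem_toZFSet_iff.2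
      ⟨_, (Ordinal.isSuccLimit_add _ Ordinal.isSuccLimit_omega0).add_one_lt ho, rfl⟩

theorem woodinSC_of_WSCinSet {δ : ZFSet.{u}} (hδ : IsCard δ) (h : WSCinSet δ δ) : WoodinSC δ := by
  have hω := h.nats_mem hδ
  refine ⟨hδ, fun A _ _ => ?_⟩
  by_contra hn
  have hex : ∀ κ, κ ∈ δ → ∃ l y, l ∈ δ ∧ l.IsOrdinal ∧ κ ∈ l ∧ y ∈ δ ∧ y.IsOrdinal ∧ l ∈ y ∧
      (∀ x ∈ y, insert x x ∈ y) ∧ ¬ ∃ O E, Wit Set.univ nats κ l A O E := by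
    intro κ hκ
    have h1 : ¬ LtSCForIn Set.univ κ δ A := fun h1 => hn ⟨κ, hκ, h1⟩
    simp only [LtSCForIn, not_forall] at h1
    obtain ⟨lam, hle, hlam, h1⟩ := h1
    have hl := hδ.succ_mem hω hlam
    obtain ⟨y, hy, hyo, hly, hs⟩ := hδ.exists_limit hω hl
    refine ⟨insert lam lam, y, hl, hδ.1.isOrdinal.mem hl, ?_, hy, hyo, hly, hs, ?_⟩
    · rw [ZFSet.mem_insert_iff]
      exact hle.symm
    · rintro ⟨O, E, hW⟩
      exact h1 (hW.lamSCFor (hδ.1.isOrdinal.mem hlam) hle)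
  choose! L Y hL hLo hκL hY hYo hLY hYs hW using hex
  obtain ⟨κ, hκ, hcl, M, j, y, hM, hj, hy, hcov, hV⟩ := h (graph δ Y) (funcSelf_graph hY)
  have hyκ : y ∈ j.toFun κ := (transfer2 j hM (fun _ f κ => ∀ x y : ZFSet.{u}, x.pair y ∈ f →
    x ∈ κ → y ∈ κ) (graph δ Y) κ).1 hcl _ _ hy (hj.mem_emb hM)
  obtain ⟨hys, hyo, l, -, hly, hκl, hlo, hnW⟩ := (transfer4 j hM (fun C f g A ω =>
    ∀ κ y : ZFSet.{u}, κ.pair y ∈ f → (∀ x ∈ y, ∃ z ∈ y, z = insert x x) ∧ IsOrd y ∧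
      ∃ l, κ.pair l ∈ g ∧ (l ∈ y ∧ κ ∈ l ∧ IsOrd l ∧ ¬ ∃ O ∈ C, ∃ E ∈ C, Wit C ω κ l A O E))
    (graph δ Y) (graph δ L) A nats).1 (by
      intro κ y hy
      obtain ⟨hκ, rfl⟩ := pair_mem_graph.1 hy
      refine ⟨fun x hx => ⟨_, hYs κ hκ x hx, rfl⟩, isOrd_iff.2 (hYo κ hκ), L κ,
        pair_mem_graph.2 ⟨hκ, rfl⟩, hLY κ hκ, hκL κ hκ, isOrd_iff.2 (hLo κ hκ), ?_⟩
      rintro ⟨O, -, E, -, h⟩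
      exact hW κ hκ ⟨O, E, h⟩) _ _ hy
  rw [emb_nats j hM] at hnW
  refine hnW (hj.exists_wit hM hyo.isOrdinal (fun x hx => ?_) hlo.isOrdinal hly hκl hyκ hcov hV)
  obtain ⟨z, hz, rfl⟩ := hys x hx
  exact hz

end Reflection

end Proof

/-- **Proposition.**  `F` is a proper filter on `δ` iff `δ` is Woodin for
strong compactness. -/
theorem filter_iff_wsc (δ : ZFSet) (hδ : IsCard δ) :
    IsProperFilterOn δ (Fset δ) ↔ WoodinSC δ :=
  (isProperFilterOn_iff hδ.1.isOrdinal).trans ⟨woodinSC_of_WSCinSet hδ, WSCinSet_of_woodinSC⟩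

end WSC
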